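/- Let F be a finite field of characteristic different from 2. Each pair consisting of a symmetric matrix and a skew-symmetric matrix of the same size over F is congruent to a direct sum, uniquely determined up to permutation of summands, consisting of any number of summands of the following types: (i) ([F_n ⟍ F_nᵀ], [G_n ⟍ −G_nᵀ]); (ii) ([I_n ⟍ I_n], [Φ ⟍ −Φᵀ]), where Φ is an n×n Frobenius block such that p_Φ(x) ∉ F[x²] and Φ is not J_k(0) with k odd, and Φ is determined up to replacement by the Frobenius block Ψ with χ_Ψ(x) = (−1)^{deg χ_Φ} χ_Φ(−x); (iii) (Φ₋₁, Φ₋₁Φ), where Φ is a Frobenius block such that p_Φ(x) ∈ F[x²]; (iv) ([J_n(0) ⟍ J_n(0)ᵀ], [I_n ⟍ −I_n]) with n odd; (v) for each n = 1,2,…: any number of summands C_n and at most one summand ζC_n, where ζ is a fixed nonsquare of F. -/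

import Mathlib

open Polynomial Matrix

namespace Can

noncomputable section

abbrev Mat (F : Type*) (n : ℕ) := Matrix (Fin n) (Fin n) F

variable {F : Type*} [Field F]

/-- conjugate transpose w.r.t. an involution σ -/
def ctr (σ : F →+* F) {m n : ℕ} (A : Matrix (Fin m) (Fin n) F) : Matrix (Fin n) (Fin m) F :=
  (A.map σ)ᵀ

/-- congruence: SᵀAS = B for a nonsingular S -/
def Congruent {n : ℕ} (A B : Mat F n) : Prop :=
  ∃ S : Mat F n, IsUnit S.det ∧ Sᵀ * A * S = B

/-- *congruence: S*AS = B for a nonsingular S -/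
def StarCongruent (σ : F →+* F) {n : ℕ} (A B : Mat F n) : Prop :=
  ∃ S : Mat F n, IsUnit S.det ∧ ctr σ S * A * S = B

/-- a square-matrix "summand" of unspecified size -/
abbrev Block (F : Type*) := Σ n : ℕ, Mat F n

def castMat {m n : ℕ} (h : m = n) (A : Mat F m) : Mat F n :=
  Matrix.reindex (finCongr h) (finCongr h) A

def BCong (X Y : Block F) : Prop :=
  ∃ h : X.1 = Y.1, Congruent (castMat h X.2) Y.2

def BStarCong (σ : F →+* F) (X Y : Block F) : Prop :=
  ∃ h : X.1 = Y.1, StarCongruent σ (castMat h X.2) Y.2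

/-- direct sum of a list of blocks -/
def bsum : List (Block F) → Block F
  | [] => ⟨0, 0⟩
  | X :: L => ⟨X.1 + (bsum L).1,
      Matrix.reindex finSumFinEquiv finSumFinEquiv (Matrix.fromBlocks X.2 0 0 (bsum L).2)⟩

/-- pairs of square matrices of the same size -/
abbrev PBlock (F : Type*) := Σ n : ℕ, Mat F n × Mat F n

def PCong (X Y : PBlock F) : Prop :=
  ∃ h : X.1 = Y.1, ∃ S : Mat F Y.1, IsUnit S.det ∧
    Sᵀ * castMat h X.2.1 * S = Y.2.1 ∧ Sᵀ * castMat h X.2.2 * S = Y.2.2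

def PStarCong (σ : F →+* F) (X Y : PBlock F) : Prop :=
  ∃ h : X.1 = Y.1, ∃ S : Mat F Y.1, IsUnit S.det ∧
    ctr σ S * castMat h X.2.1 * S = Y.2.1 ∧ ctr σ S * castMat h X.2.2 * S = Y.2.2

def psum : List (PBlock F) → PBlock F
  | [] => ⟨0, (0, 0)⟩
  | X :: L =>
      ⟨X.1 + (psum L).1,
        (Matrix.reindex finSumFinEquiv finSumFinEquiv (Matrix.fromBlocks X.2.1 0 0 (psum L).2.1),
         Matrix.reindex finSumFinEquiv finSumFinEquiv (Matrix.fromBlocks X.2.2 0 0 (psum L).2.2))⟩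

/-- lower-triangular Jordan block -/
def J (F : Type*) [Field F] (n : ℕ) (lam : F) : Mat F n :=
  Matrix.of fun i j => if i = j then lam else if (i : ℕ) = (j : ℕ) + 1 then 1 else 0

/-- the companion (Frobenius) matrix of a polynomial -/
def companion (F : Type*) [Field F] (f : Polynomial F) : Mat F f.natDegree :=
  Matrix.of fun i j => if (i : ℕ) = (j : ℕ) + 1 then 1
    else if (j : ℕ) + 1 = f.natDegree then -f.coeff i else 0

/-- f ↦ f^∨ (with respect to the involution σ) -/
def dualPoly (σ : F →+* F) (f : Polynomial F) : Polynomial F :=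
  Polynomial.C (σ (f.coeff 0))⁻¹ * (f.map σ).reverse

/-- the skew sum [A ⟍ B] = [[0, B], [A, 0]] -/
def skewSum {k l : ℕ} (A : Matrix (Fin k) (Fin l) F) (B : Matrix (Fin l) (Fin k) F) :
    Mat F (l + k) :=
  Matrix.reindex finSumFinEquiv finSumFinEquiv (Matrix.fromBlocks 0 B A 0)

/-- the matrix Γₙ -/
def Gamma (F : Type*) [Field F] (n : ℕ) : Mat F n :=
  Matrix.of fun i j =>
    if (i : ℕ) + (j : ℕ) + 1 = n ∨ (i : ℕ) + (j : ℕ) = n then (-1 : F) ^ (n - 1 - (i : ℕ)) else 0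

/-- Fₙ = [I | 0], an (n−1)×n matrix -/
def Fmat (F : Type*) [Field F] (n : ℕ) : Matrix (Fin (n - 1)) (Fin n) F :=
  Matrix.of fun i j => if (i : ℕ) = (j : ℕ) then 1 else 0

/-- Gₙ = [0 | I], an (n−1)×n matrix -/
def Gmat (F : Type*) [Field F] (n : ℕ) : Matrix (Fin (n - 1)) (Fin n) F :=
  Matrix.of fun i j => if (i : ℕ) + 1 = (j : ℕ) then 1 else 0

/-- the pair Bₙ of symmetric n×n matrices -/
def Bpair (F : Type*) [Field F] (n : ℕ) : Mat F n × Mat F n :=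
  (Matrix.of fun i j => if (i : ℕ) + (j : ℕ) + 2 = n then 1 else 0,
   Matrix.of fun i j => if (i : ℕ) + (j : ℕ) + 1 = n then 1 else 0)

/-- the pair Cₙ of a symmetric and a skew-symmetric n×n matrix -/
def Cpair (F : Type*) [Field F] (n : ℕ) : Mat F n × Mat F n :=
  if Odd n then
    (Matrix.of fun i j => if (i : ℕ) + (j : ℕ) + 1 = n then 1 else 0,
     Matrix.of fun i j =>
       if (i : ℕ) + (j : ℕ) + 2 = n ∧ i < j then 1
       else if (i : ℕ) + (j : ℕ) + 2 = n ∧ j < i then -1 else 0)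
  else
    (Matrix.of fun i j => if (i : ℕ) + (j : ℕ) + 2 = n then 1 else 0,
     Matrix.of fun i j =>
       if (i : ℕ) + (j : ℕ) + 1 = n ∧ i < j then 1
       else if (i : ℕ) + (j : ℕ) + 1 = n ∧ j < i then -1 else 0)

/-- at most one entry of the list satisfies P -/
def AtMostOne {α : Type*} (P : α → Prop) (L : List α) : Prop :=
  ¬ ∃ b₁ b₂ : α, List.Sublist [b₁, b₂] L ∧ P b₁ ∧ P b₂


section Stmt3
variable {F : Type*} [Field F]

/-- the pair ([Iₙ ⟍ Iₙ], [Φ ⟍ −Φᵀ]) attached to the characteristic polynomial χ of Φ -/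
def pairSkew3 (χ : Polynomial F) : PBlock F :=
  ⟨χ.natDegree + χ.natDegree,
    (skewSum (1 : Mat F χ.natDegree) (1 : Mat F χ.natDegree),
     skewSum (companion F χ) (-(companion F χ)ᵀ))⟩

/-- type (i): ([Fₙ ⟍ Fₙᵀ], [Gₙ ⟍ −Gₙᵀ]) -/
def T3i (b : PBlock F) : Prop :=
  ∃ n : ℕ, 0 < n ∧
    b = ⟨n + (n - 1), (skewSum (Fmat F n) (Fmat F n)ᵀ, skewSum (Gmat F n) (-(Gmat F n)ᵀ))⟩

/-- type (ii): ([Iₙ ⟍ Iₙ], [Φ ⟍ −Φᵀ]), p_Φ ∉ F[x²] and Φ not a singular Jordan block of odd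
size -/
def T3ii (b : PBlock F) : Prop :=
  ∃ (pp : Polynomial F) (l : ℕ), pp.Monic ∧ Irreducible pp ∧ 0 < l ∧
    (¬ ∃ g : Polynomial F, pp = g.comp (X ^ 2)) ∧ ¬ (pp = X ∧ Odd l) ∧
    b = pairSkew3 (pp ^ l)

/-- type (iii): (Φ₋₁, Φ₋₁Φ), p_Φ ∈ F[x²] -/
def T3iii (Phim1 : (q : Polynomial F) → Mat F q.natDegree) (b : PBlock F) : Prop :=
  ∃ (pp : Polynomial F) (l : ℕ), pp.Monic ∧ Irreducible pp ∧ 0 < l ∧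
    (∃ g : Polynomial F, pp = g.comp (X ^ 2)) ∧
    b = ⟨(pp ^ l).natDegree, (Phim1 (pp ^ l), Phim1 (pp ^ l) * companion F (pp ^ l))⟩

/-- type (iv): ([Jₙ(0) ⟍ Jₙ(0)ᵀ], [Iₙ ⟍ −Iₙ]), n odd -/
def T3iv (b : PBlock F) : Prop :=
  ∃ n : ℕ, Odd n ∧
    b = ⟨n + n, (skewSum (J F n 0) (J F n 0)ᵀ, skewSum (1 : Mat F n) (-1))⟩

/-- type (v), first kind: Cₙ -/
def T3va (b : PBlock F) : Prop := ∃ n : ℕ, 0 < n ∧ b = ⟨n, Cpair F n⟩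

/-- type (v), second kind: ζCₙ -/
def T3vb (ζ : F) (n : ℕ) (b : PBlock F) : Prop :=
  0 < n ∧ b = ⟨n, (ζ • (Cpair F n).1, ζ • (Cpair F n).2)⟩

def Canon3 (ζ : F) (Phim1 : (q : Polynomial F) → Mat F q.natDegree)
    (L : List (PBlock F)) : Prop :=
  (∀ b ∈ L, T3i b ∨ T3ii b ∨ T3iii Phim1 b ∨ T3iv b ∨ T3va b ∨ ∃ n, T3vb ζ n b) ∧
  ∀ n : ℕ, AtMostOne (T3vb ζ n) L

/-- a type (ii) summand may be replaced by the one with χ_Ψ(x) = (−1)^{deg χ_Φ} χ_Φ(−x) -/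
def Equiv3 (b c : PBlock F) : Prop :=
  b = c ∨
  ∃ (pp : Polynomial F) (l : ℕ), pp.Monic ∧ Irreducible pp ∧ 0 < l ∧
    (¬ ∃ g : Polynomial F, pp = g.comp (X ^ 2)) ∧ ¬ (pp = X ∧ Odd l) ∧
    b = pairSkew3 (pp ^ l) ∧
    c = pairSkew3 (C ((-1 : F) ^ (pp ^ l).natDegree) * (pp ^ l).comp (-X))

/-- simultaneous congruence of two pairs of matrices with arbitrary index types -/
def Cg {ι κ : Type*} [Fintype ι] [Fintype κ] [DecidableEq ι] [DecidableEq κ]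
    (A B : Matrix ι ι F) (A' B' : Matrix κ κ F) : Prop :=
  ∃ (S : Matrix ι κ F) (R : Matrix κ ι F), S * R = 1 ∧ R * S = 1 ∧
    Sᵀ * A * S = A' ∧ Sᵀ * B * S = B'

section Cg
variable {ι κ μ ν : Type*} [Fintype ι] [Fintype κ] [Fintype μ] [Fintype ν] [DecidableEq ι]
  [DecidableEq κ] [DecidableEq μ] [DecidableEq ν]
  {A B : Matrix ι ι F} {A' B' : Matrix κ κ F} {A'' B'' : Matrix μ μ F} {C D : Matrix ν ν F}

theorem Cg.refl (A B : Matrix ι ι F) : Cg A B A B := ⟨1, 1, by simp⟩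

theorem Cg.symm (h : Cg A B A' B') : Cg A' B' A B := by
  obtain ⟨S, R, h1, h2, rfl, rfl⟩ := h
  have h3 : Rᵀ * Sᵀ = 1 := by rw [← transpose_mul, h1, transpose_one]
  refine ⟨R, S, h2, h1, ?_, ?_⟩
  · rw [Matrix.mul_assoc, Matrix.mul_assoc, h1, Matrix.mul_one, ← Matrix.mul_assoc, h3,
      Matrix.one_mul]
  · rw [Matrix.mul_assoc, Matrix.mul_assoc, h1, Matrix.mul_one, ← Matrix.mul_assoc, h3,
      Matrix.one_mul]

theorem Cg.trans (h : Cg A B A' B') (h' : Cg A' B' A'' B'') : Cg A B A'' B'' := by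
  obtain ⟨S, R, h1, h2, rfl, rfl⟩ := h
  obtain ⟨S', R', h1', h2', rfl, rfl⟩ := h'
  refine ⟨S * S', R' * R, ?_, ?_, ?_, ?_⟩
  · rw [Matrix.mul_assoc, ← Matrix.mul_assoc S', h1', Matrix.one_mul, h1]
  · rw [Matrix.mul_assoc, ← Matrix.mul_assoc R, h2, Matrix.one_mul, h2']
  · simp only [transpose_mul, Matrix.mul_assoc]
  · simp only [transpose_mul, Matrix.mul_assoc]

theorem Cg.swap (h : Cg A B A' B') : Cg B A B' A' := by
  obtain ⟨S, R, h1, h2, h3, h4⟩ := h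
  exact ⟨S, R, h1, h2, h4, h3⟩

theorem Cg.smul (h : Cg A B A' B') (c : F) : Cg (c • A) (c • B) (c • A') (c • B') := by
  obtain ⟨S, R, h1, h2, rfl, rfl⟩ := h
  exact ⟨S, R, h1, h2, by simp, by simp⟩

theorem Cg.submatrix (A B : Matrix ι ι F) (e : κ ≃ ι) :
    Cg A B (A.submatrix e e) (B.submatrix e e) := by
  refine ⟨(1 : Matrix ι ι F).submatrix id e, (1 : Matrix ι ι F).submatrix e id, ?_, ?_, ?_, ?_⟩
  · rw [submatrix_mul_equiv]; simp
  · rw [← submatrix_mul _ _ _ _ _ Function.bijective_id]; simp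
  all_goals
    ext i j
    simp [Matrix.mul_apply, Matrix.one_apply]

theorem Cg.reindex (A B : Matrix ι ι F) (e : ι ≃ κ) :
    Cg A B (Matrix.reindex e e A) (Matrix.reindex e e B) := Cg.submatrix A B e.symm

theorem Cg.fromBlocks (h : Cg A B A' B') (h' : Cg A'' B'' C D) :
    Cg (Matrix.fromBlocks A 0 0 A'') (Matrix.fromBlocks B 0 0 B'') (Matrix.fromBlocks A' 0 0 C)
      (Matrix.fromBlocks B' 0 0 D) := by
  obtain ⟨S, R, h1, h2, rfl, rfl⟩ := h
  obtain ⟨S', R', h1', h2', rfl, rfl⟩ := h'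
  refine ⟨Matrix.fromBlocks S 0 0 S', Matrix.fromBlocks R 0 0 R', ?_, ?_, ?_, ?_⟩ <;>
    simp [fromBlocks_multiply, fromBlocks_transpose, *]

theorem Cg.fromBlocks_swap (A B : Matrix ι ι F) (A' B' : Matrix κ κ F) :
    Cg (Matrix.fromBlocks A 0 0 A') (Matrix.fromBlocks B 0 0 B') (Matrix.fromBlocks A' 0 0 A)
      (Matrix.fromBlocks B' 0 0 B) := by
  have := Cg.submatrix (Matrix.fromBlocks A 0 0 A') (Matrix.fromBlocks B 0 0 B')
    (Equiv.sumComm κ ι)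
  simpa using this

theorem Cg.fromBlocks_assoc (A B : Matrix ι ι F) (A' B' : Matrix κ κ F) (A'' B'' : Matrix μ μ F) :
    Cg (Matrix.fromBlocks (Matrix.fromBlocks A 0 0 A') 0 0 A'')
      (Matrix.fromBlocks (Matrix.fromBlocks B 0 0 B') 0 0 B'')
      (Matrix.fromBlocks A 0 0 (Matrix.fromBlocks A' 0 0 A''))
      (Matrix.fromBlocks B 0 0 (Matrix.fromBlocks B' 0 0 B'')) := by
  have := Cg.submatrix (Matrix.fromBlocks (Matrix.fromBlocks A 0 0 A') 0 0 A'')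
    (Matrix.fromBlocks (Matrix.fromBlocks B 0 0 B') 0 0 B'') (Equiv.sumAssoc ι κ μ).symm
  convert this using 1
  all_goals
    ext (i | i | i) (j | j | j) <;> simp

end Cg

/-- congruence of two blocks, phrased without casts -/
def PCg (X Y : PBlock F) : Prop := Cg X.2.1 X.2.2 Y.2.1 Y.2.2

theorem PCong.pcg {X Y : PBlock F} (h : PCong X Y) : PCg X Y := by
  obtain ⟨n, A, B⟩ := X
  obtain ⟨m, A', B'⟩ := Y
  obtain ⟨h, S, hS, h1, h2⟩ := h
  dsimp only at h
  subst h
  refine ⟨S, S⁻¹, Matrix.mul_nonsing_inv _ hS, Matrix.nonsing_inv_mul _ hS, ?_, ?_⟩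
  · simpa [castMat] using h1
  · simpa [castMat] using h2

theorem PCg.pcong {X Y : PBlock F} (h : PCg X Y) : PCong X Y := by
  obtain ⟨n, A, B⟩ := X
  obtain ⟨m, A', B'⟩ := Y
  obtain ⟨S, R, h1, h2, h3, h4⟩ := h
  dsimp only at *
  have hnm : n = m := by
    have := Matrix.square_of_invertible S R h1 h2
    simpa using this
  subst hnm
  refine ⟨rfl, S, Matrix.isUnit_det_of_left_inverse h2, ?_, ?_⟩
  · simpa [castMat] using h3
  · simpa [castMat] using h4

theorem PCg.refl (X : PBlock F) : PCg X X := Cg.refl _ _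
theorem PCg.symm {X Y : PBlock F} (h : PCg X Y) : PCg Y X := Cg.symm h
theorem PCg.trans {X Y Z : PBlock F} (h : PCg X Y) (h' : PCg Y Z) : PCg X Z := Cg.trans h h'

theorem cg_psum_cons (X : PBlock F) (L : List (PBlock F)) :
    Cg (fromBlocks X.2.1 0 0 (psum L).2.1) (fromBlocks X.2.2 0 0 (psum L).2.2)
      (psum (X :: L)).2.1 (psum (X :: L)).2.2 := Cg.reindex _ _ _

theorem PCg.cons {X Y : PBlock F} {L L' : List (PBlock F)} (h : PCg X Y)
    (h' : PCg (psum L) (psum L')) : PCg (psum (X :: L)) (psum (Y :: L')) :=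
  ((cg_psum_cons X L).symm.trans (Cg.fromBlocks h h')).trans (cg_psum_cons Y L')

theorem cg_psum_cons_cons (X Y : PBlock F) (L : List (PBlock F)) :
    Cg (fromBlocks (fromBlocks X.2.1 0 0 Y.2.1) 0 0 (psum L).2.1)
      (fromBlocks (fromBlocks X.2.2 0 0 Y.2.2) 0 0 (psum L).2.2)
      (psum (X :: Y :: L)).2.1 (psum (X :: Y :: L)).2.2 :=
  ((Cg.fromBlocks_assoc X.2.1 X.2.2 Y.2.1 Y.2.2 (psum L).2.1 (psum L).2.2).trans
    (Cg.fromBlocks (Cg.refl X.2.1 X.2.2) (cg_psum_cons Y L))).trans (cg_psum_cons X (Y :: L))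

theorem PCg.swap_cons (X Y : PBlock F) (L : List (PBlock F)) :
    PCg (psum (X :: Y :: L)) (psum (Y :: X :: L)) :=
  ((cg_psum_cons_cons X Y L).symm.trans
    (Cg.fromBlocks (Cg.fromBlocks_swap X.2.1 X.2.2 Y.2.1 Y.2.2)
      (Cg.refl (psum L).2.1 (psum L).2.2))).trans (cg_psum_cons_cons Y X L)

theorem PCg.perm {L L' : List (PBlock F)} (h : L.Perm L') : PCg (psum L) (psum L') := by
  induction h with
  | nil => exact PCg.refl _
  | cons x _ ih => exact PCg.cons (PCg.refl x) ih
  | swap x y l => exact PCg.swap_cons y x l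
  | trans _ _ ih1 ih2 => exact ih1.trans ih2

theorem cg_psum_append (L L₂ : List (PBlock F)) :
    Cg (fromBlocks (psum L).2.1 0 0 (psum L₂).2.1) (fromBlocks (psum L).2.2 0 0 (psum L₂).2.2)
      (psum (L ++ L₂)).2.1 (psum (L ++ L₂)).2.2 := by
  induction L with
  | nil =>
    have := Cg.submatrix (fromBlocks (0 : Matrix (Fin 0) (Fin 0) F) 0 0 (psum L₂).2.1)
      (fromBlocks (0 : Matrix (Fin 0) (Fin 0) F) 0 0 (psum L₂).2.2)
      (Equiv.emptySum (Fin 0) (Fin (psum L₂).1)).symm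
    have h (N : Matrix (Fin (psum L₂).1) (Fin (psum L₂).1) F) :
        (fromBlocks (0 : Matrix (Fin 0) (Fin 0) F) 0 0 N).submatrix
          (Equiv.emptySum (Fin 0) (Fin (psum L₂).1)).symm
          (Equiv.emptySum (Fin 0) (Fin (psum L₂).1)).symm = N := by
      ext i j; simp
    rw [h, h] at this
    exact this
  | cons X L ih =>
    exact ((Cg.fromBlocks (cg_psum_cons X L).symm (Cg.refl (psum L₂).2.1 (psum L₂).2.2)).trans
      ((Cg.fromBlocks_assoc X.2.1 X.2.2 _ _ _ _).trans
        (Cg.fromBlocks (Cg.refl X.2.1 X.2.2) ih))).trans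
      (cg_psum_cons X (L ++ L₂))

/-- the pair of bilinear forms has the Gram matrices `M`, `N` in a suitable basis -/
def Rep {V : Type*} [AddCommGroup V] [Module F V] {κ : Type*} (A B : LinearMap.BilinForm F V)
    (M N : Matrix κ κ F) : Prop :=
  ∃ b : Module.Basis κ F V, (∀ i j, A (b i) (b j) = M i j) ∧ ∀ i j, B (b i) (b j) = N i j

section Rep
variable {V : Type*} [AddCommGroup V] [Module F V] {A B : LinearMap.BilinForm F V}
variable {κ μ : Type*} [Fintype κ] [Fintype μ] [DecidableEq κ] [DecidableEq μ]

theorem form_sum_sum {α β : Type*} [Fintype α] [Fintype β] (A : LinearMap.BilinForm F V)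
    (c : α → F) (d : β → F) (v : α → V) (w : β → V) :
    A (∑ i, c i • v i) (∑ j, d j • w j) = ∑ i, ∑ j, c i * A (v i) (w j) * d j := by
  simp only [map_sum, LinearMap.sum_apply, map_smul, LinearMap.smul_apply, smul_eq_mul,
    Finset.mul_sum]
  rw [Finset.sum_comm]
  refine Finset.sum_congr rfl fun i _ => Finset.sum_congr rfl fun j _ => by ring

theorem Rep.cg {M N : Matrix κ κ F} {M' N' : Matrix μ μ F} (h : Rep A B M N)
    (h' : Cg M N M' N') : Rep A B M' N' := by
  obtain ⟨b, hA, hB⟩ := h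
  obtain ⟨S, R, h1, h2, rfl, rfl⟩ := h'
  let e : (κ → F) ≃ₗ[F] (μ → F) := Matrix.toLin'OfInv h1 h2
  let b' : Module.Basis μ F V := Module.Basis.ofEquivFun (b.equivFun ≪≫ₗ e)
  have hb' : ∀ j, b' j = ∑ i, S i j • b i := by
    intro j
    have : b' j = b.equivFun.symm (S *ᵥ Pi.single j 1) := by
      simp only [b', Module.Basis.coe_ofEquivFun]
      rfl
    rw [this, Module.Basis.equivFun_symm_apply]
    simp
  have key : ∀ (A : LinearMap.BilinForm F V) (M : Matrix κ κ F), (∀ i j, A (b i) (b j) = M i j) →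
      ∀ i j, A (b' i) (b' j) = (Sᵀ * M * S) i j := by
    intro A M hA i j
    rw [hb', hb', form_sum_sum, Finset.sum_comm]
    simp only [Matrix.mul_apply, Finset.sum_mul, transpose_apply, hA]
  exact ⟨b', key A M hA, key B N hB⟩

theorem Rep.cg_of {M N : Matrix κ κ F} {M' N' : Matrix μ μ F} (h : Rep A B M N)
    (h' : Rep A B M' N') : Cg M N M' N' := by
  obtain ⟨b, hA, hB⟩ := h
  obtain ⟨c, hcA, hcB⟩ := h'
  have key : ∀ (A : LinearMap.BilinForm F V) (M : Matrix κ κ F) (M' : Matrix μ μ F),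
      (∀ i j, A (b i) (b j) = M i j) → (∀ i j, A (c i) (c j) = M' i j) →
      (b.toMatrix c)ᵀ * M * b.toMatrix c = M' := by
    intro A M M' hA hA'
    ext i j
    rw [← hA', ← b.sum_toMatrix_smul_self c i, ← b.sum_toMatrix_smul_self c j, form_sum_sum,
      Finset.sum_comm]
    simp only [Matrix.mul_apply, Finset.sum_mul, transpose_apply, hA]
  exact ⟨b.toMatrix c, c.toMatrix b, Module.Basis.toMatrix_mul_toMatrix_flip _ _,
    Module.Basis.toMatrix_mul_toMatrix_flip _ _, key A M M' hA hcA, key B N N' hB hcB⟩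

/-- the restriction of a form to a submodule -/
abbrev res (A : LinearMap.BilinForm F V) (K : Submodule F V) : LinearMap.BilinForm F K :=
  A.restrict K

theorem Rep.sum_of_isCompl {α β : Type*} {U W : Submodule F V} (h : IsCompl U W)
    (hA : ∀ u ∈ U, ∀ w ∈ W, A u w = 0 ∧ A w u = 0) (hB : ∀ u ∈ U, ∀ w ∈ W, B u w = 0 ∧ B w u = 0)
    {M N : Matrix α α F} {M' N' : Matrix β β F} (hU : Rep (res A U) (res B U) M N)
    (hW : Rep (res A W) (res B W) M' N') :
    Rep A B (fromBlocks M 0 0 M') (fromBlocks N 0 0 N') := by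
  obtain ⟨b, h1, h2⟩ := hU
  obtain ⟨c, h3, h4⟩ := hW
  refine ⟨(b.prod c).map (Submodule.prodEquivOfIsCompl U W h), ?_, ?_⟩
  · rintro (i | i) (j | j)
    · simpa using h1 i j
    · simpa using (hA _ (b i).2 _ (c j).2).1
    · simpa using (hA _ (b j).2 _ (c i).2).2
    · simpa using h3 i j
  · rintro (i | i) (j | j)
    · simpa using h2 i j
    · simpa using (hB _ (b i).2 _ (c j).2).1
    · simpa using (hB _ (b j).2 _ (c i).2).2
    · simpa using h4 i j

/-- splitting off the span of a family `e` that has a retraction `π` with orthogonal kernel -/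
theorem Rep.split {α : Type*} (e : κ → V) (π : V →ₗ[F] (κ → F)) (hπ : ∀ i, π (e i) = Pi.single i 1)
    (hA : ∀ i, ∀ x ∈ LinearMap.ker π, A (e i) x = 0 ∧ A x (e i) = 0)
    (hB : ∀ i, ∀ x ∈ LinearMap.ker π, B (e i) x = 0 ∧ B x (e i) = 0)
    {M' N' : Matrix α α F} (hW : Rep (res A (LinearMap.ker π)) (res B (LinearMap.ker π)) M' N') :
    Rep A B (fromBlocks (Matrix.of fun i j => A (e i) (e j)) 0 0 M')
      (fromBlocks (Matrix.of fun i j => B (e i) (e j)) 0 0 N') := by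
  have hli : LinearIndependent F e := by
    rw [Fintype.linearIndependent_iff]
    intro g hg i
    have := congrFun (congrArg π hg) i
    simpa [map_sum, hπ, Finset.sum_apply, Pi.single_apply] using this
  have horth : ∀ (A : LinearMap.BilinForm F V),
      (∀ i, ∀ x ∈ LinearMap.ker π, A (e i) x = 0 ∧ A x (e i) = 0) →
      ∀ u ∈ Submodule.span F (Set.range e), ∀ w ∈ LinearMap.ker π, A u w = 0 ∧ A w u = 0 := by
    intro A hA u hu w hw
    induction hu using Submodule.span_induction with
    | mem x hx => obtain ⟨i, rfl⟩ := hx; exact hA i w hw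
    | zero => simp
    | add x y _ _ hx hy => simp [hx.1, hx.2, hy.1, hy.2]
    | smul a x _ hx => simp [hx.1, hx.2]
  have hc : IsCompl (Submodule.span F (Set.range e)) (LinearMap.ker π) := by
    constructor
    · rw [Submodule.disjoint_def]
      intro x hx hx'
      rw [Submodule.mem_span_range_iff_exists_fun] at hx
      obtain ⟨c, rfl⟩ := hx
      have : c = 0 := by
        ext i
        have := congrFun (LinearMap.mem_ker.1 hx') i
        simpa [map_sum, hπ, Finset.sum_apply, Pi.single_apply] using this
      simp [this]
    · rw [codisjoint_iff, eq_top_iff]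
      rintro x -
      rw [← add_sub_cancel (∑ i, π x i • e i) x]
      refine Submodule.add_mem_sup ?_ ?_
      · exact Submodule.sum_mem _ fun i _ => Submodule.smul_mem _ _
          (Submodule.subset_span ⟨i, rfl⟩)
      · rw [LinearMap.mem_ker, map_sub, sub_eq_zero]
        ext i
        simp [map_sum, hπ, Finset.sum_apply, Pi.single_apply]
  refine Rep.sum_of_isCompl hc (horth A hA) (horth B hB)
    ⟨Module.Basis.span hli, ?_, ?_⟩ hW
  · intro i j; simp [Module.Basis.span_apply]
  · intro i j; simp [Module.Basis.span_apply]

end Rep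

section SkewAdjoint
variable {V : Type*} [AddCommGroup V] [Module F V]

/-- `T` is skew-adjoint for the nondegenerate `ε`-symmetric form `P` -/
structure SkewAdj (P : LinearMap.BilinForm F V) (T : Module.End F V) (ε : F) : Prop where
  sq : ε * ε = 1
  symm : ∀ x y, P x y = ε * P y x
  nd : ∀ x, (∀ y, P x y = 0) → x = 0
  adj : ∀ x y, P (T x) y = -P x (T y)

/-- the second form attached to a form and an endomorphism -/
abbrev twist (P : LinearMap.BilinForm F V) (T : Module.End F V) : LinearMap.BilinForm F V :=
  P.compl₂ T

variable {P : LinearMap.BilinForm F V} {T : Module.End F V} {ε : F}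

theorem SkewAdj.eps (h : SkewAdj P T ε) : ε = 1 ∨ ε = -1 := mul_self_eq_one_iff.1 h.sq

theorem SkewAdj.eq_zero_comm (h : SkewAdj P T ε) {x y : V} (hxy : P x y = 0) : P y x = 0 := by
  rw [h.symm, hxy, mul_zero]

theorem SkewAdj.nd_right (h : SkewAdj P T ε) (y : V) (hy : ∀ x, P x y = 0) : y = 0 :=
  h.nd y fun x => h.eq_zero_comm (hy x)

theorem SkewAdj.adj_aeval (h : SkewAdj P T ε) (f : F[X]) (x y : V) :
    P (aeval T f x) y = P x (aeval (-T) f y) := by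
  induction f using Polynomial.induction_on' generalizing x y with
  | add p q hp hq => simp [hp, hq]
  | monomial n a =>
    rw [aeval_monomial, aeval_monomial]
    simp only [Module.End.mul_apply, Module.algebraMap_end_apply, map_smul, LinearMap.smul_apply]
    congr 1
    induction n generalizing x y with
    | zero => simp
    | succ n ih =>
      rw [pow_succ, pow_succ', Module.End.mul_apply, Module.End.mul_apply, ih, h.adj]
      simp

theorem SkewAdj.adj_pow (h : SkewAdj P T ε) (n : ℕ) (x y : V) :
    P ((T ^ n) x) y = (-1) ^ n * P x ((T ^ n) y) := by
  induction n generalizing x y with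
  | zero => simp
  | succ n ih =>
    rw [pow_succ T, Module.End.mul_apply, ih, h.adj, ← Module.End.mul_apply T, ← pow_succ',
      ← pow_succ, pow_succ (-1 : F)]
    ring

theorem aeval_neg_eq (T : Module.End F V) (f : F[X]) : aeval (-T) f = aeval T (f.comp (-X)) := by
  rw [aeval_comp]; simp

theorem SkewAdj.twist_symm (h : SkewAdj P T ε) (x y : V) :
    twist P T x y = -ε * twist P T y x := by
  simp only [LinearMap.compl₂_apply]
  rw [h.symm x, h.adj]; ring

theorem isUnit_det_of_mulVec_eq_zero {κ : Type*} [Fintype κ] [DecidableEq κ]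
    {M : Matrix κ κ F} (h : ∀ c, M *ᵥ c = 0 → c = 0) : IsUnit M.det := by
  rw [← Matrix.isUnit_iff_isUnit_det, ← Matrix.mulVec_injective_iff_isUnit]
  intro a b hab
  exact sub_eq_zero.1 (h _ (by rw [Matrix.mulVec_sub, sub_eq_zero]; exact hab))

/-- an invariant nondegenerate subspace splits off -/
theorem SkewAdj.split (h : SkewAdj P T ε) {κ : Type*} [Fintype κ] [DecidableEq κ] (v : κ → V)
    (hv : IsUnit (Matrix.of fun i j => P (v i) (v j)).det)
    (hT : ∀ i, T (v i) ∈ Submodule.span F (Set.range v)) :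
    ∃ (K : Submodule F V) (T' : Module.End F K), SkewAdj (res P K) T' ε ∧
      res (twist P T) K = twist (res P K) T' ∧ (∀ x : K, (T' x : V) = T x) ∧
      (Nonempty κ → K ≠ ⊤) ∧
      ∀ {μ : Type} [Fintype μ] [DecidableEq μ] (M' N' : Matrix μ μ F),
        Rep (res P K) (twist (res P K) T') M' N' →
        Rep P (twist P T) (fromBlocks (Matrix.of fun i j => P (v i) (v j)) 0 0 M')
          (fromBlocks (Matrix.of fun i j => P (v i) (T (v j))) 0 0 N') := by
  set G : Matrix κ κ F := Matrix.of fun i j => P (v i) (v j) with hG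
  let ρ : V →ₗ[F] (κ → F) := LinearMap.pi fun i => P (v i)
  let π : V →ₗ[F] (κ → F) := (Matrix.mulVecLin G⁻¹) ∘ₗ ρ
  have hρ : ∀ j, ρ (v j) = G *ᵥ Pi.single j 1 := by
    intro j; ext i; simp [ρ, hG]
  have hπ : ∀ j, π (v j) = Pi.single j 1 := by
    intro j
    simp only [π, LinearMap.comp_apply, hρ, Matrix.mulVecLin_apply, Matrix.mulVec_mulVec]
    rw [Matrix.nonsing_inv_mul _ hv, Matrix.one_mulVec]
  have hker : ∀ x, x ∈ LinearMap.ker π ↔ ∀ i, P (v i) x = 0 := by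
    intro x
    rw [LinearMap.mem_ker]
    constructor
    · intro hx i
      have : ρ x = G *ᵥ (π x) := by
        simp only [π, LinearMap.comp_apply, Matrix.mulVecLin_apply, Matrix.mulVec_mulVec]
        rw [Matrix.mul_nonsing_inv _ hv, Matrix.one_mulVec]
      rw [hx, Matrix.mulVec_zero] at this
      exact congrFun this i
    · intro hx
      have : ρ x = 0 := funext hx
      simp [π, this]
  have hspan : ∀ x ∈ LinearMap.ker π, ∀ y ∈ Submodule.span F (Set.range v), P y x = 0 := by
    intro x hx y hy
    induction hy using Submodule.span_induction with
    | mem y hy => obtain ⟨i, rfl⟩ := hy; exact (hker x).1 hx i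
    | zero => simp
    | add a b _ _ ha hb => simp [ha, hb]
    | smul c a _ ha => simp [ha]
  have hinv : ∀ x ∈ LinearMap.ker π, T x ∈ LinearMap.ker π := by
    intro x hx
    rw [hker]
    intro i
    have := hspan x hx _ (hT i)
    rw [h.adj] at this
    exact neg_eq_zero.1 this
  let T' : Module.End F (LinearMap.ker π) := T.restrict hinv
  have hres : res (twist P T) (LinearMap.ker π) = twist (res P (LinearMap.ker π)) T' := by
    ext x y; rfl
  refine ⟨LinearMap.ker π, T', ⟨h.sq, fun x y => h.symm x y, ?_, fun x y => h.adj x y⟩, hres,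
    fun x => rfl, ?_, ?_⟩
  · rintro ⟨x, hx⟩ hx'
    have : x = 0 := by
      apply h.nd
      intro y
      have hy : y - ∑ i, π y i • v i ∈ LinearMap.ker π := by
        rw [LinearMap.mem_ker, map_sub, sub_eq_zero]
        ext i
        simp [map_sum, hπ, Finset.sum_apply, Pi.single_apply]
      have h1 : P x (y - ∑ i, π y i • v i) = 0 := hx' ⟨_, hy⟩
      have h2 : P x (∑ i, π y i • v i) = 0 := by
        rw [map_sum]
        refine Finset.sum_eq_zero fun i _ => ?_
        rw [map_smul, h.eq_zero_comm ((hker x).1 hx i), smul_zero]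
      rw [map_sub, h2, sub_zero] at h1
      exact h1
    exact Subtype.ext this
  · rintro ⟨i⟩ htop
    have : v i ∈ LinearMap.ker π := htop ▸ Submodule.mem_top
    rw [LinearMap.mem_ker, hπ] at this
    simpa using congrFun this i
  · intro μ _ _ M' N' hW
    rw [← hres] at hW
    refine Rep.split (A := P) (B := twist P T) v π hπ ?_ ?_ hW
    · intro i x hx
      exact ⟨(hker x).1 hx i, h.eq_zero_comm ((hker x).1 hx i)⟩
    · intro i x hx
      have h1 : twist P T (v i) x = 0 := (hker _).1 (hinv x hx) i
      exact ⟨h1, by rw [h.twist_symm, h1, mul_zero]⟩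

theorem aeval_companion_chain {χ : F[X]} (hχ : χ.Monic) {u : V} (hu : aeval T χ u = 0)
    (j : Fin χ.natDegree) :
    T ((T ^ (j : ℕ)) u) = ∑ i, companion F χ i j • (T ^ (i : ℕ)) u := by
  rw [← Module.End.mul_apply, ← pow_succ']
  by_cases hj : (j : ℕ) + 1 = χ.natDegree
  · have h1 : ∀ i, companion F χ i j = -χ.coeff i := by
      intro i
      have := i.2
      simp [companion, hj, this.ne]
    simp only [h1]
    rw [aeval_eq_sum_range, Finset.sum_range_succ, hχ.coeff_natDegree, one_smul,
      LinearMap.add_apply, LinearMap.sum_apply] at hu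
    rw [hj, Fin.sum_univ_eq_sum_range (fun i => -χ.coeff i • (T ^ i) u) χ.natDegree,
      eq_neg_of_add_eq_zero_right hu, ← Finset.sum_neg_distrib]
    simp
  · have h1 : ∀ i, companion F χ i j = if i = ⟨j + 1, by omega⟩ then 1 else 0 := by
      intro i
      simp [companion, hj, Fin.ext_iff]
    simp [h1]

/-- the pairing between two cyclic subspaces attached to `p ^ l` is perfect -/
theorem SkewAdj.gram_isUnit (h : SkewAdj P T ε) {p : F[X]} (hm : p.Monic) (hp : Irreducible p)
    {l : ℕ} (hl : 0 < l) {u w : V} (hu : aeval T (p ^ l) u = 0)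
    (huw : P w (aeval T (p ^ (l - 1)) u) ≠ 0) :
    IsUnit (Matrix.of fun i j : Fin (p ^ l).natDegree =>
      P ((T ^ (i : ℕ)) w) ((T ^ (j : ℕ)) u)).det := by
  have hml := hm.pow l
  set d := (p ^ l).natDegree with hd
  apply isUnit_det_of_mulVec_eq_zero
  intro c hc
  set f : F[X] := ∑ j : Fin d, C (c j) * X ^ (j : ℕ) with hf
  have hfu : aeval T f u = ∑ j : Fin d, c j • (T ^ (j : ℕ)) u := by
    simp [hf, map_sum, LinearMap.sum_apply, Module.End.mul_apply]
  have hcoeff : ∀ j : Fin d, f.coeff j = c j := by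
    intro j
    simp [hf, coeff_X_pow, Fin.val_inj]
  have hdeg : f.degree < d := by
    rw [degree_lt_iff_coeff_zero]
    intro m hm
    simp only [hf, finsetSum_coeff, coeff_C_mul, coeff_X_pow]
    exact Finset.sum_eq_zero fun j _ => by rw [if_neg (by omega), mul_zero]
  have h0 : ∀ i < d, P w ((T ^ i) (aeval T f u)) = 0 := by
    intro i hi
    have := congrFun hc ⟨i, hi⟩
    simp only [Matrix.mulVec, dotProduct, Matrix.of_apply, Pi.zero_apply] at this
    have h2 := h.adj_pow i w (aeval T f u)
    rw [hfu] at h2 ⊢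
    have h3 : P ((T ^ i) w) (∑ j : Fin d, c j • (T ^ (j : ℕ)) u) = 0 := by
      rw [← this]; simp [map_sum, mul_comm]
    rw [h3] at h2
    exact (mul_eq_zero.1 h2.symm).resolve_left (pow_ne_zero _ (by simp))
  have h1 : ∀ g : F[X], P w (aeval T (g * f) u) = 0 := by
    intro g
    have e : g * f = (g % (p ^ l)) * f + (g / (p ^ l) * f) * p ^ l := by
      conv_lhs => rw [← EuclideanDomain.mod_add_div g (p ^ l)]
      ring
    have hlt : (g % (p ^ l)).natDegree < d ∨ g % (p ^ l) = 0 := by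
      by_cases h0 : g % (p ^ l) = 0
      · exact Or.inr h0
      · left
        exact natDegree_lt_natDegree h0 (EuclideanDomain.mod_lt g hml.ne_zero)
    rw [e, map_add, LinearMap.add_apply, map_mul (aeval T) _ (p ^ l), Module.End.mul_apply, hu,
      map_zero, add_zero]
    rcases hlt with hlt | h0'
    · rw [as_sum_range' _ d hlt, Finset.sum_mul, map_sum, LinearMap.sum_apply, map_sum]
      refine Finset.sum_eq_zero fun i hi => ?_
      rw [map_mul, Module.End.mul_apply, aeval_monomial]
      simp [h0 i (Finset.mem_range.1 hi)]
    · simp [h0']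
  have hf0 : f = 0 := by
    by_contra hne
    obtain ⟨k, f', hf', hff⟩ := WfDvdMonoid.max_power_factor hne hp
    have hk : k < l := by
      by_contra hk
      have : p ^ l ∣ f := hff ▸ Dvd.dvd.mul_right (pow_dvd_pow p (not_lt.1 hk)) f'
      have := degree_le_of_dvd this hne
      rw [degree_eq_natDegree hml.ne_zero] at this
      exact absurd hdeg (not_lt.2 this)
    have hcop : IsCoprime f' (p ^ l) :=
      ((hp.coprime_iff_not_dvd.2 hf').pow_left).symm
    obtain ⟨a, b, hab⟩ := hcop
    have e : a * p ^ (l - 1 - k) * f = p ^ (l - 1) - b * p ^ (l - 1) * p ^ l := by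
      have : p ^ (l - 1) = p ^ (l - 1 - k) * p ^ k := by rw [← pow_add]; congr 1; omega
      rw [hff]
      calc _ = p ^ (l - 1) * (a * f') := by rw [this]; ring
        _ = _ := by rw [eq_sub_of_add_eq hab]; ring
    have := h1 (a * p ^ (l - 1 - k))
    rw [e, map_sub, LinearMap.sub_apply, map_mul (aeval T) _ (p ^ l), Module.End.mul_apply, hu,
      map_zero, sub_zero] at this
    exact huw this
  ext j
  rw [← hcoeff, hf0]; simp

end SkewAdjoint

/-- the hyperbolic pair attached to a monic polynomial and a sign -/
def hypBlock (ε : F) (χ : F[X]) : PBlock F :=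
  ⟨χ.natDegree + χ.natDegree,
    (skewSum (1 : Mat F χ.natDegree) (ε • (1 : Mat F χ.natDegree)),
     skewSum (companion F χ) (-ε • (companion F χ)ᵀ))⟩

section Split
variable {V : Type*} [AddCommGroup V] [Module F V]
variable {P : LinearMap.BilinForm F V} {T : Module.End F V} {ε : F}

/-- the block `b` splits off from the pair `(P, P ∘ T)` -/
def Splits (P : LinearMap.BilinForm F V) (T : Module.End F V) (ε : F) (b : PBlock F) : Prop :=
  ∃ (K : Submodule F V) (T' : Module.End F K), SkewAdj (res P K) T' ε ∧ K ≠ ⊤ ∧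
    (∀ x : K, (T' x : V) = T x) ∧
    ∀ {μ : Type} [Fintype μ] [DecidableEq μ] (M' N' : Matrix μ μ F),
      Rep (res P K) (twist (res P K) T') M' N' →
      Rep P (twist P T) (fromBlocks b.2.1 0 0 M') (fromBlocks b.2.2 0 0 N')

theorem natDegree_pow_pos {p : F[X]} (hm : p.Monic) (hp : Irreducible p) {l : ℕ} (hl : 0 < l) :
    0 < (p ^ l).natDegree := by
  rw [hm.natDegree_pow]
  exact Nat.mul_pos hl hp.natDegree_pos

theorem SkewAdj.cyc_split (h : SkewAdj P T ε) {p : F[X]} (hm : p.Monic) (hp : Irreducible p)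
    {l : ℕ} (hl : 0 < l) {u : V} (hu : aeval T (p ^ l) u = 0)
    (huu : P u (aeval T (p ^ (l - 1)) u) ≠ 0) :
    ∃ G : Mat F (p ^ l).natDegree, IsUnit G.det ∧ Gᵀ = ε • G ∧
      (G * companion F (p ^ l))ᵀ = -ε • (G * companion F (p ^ l)) ∧
      Splits P T ε ⟨(p ^ l).natDegree, (G, G * companion F (p ^ l))⟩ := by
  have hG := h.gram_isUnit hm hp hl hu huu
  have hch := aeval_companion_chain (T := T) (hm.pow l) hu
  set d := (p ^ l).natDegree with hd
  let v : Fin d → V := fun i => (T ^ (i : ℕ)) u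
  set G : Mat F d := Matrix.of fun i j => P (v i) (v j) with hGdef
  have hQ : G * companion F (p ^ l) = Matrix.of fun i j => P (v i) (T (v j)) := by
    ext i j
    rw [Matrix.of_apply, hch j, map_sum, Matrix.mul_apply]
    refine Finset.sum_congr rfl fun k _ => ?_
    rw [map_smul, smul_eq_mul, mul_comm]; rfl
  refine ⟨G, hG, ?_, ?_, ?_⟩
  · ext i j; exact h.symm _ _
  · rw [hQ]; ext i j; exact h.twist_symm _ _
  · obtain ⟨K, T', h1, h2, h3, h4, h5⟩ := h.split v hG (fun j => by
      rw [hch j]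
      exact Submodule.sum_mem _ fun i _ => Submodule.smul_mem _ _ (Submodule.subset_span ⟨i, rfl⟩))
    refine ⟨K, T', h1, h4 ⟨⟨0, natDegree_pow_pos hm hp hl⟩⟩, h3, ?_⟩
    rw [hQ]
    exact h5

theorem SkewAdj.hyp_split (h : SkewAdj P T ε) {p : F[X]} (hm : p.Monic) (hp : Irreducible p)
    {l : ℕ} (hl : 0 < l) {u w : V} (hu : aeval T (p ^ l) u = 0) (hw : aeval (-T) (p ^ l) w = 0)
    (huw : P w (aeval T (p ^ (l - 1)) u) ≠ 0) (huu : ∀ i, P u ((T ^ i) u) = 0)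
    (hww : ∀ i, P w ((T ^ i) w) = 0) : Splits P T ε (hypBlock ε (p ^ l)) := by
  have hG := h.gram_isUnit hm hp hl hu huw
  have hch := aeval_companion_chain (T := T) (hm.pow l) hu
  have hchw := aeval_companion_chain (T := -T) (hm.pow l) hw
  have hpos := natDegree_pow_pos hm hp hl
  have hu2 : ∀ i j : ℕ, P ((T ^ i) u) ((T ^ j) u) = 0 := by
    intro i j
    rw [h.adj_pow, ← Module.End.mul_apply, ← pow_add, huu, mul_zero]
  have hw2 : ∀ i j : ℕ, P ((T ^ i) w) ((T ^ j) w) = 0 := by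
    intro i j
    rw [h.adj_pow, ← Module.End.mul_apply, ← pow_add, hww, mul_zero]
  set d := (p ^ l).natDegree with hd
  set Φ := companion F (p ^ l) with hΦ
  set M : Mat F d := Matrix.of fun i j : Fin d => P ((T ^ (i : ℕ)) w) ((T ^ (j : ℕ)) u) with hM
  let w' : Fin d → V := fun i => ∑ k, M⁻¹ i k • (T ^ (k : ℕ)) w
  let v : Fin d ⊕ Fin d → V := Sum.elim (fun i => (T ^ (i : ℕ)) u) w'
  have hwu : ∀ i j : Fin d, P (w' i) ((T ^ (j : ℕ)) u) = (1 : Mat F d) i j := by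
    intro i j
    rw [← Matrix.nonsing_inv_mul M hG, Matrix.mul_apply]
    simp [w', M]
  have hww' : ∀ i j, P (w' i) (w' j) = 0 := by
    intro i j
    simp only [w']
    rw [form_sum_sum]
    simp [hw2]
  have hwTw : ∀ i j, P (w' i) (T (w' j)) = 0 := by
    intro i j
    have : T (w' j) = ∑ k, M⁻¹ j k • (T ^ ((k : ℕ) + 1)) w := by
      simp [w', map_sum, pow_succ']
    rw [this]
    simp only [w']
    rw [form_sum_sum]
    simp [hw2]
  have hwTu : ∀ i j : Fin d, P (w' i) (T ((T ^ (j : ℕ)) u)) = Φ i j := by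
    intro i j
    rw [hch j, map_sum, Finset.sum_eq_single i]
    · simp [hwu]
    · intro b _ hb
      simp [hwu, hb.symm]
    · simp
  have hP : (Matrix.of fun i j => P (v i) (v j)) = fromBlocks 0 (ε • 1) 1 0 := by
    ext (i | i) (j | j)
    · simpa [v] using hu2 i j
    · simp [v]
      rw [h.symm, hwu, Matrix.one_apply, Matrix.one_apply]
      simp [eq_comm]
    · simpa [v] using hwu i j
    · simpa [v] using hww' i j
  have hQ : (Matrix.of fun i j => P (v i) (T (v j))) = fromBlocks 0 (-ε • Φᵀ) Φ 0 := by
    ext (i | i) (j | j)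
    · simp only [v, Sum.elim_inl, of_apply, fromBlocks_apply₁₁, Matrix.zero_apply]
      rw [← Module.End.mul_apply T, ← pow_succ']
      exact hu2 _ _
    · have := h.twist_symm ((T ^ (i : ℕ)) u) (w' j)
      simp only [LinearMap.compl₂_apply, hwTu] at this
      simpa [v] using this
    · simpa [v] using hwTu i j
    · simpa [v] using hwTw i j
  have hunit : IsUnit (Matrix.of fun i j => P (v i) (v j)).det := by
    rw [hP]
    refine Matrix.isUnit_det_of_left_inverse (B := fromBlocks 0 1 (ε • 1) 0) ?_
    simp [fromBlocks_multiply, smul_smul, h.sq]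
  have hTv : ∀ i, T (v i) ∈ Submodule.span F (Set.range v) := by
    have hvi : ∀ i, v i ∈ Submodule.span F (Set.range v) := fun i =>
      Submodule.subset_span ⟨i, rfl⟩
    have hTw : ∀ k : Fin d, (T ^ (k : ℕ)) w ∈ Submodule.span F (Set.range v) := by
      intro k
      have : (T ^ (k : ℕ)) w = ∑ i, M k i • w' i := by
        simp only [w', Finset.smul_sum, smul_smul]
        rw [Finset.sum_comm]
        simp only [← Finset.sum_smul, ← Matrix.mul_apply, Matrix.mul_nonsing_inv M hG]
        simp [Matrix.one_apply]
      rw [this]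
      exact Submodule.sum_mem _ fun i _ => Submodule.smul_mem _ _ (hvi (Sum.inr i))
    have hneg : ∀ (k : ℕ) (x : V), ((-T) ^ k) x = (-1 : F) ^ k • (T ^ k) x := by
      intro k x
      rcases Nat.even_or_odd k with hk | hk <;> simp [hk.neg_pow]
    rintro (i | i)
    · simp only [v, Sum.elim_inl]
      rw [hch i]
      exact Submodule.sum_mem _ fun k _ => Submodule.smul_mem _ _ (hvi (Sum.inl k))
    · simp only [v, Sum.elim_inr, w', map_sum, map_smul]
      refine Submodule.sum_mem _ fun k _ => Submodule.smul_mem _ _ ?_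
      have := hchw k
      simp only [hneg, LinearMap.neg_apply, map_smul] at this
      have h1 : ((-1 : F) ^ (k : ℕ)) ≠ 0 := pow_ne_zero _ (by simp)
      rw [neg_eq_iff_eq_neg.1 ((eq_inv_smul_iff₀ h1).2 this)]
      refine Submodule.neg_mem _ (Submodule.smul_mem _ _ (Submodule.sum_mem _ fun i _ =>
        Submodule.smul_mem _ _ (Submodule.smul_mem _ _ (hTw i))))
  obtain ⟨K, T', h1, h2, h3, h4, h5⟩ := h.split v hunit hTv
  refine ⟨K, T', h1, h4 ⟨Sum.inl ⟨0, hpos⟩⟩, h3, ?_⟩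
  intro μ _ _ M' N' hR
  have := h5 M' N' hR
  rw [hP, hQ] at this
  refine this.cg ?_
  exact Cg.fromBlocks (Cg.reindex _ _ finSumFinEquiv) (Cg.refl _ _)

end Split

theorem coeff_comp_neg_X (p : F[X]) (n : ℕ) :
    (p.comp (-X)).coeff n = (-1) ^ n * p.coeff n := by
  have : (-X : F[X]) = C (-1) * X := by simp
  rw [this, comp_C_mul_X_coeff, mul_comm]

theorem comp_X_sq_of_even (h2 : (2 : F) ≠ 0) {p : F[X]} (h : p.comp (-X) = p) :
    ∃ g : F[X], p = g.comp (X ^ 2) := by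
  refine ⟨p.contract 2, ?_⟩
  rw [← expand_eq_comp_X_pow]
  ext n
  rw [coeff_expand two_pos, coeff_contract two_ne_zero]
  split_ifs with hn
  · rw [Nat.div_mul_cancel hn]
  · have h1 : (p.comp (-X)).coeff n = p.coeff n := by rw [h]
    rw [coeff_comp_neg_X, (Nat.not_even_iff_odd.1 fun he => hn he.two_dvd).neg_one_pow] at h1
    have : 2 * p.coeff n = 0 := by linear_combination -h1
    exact (mul_eq_zero.1 this).resolve_left h2

theorem comp_neg_X_irreducible {p : F[X]} (hp : Irreducible p) : Irreducible (p.comp (-X)) := by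
  have : p.comp (-X) = algEquivAevalNegX p := by simp [algEquivAevalNegX, ← comp_eq_aeval]
  rw [this]
  exact (MulEquiv.irreducible_iff (algEquivAevalNegX (R := F)).toMulEquiv).2 hp

theorem comp_neg_X_eq_of_dvd {p : F[X]} (hm : p.Monic) (hp : Irreducible p)
    (h : p ∣ p.comp (-X)) : p.comp (-X) = C ((-1) ^ p.natDegree) * p := by
  have hq := comp_neg_X_irreducible hp
  obtain ⟨c, hc⟩ := hp.associated_of_dvd hq h
  obtain ⟨a, ha, hac⟩ := Polynomial.isUnit_iff.1 c.isUnit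
  rw [← hac] at hc
  have h1 : (p.comp (-X)).coeff p.natDegree = (p * C a).coeff p.natDegree := by rw [hc]
  rw [coeff_comp_neg_X, coeff_mul_C, hm.coeff_natDegree] at h1
  rw [← hc, mul_comm p]
  congr 2
  linear_combination -h1

theorem isCoprime_comp_neg_X (h2 : (2 : F) ≠ 0) {p : F[X]} (hm : p.Monic) (hp : Irreducible p)
    (hn : ¬ ∃ g : F[X], p = g.comp (X ^ 2)) (hX : p ≠ X) : IsCoprime p (p.comp (-X)) := by
  rw [hp.coprime_iff_not_dvd]
  intro h
  have h1 := comp_neg_X_eq_of_dvd hm hp h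
  rcases neg_one_pow_eq_or F p.natDegree with e | e
  · rw [e, C_1, one_mul] at h1
    exact hn (comp_X_sq_of_even h2 h1)
  · rw [e] at h1
    have h3 : (p.comp (-X)).eval 0 = (C (-1) * p).eval 0 := by rw [h1]
    simp only [eval_comp, eval_neg, eval_X, neg_zero, eval_mul, eval_C] at h3
    have h4 : 2 * p.eval 0 = 0 := by linear_combination h3
    have h5 : X ∣ p := by
      rw [X_dvd_iff, coeff_zero_eq_eval_zero]
      exact (mul_eq_zero.1 h4).resolve_left h2
    have := irreducible_X.associated_of_dvd hp h5
    exact hX (eq_of_monic_of_associated hm monic_X this.symm)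

/-- the standard blocks of a form with a skew-adjoint endomorphism -/
def Good (ε : F) (b : PBlock F) : Prop :=
  ∃ (p : F[X]) (l : ℕ), p.Monic ∧ Irreducible p ∧ 0 < l ∧
    ((¬ (∃ g : F[X], p = g.comp (X ^ 2)) ∧ ¬ (p = X ∧ ε * (-1) ^ (l - 1) = 1) ∧
        (ε = 1 ∨ p = X) ∧ b = hypBlock ε (p ^ l)) ∨
      (((ε = 1 ∧ ∃ g : F[X], p = g.comp (X ^ 2)) ∨ (p = X ∧ ε * (-1) ^ (l - 1) = 1)) ∧
        ∃ G : Mat F (p ^ l).natDegree, IsUnit G.det ∧ Gᵀ = ε • G ∧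
          (G * companion F (p ^ l))ᵀ = -ε • (G * companion F (p ^ l)) ∧
          b = ⟨(p ^ l).natDegree, (G, G * companion F (p ^ l))⟩))

section Dec
variable {V : Type*} [AddCommGroup V] [Module F V]
variable {P : LinearMap.BilinForm F V} {T : Module.End F V} {ε : F}

theorem SkewAdj.exists_pair (h : SkewAdj P T ε) {p m : F[X]} {l : ℕ} (hp : Irreducible p)
    (hl : 0 < l) (hmp : minpoly F T = p ^ l * m) (hpm : ¬ p ∣ m) (hT : IsIntegral F T) :
    ∃ u w : V, aeval T (p ^ l) u = 0 ∧ aeval (-T) (p ^ l) w = 0 ∧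
      P w (aeval T (p ^ (l - 1)) u) ≠ 0 := by
  have hne : aeval T (p ^ (l - 1) * m) ≠ 0 := by
    intro h0
    have h1 := minpoly.dvd F T h0
    have h2 : p ^ l * m = p * (p ^ (l - 1) * m) := by
      rw [← mul_assoc, ← pow_succ']; congr 2; omega
    have h3 : p ^ (l - 1) * m ≠ 0 := by
      intro h4
      apply minpoly.ne_zero hT
      rw [hmp, h2, h4, mul_zero]
    rw [hmp, h2] at h1
    have : p ∣ 1 := by
      have h5 : p * (p ^ (l - 1) * m) ∣ 1 * (p ^ (l - 1) * m) := by rwa [one_mul]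
      exact (mul_dvd_mul_iff_right h3).1 h5
    exact hp.not_isUnit (isUnit_of_dvd_one this)
  obtain ⟨y, hy⟩ : ∃ y, aeval T (p ^ (l - 1) * m) y ≠ 0 := by
    by_contra hcon
    push Not at hcon
    exact hne (LinearMap.ext hcon)
  obtain ⟨w, hw⟩ : ∃ w, P (aeval T (p ^ (l - 1) * m) y) w ≠ 0 := by
    by_contra hcon
    push Not at hcon
    exact hy (h.nd _ hcon)
  have hann : ∀ x, aeval T (p ^ l * m) x = 0 := fun x => by
    rw [← hmp, minpoly.aeval]; rfl
  obtain ⟨a, b, hab⟩ : IsCoprime (p ^ l) m := (hp.coprime_iff_not_dvd.2 hpm).pow_left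
  have key : aeval T (p ^ (l - 1) * m) y = aeval T (b * m) (aeval T (p ^ (l - 1) * m) y) := by
    have e : p ^ (l - 1) * m = b * m * (p ^ (l - 1) * m) + a * p ^ (l - 1) * (p ^ l * m) := by
      linear_combination (-p ^ (l - 1) * m) * hab
    conv_lhs => rw [e]
    rw [map_add, LinearMap.add_apply, map_mul (aeval T) (b * m), Module.End.mul_apply,
      map_mul (aeval T) (a * _), Module.End.mul_apply (aeval T (a * _)), hann, map_zero, add_zero]
  refine ⟨aeval T m y, aeval (-T) (b * m) w, ?_, ?_, ?_⟩
  · rw [← Module.End.mul_apply, ← map_mul, hann]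
  · apply h.nd_right
    intro x
    rw [← Module.End.mul_apply, ← map_mul, ← h.adj_aeval, show p ^ l * (b * m) = b * (p ^ l * m) by
      ring, map_mul, Module.End.mul_apply, hann]
    simp
  · intro h0
    apply hw
    rw [key, h.adj_aeval, map_mul (aeval T), Module.End.mul_apply]
    exact h.eq_zero_comm h0

theorem SkewAdj.isotropic_of_coprime (h : SkewAdj P T ε) {q : F[X]} {u : V}
    (hu : aeval T q u = 0) (hq : IsCoprime q (q.comp (-X))) (i : ℕ) : P u ((T ^ i) u) = 0 := by
  obtain ⟨a, b, hab⟩ := hq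
  have h1 : u = aeval (-T) q (aeval T b u) := by
    rw [aeval_neg_eq, ← Module.End.mul_apply, ← map_mul, mul_comm]
    have := congrArg (fun f => aeval T f u) hab
    simp only [map_add, LinearMap.add_apply, map_mul, Module.End.mul_apply, hu, map_zero,
      zero_add, map_one, Module.End.one_apply] at this
    rw [map_mul, Module.End.mul_apply, this]
  have h3 : (T ^ i) u = aeval (-T) q (aeval T b ((T ^ i) u)) := by
    conv_lhs => rw [h1]
    have : T ^ i = aeval T (X ^ i : F[X]) := by simp
    rw [this, aeval_neg_eq]
    simp only [← Module.End.mul_apply, ← map_mul]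
    congr 2
    ring
  rw [h3, ← h.adj_aeval, hu]
  simp

theorem neg_one_pow_mul_self (n : ℕ) : ((-1 : F) ^ n) * (-1) ^ n = 1 := by
  rw [← mul_pow]; simp

theorem SkewAdj.isotropic_nilpotent_aux (h : SkewAdj P T ε) (h2 : (2 : F) ≠ 0) {l : ℕ} (hl : 0 < l)
    (hε : ε * (-1) ^ (l - 1) = -1) {u w : V} (hu : (T ^ l) u = 0) (hw : (T ^ l) w = 0)
    (huw : P w ((T ^ (l - 1)) u) ≠ 0) (k : ℕ) (hk : k ≤ l) :
    ∃ u', (T ^ l) u' = 0 ∧ P w ((T ^ (l - 1)) u') ≠ 0 ∧ ∀ i, l - k ≤ i → P u' ((T ^ i) u') = 0 := by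
  have hz : ∀ {x : V}, (T ^ l) x = 0 → ∀ i, l ≤ i → (T ^ i) x = 0 := by
    intro x hx i hi
    obtain ⟨j, rfl⟩ := Nat.exists_eq_add_of_le' hi
    rw [pow_add, Module.End.mul_apply, hx, map_zero]
  induction k with
  | zero => exact ⟨u, hu, huw, fun i hi => by rw [hz hu i (by omega), map_zero]⟩
  | succ k ih =>
    obtain ⟨x, hx, hwx, hiso⟩ := ih (by omega)
    by_cases hpar : ε * (-1) ^ (l - (k + 1)) = -1
    · refine ⟨x, hx, hwx, fun i hi => ?_⟩
      rcases eq_or_lt_of_le hi with rfl | hi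
      · have h1 := h.symm x ((T ^ (l - (k + 1))) x)
        rw [h.adj_pow, ← mul_assoc, hpar] at h1
        have : 2 * P x ((T ^ (l - (k + 1))) x) = 0 := by linear_combination h1
        exact (mul_eq_zero.1 this).resolve_left h2
      · exact hiso i (by omega)
    · have hodd : (-1 : F) ^ k = -1 := by
        have e : (-1 : F) ^ (l - 1) = (-1) ^ (l - (k + 1)) * (-1) ^ k := by
          rw [← pow_add]; congr 1; omega
        rcases neg_one_pow_eq_or F k with h3 | h3
        · rw [h3, mul_one] at e; rw [e] at hε; exact absurd hε hpar
        · exact h3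
      have hk0 : k ≠ 0 := by
        rintro rfl
        rw [pow_zero] at hodd
        exact h2 (by linear_combination hodd)
      set a := P w ((T ^ (l - 1)) x) with ha
      set c : F := -(P x ((T ^ (l - (k + 1))) x)) / (2 * (ε * (-1) ^ (l - 1) * a)) with hc
      have hden : (2 * (ε * (-1) ^ (l - 1) * a)) ≠ 0 := by
        rw [hε]; simpa using ⟨h2, hwx⟩
      have hpair : ∀ i, P x ((T ^ i) w) = ε * (-1) ^ i * P w ((T ^ i) x) := by
        intro i
        rw [h.symm, h.adj_pow, mul_assoc]
      have expand : ∀ i, P (x + c • (T ^ k) w) ((T ^ i) (x + c • (T ^ k) w)) =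
          P x ((T ^ i) x) + c * (P x ((T ^ (i + k)) w) + (-1) ^ k * P w ((T ^ (i + k)) x)) +
          c * c * ((-1) ^ k * P w ((T ^ (i + k + k)) w)) := by
        intro i
        simp only [map_add, map_smul, LinearMap.add_apply, LinearMap.smul_apply, smul_eq_mul,
          h.adj_pow k w, ← Module.End.mul_apply, ← pow_add]
        rw [show k + (i + k) = i + k + k by ring, show k + i = i + k by ring]
        ring
      refine ⟨x + c • (T ^ k) w, ?_, ?_, ?_⟩
      · rw [map_add, hx, map_smul, ← Module.End.mul_apply, ← pow_add, hz hw _ (by omega)]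
        simp
      · rw [map_add, map_smul, ← Module.End.mul_apply, ← pow_add, hz hw _ (by omega)]
        simpa using hwx
      · intro i hi
        rw [expand, hz hw (i + k + k) (by omega), map_zero, mul_zero, mul_zero, add_zero]
        rcases eq_or_lt_of_le hi with rfl | hi
        · rw [show l - (k + 1) + k = l - 1 by omega, hpair, ← ha, hodd]
          have : ε * (-1) ^ (l - 1) * a + -1 * a = 2 * (ε * (-1) ^ (l - 1) * a) := by
            rw [hε]; ring
          rw [this, hc, div_mul_cancel₀ _ hden]
          ring
        · rw [hz hw (i + k) (by omega), hz hx (i + k) (by omega), hiso i (by omega)]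
          simp

end Dec

theorem X_not_even : ¬ ∃ g : F[X], (X : F[X]) = g.comp (X ^ 2) := by
  rintro ⟨g, hg⟩
  have := congrArg natDegree hg
  rw [natDegree_comp, natDegree_X, natDegree_X_pow] at this
  omega

theorem comp_neg_X_of_even {p : F[X]} (h : ∃ g : F[X], p = g.comp (X ^ 2)) :
    p.comp (-X) = p := by
  obtain ⟨g, rfl⟩ := h
  rw [comp_assoc]; simp

section Dec
variable {V : Type*} [AddCommGroup V] [Module F V]
variable {P : LinearMap.BilinForm F V} {T : Module.End F V} {ε : F}

theorem exists_cyclic_vector (h2 : (2 : F) ≠ 0) {q r : F[X]}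
    (hsym : ∀ x y, P x (aeval T q y) = P y (aeval T q x)) {u w : V}
    (hu : aeval T r u = 0) (hw : aeval T r w = 0) (huw : P w (aeval T q u) ≠ 0) :
    ∃ x, aeval T r x = 0 ∧ P x (aeval T q x) ≠ 0 := by
  by_cases h3 : P u (aeval T q u) = 0
  · by_cases h4 : P w (aeval T q w) = 0
    · refine ⟨u + w, by rw [map_add, hu, hw, add_zero], ?_⟩
      simp only [map_add, LinearMap.add_apply, h3, h4, hsym u w]
      simpa [← two_mul] using ⟨h2, huw⟩
    · exact ⟨w, hw, h4⟩
  · exact ⟨u, hu, h3⟩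

theorem SkewAdj.exists_splits (h : SkewAdj P T ε) (h2 : (2 : F) ≠ 0) [FiniteDimensional F V]
    [Nontrivial V] (hε : ε = 1 ∨ IsNilpotent T) : ∃ b, Good ε b ∧ Splits P T ε b := by
  have hT : IsIntegral F T := Algebra.IsIntegral.isIntegral T
  obtain ⟨p, hm, hp, hdvd⟩ := exists_monic_irreducible_factor _ (minpoly.not_isUnit F T)
  obtain ⟨l, m, hpm, hmp⟩ := WfDvdMonoid.max_power_factor (minpoly.ne_zero hT) hp
  have hl : 0 < l := by
    rcases Nat.eq_zero_or_pos l with rfl | hl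
    · rw [hmp] at hdvd; simp at hdvd; exact absurd hdvd hpm
    · exact hl
  have hεX : ε = 1 ∨ p = X := by
    refine hε.imp id ?_
    rintro ⟨k, hk⟩
    have h1 : minpoly F T ∣ X ^ k := minpoly.dvd F T (by simpa using hk)
    have h3 := hp.prime.dvd_of_dvd_pow (hdvd.trans h1)
    exact eq_of_monic_of_associated hm monic_X (hp.associated_of_dvd irreducible_X h3)
  obtain ⟨u, w, hu, hw, huw⟩ := h.exists_pair hp hl hmp hpm hT
  by_cases hev : ∃ g : F[X], p = g.comp (X ^ 2)
  · have hε1 : ε = 1 := hεX.resolve_right fun hX => X_not_even (hX ▸ hev)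
    have hc := comp_neg_X_of_even hev
    rw [aeval_neg_eq, pow_comp, hc] at hw
    obtain ⟨x, hx, hxx⟩ := exists_cyclic_vector (P := P) h2 (fun x y => by
      rw [h.symm, hε1, one_mul, h.adj_aeval, aeval_neg_eq, pow_comp, hc]) hu hw huw
    obtain ⟨G, h3, h4, h5, h6⟩ := h.cyc_split hm hp hl hx hxx
    exact ⟨_, ⟨p, l, hm, hp, hl, Or.inr ⟨Or.inl ⟨hε1, hev⟩, G, h3, h4, h5, rfl⟩⟩, h6⟩
  by_cases hX : p = X
  · subst hX
    rw [aeval_neg_eq, pow_comp, X_comp, neg_pow, map_mul, Module.End.mul_apply] at hw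
    have hw' : aeval T (X ^ l : F[X]) w = 0 := by
      rcases neg_one_pow_eq_or F[X] l with e | e <;> rw [e] at hw <;> simpa using hw
    have hpar : ε * (-1) ^ (l - 1) = 1 ∨ ε * (-1) ^ (l - 1) = -1 := by
      rcases h.eps with e | e <;> rcases neg_one_pow_eq_or F (l - 1) with e' | e' <;> simp [e, e']
    rcases hpar with hpar | hpar
    · obtain ⟨x, hx, hxx⟩ := exists_cyclic_vector (P := P) (T := T) (q := X ^ (l - 1)) h2 (fun x y => by
        rw [h.symm]
        simp only [map_pow, aeval_X, h.adj_pow, ← mul_assoc, hpar, one_mul]) hu hw' huw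
      obtain ⟨G, h3, h4, h5, h6⟩ := h.cyc_split hm hp hl hx hxx
      exact ⟨_, ⟨X, l, hm, hp, hl, Or.inr ⟨Or.inr ⟨rfl, hpar⟩, G, h3, h4, h5, rfl⟩⟩, h6⟩
    · simp only [map_pow, aeval_X] at hu hw' huw
      obtain ⟨u', hu1, hu2, hu3⟩ := h.isotropic_nilpotent_aux h2 hl hpar hu hw' huw l le_rfl
      have hsw : ∀ x y, P x ((T ^ (l - 1)) y) ≠ 0 → P y ((T ^ (l - 1)) x) ≠ 0 := by
        intro x y hxy h0
        rw [h.symm, h.adj_pow, h0] at hxy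
        simp at hxy
      obtain ⟨w', hw1, hw2, hw3⟩ :=
        h.isotropic_nilpotent_aux h2 hl hpar hw' hu1 (hsw _ _ hu2) l le_rfl
      refine ⟨_, ⟨X, l, hm, hp, hl, Or.inl ⟨hev, ?_, Or.inr rfl, rfl⟩⟩,
        h.hyp_split hm hp hl (u := u') (w := w') (by simpa using hu1) ?_ ?_
          (fun i => hu3 i (by omega)) (fun i => hw3 i (by omega))⟩
      · rintro ⟨-, h3⟩
        rw [hpar] at h3
        exact h2 (by linear_combination -h3)
      · rw [aeval_neg_eq, pow_comp, X_comp, neg_pow, map_mul, Module.End.mul_apply]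
        simp [hw1]
      · simpa using hsw _ _ hw2
  · have hcop := isCoprime_comp_neg_X h2 hm hp hev hX
    have hcop' : IsCoprime (p ^ l) ((p ^ l).comp (-X)) := by rw [pow_comp]; exact hcop.pow
    refine ⟨_, ⟨p, l, hm, hp, hl, Or.inl ⟨hev, fun h3 => hX h3.1, hεX, rfl⟩⟩,
      h.hyp_split hm hp hl hu hw huw (h.isotropic_of_coprime hu hcop') ?_⟩
    rw [aeval_neg_eq] at hw
    refine h.isotropic_of_coprime hw ?_
    rw [comp_neg_X_comp_neg_X]
    exact hcop'.symm

theorem SkewAdj.exists_list (h2 : (2 : F) ≠ 0) (n : ℕ) :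
    ∀ {V : Type*} [AddCommGroup V] [Module F V] [FiniteDimensional F V]
      {P : LinearMap.BilinForm F V} {T : Module.End F V}, SkewAdj P T ε →
      (ε = 1 ∨ IsNilpotent T) → Module.finrank F V = n →
      ∃ L : List (PBlock F), (∀ b ∈ L, Good ε b) ∧
        Rep P (twist P T) (psum L).2.1 (psum L).2.2 := by
  induction n using Nat.strong_induction_on with
  | _ n ih =>
  intro V _ _ _ P T h hε hn
  rcases subsingleton_or_nontrivial V with hV | hV
  · refine ⟨[], by simp, ?_⟩
    exact ⟨(Module.Basis.empty V : Module.Basis (Fin 0) F V), fun i => i.elim0, fun i => i.elim0⟩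
  · obtain ⟨b, hb, K, T', hK, hKt, hT', hrep⟩ := h.exists_splits h2 hε
    have hlt : Module.finrank F K < n := hn ▸ Submodule.finrank_lt hKt
    have hε' : ε = 1 ∨ IsNilpotent T' := by
      refine hε.imp id ?_
      rintro ⟨k, hk⟩
      refine ⟨k, LinearMap.ext fun x => Subtype.ext ?_⟩
      have : ∀ (j : ℕ) (x : K), ((T' ^ j) x : V) = (T ^ j) x := by
        intro j
        induction j with
        | zero => simp
        | succ j ih => intro x; rw [pow_succ, pow_succ, Module.End.mul_apply, ih, hT']; rfl
      rw [this, hk]; rfl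
    obtain ⟨L, hL, hR⟩ := ih _ hlt hK hε' rfl
    refine ⟨b :: L, ?_, (hrep _ _ hR).cg (cg_psum_cons b L)⟩
    intro c hc
    rcases List.mem_cons.1 hc with rfl | hc
    · exact hb
    · exact hL c hc

end Dec

section Companion

theorem companion_pow_mulVec {χ : F[X]} (hd : 0 < χ.natDegree) (i : Fin χ.natDegree) :
    (companion F χ ^ (i : ℕ)) *ᵥ Pi.single ⟨0, hd⟩ 1 = Pi.single i 1 := by
  obtain ⟨i, hi⟩ := i
  induction i with
  | zero => simp only [pow_zero, Matrix.one_mulVec]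
  | succ i ih =>
    have := ih (by omega)
    simp only at this ⊢
    rw [pow_succ', ← Matrix.mulVec_mulVec, this]
    ext j
    have h1 : i + 1 ≠ χ.natDegree := by omega
    simp [companion, Pi.single_apply, Fin.ext_iff, h1]

theorem eq_of_comm_companion {χ : F[X]} (hd : 0 < χ.natDegree) {A B : Mat F χ.natDegree}
    (hA : Commute A (companion F χ)) (hB : Commute B (companion F χ))
    (h : A *ᵥ Pi.single ⟨0, hd⟩ 1 = B *ᵥ Pi.single ⟨0, hd⟩ 1) : A = B := by
  apply Matrix.ext_of_mulVec_single
  intro i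
  rw [← companion_pow_mulVec hd i, Matrix.mulVec_mulVec, Matrix.mulVec_mulVec,
    (hA.pow_right _).eq, (hB.pow_right _).eq, ← Matrix.mulVec_mulVec, ← Matrix.mulVec_mulVec, h]

theorem commute_aeval_companion (χ f : F[X]) :
    Commute (aeval (companion F χ) f) (companion F χ) := by
  have := (Polynomial.aeval_X (R := F) (companion F χ)) ▸
    (show Commute (aeval (companion F χ) f) (aeval (companion F χ) (X : F[X])) from by
      rw [commute_iff_eq, ← map_mul, ← map_mul, mul_comm])
  exact this

theorem aeval_companion_mulVec {χ : F[X]} (hd : 0 < χ.natDegree) (c : Fin χ.natDegree → F) :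
    aeval (companion F χ) (∑ i, C (c i) * X ^ (i : ℕ)) *ᵥ Pi.single ⟨0, hd⟩ 1 = c := by
  simp only [map_sum, map_mul, aeval_C, map_pow, aeval_X, Matrix.sum_mulVec, ← Matrix.mulVec_mulVec,
    companion_pow_mulVec]
  ext j
  simp [Finset.sum_apply, Matrix.algebraMap_eq_diagonal, Pi.single_apply]

theorem exists_aeval_companion {χ : F[X]} (hd : 0 < χ.natDegree) {A : Mat F χ.natDegree}
    (hA : Commute A (companion F χ)) : ∃ f : F[X], A = aeval (companion F χ) f :=
  ⟨_, eq_of_comm_companion hd hA (commute_aeval_companion _ _)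
    (aeval_companion_mulVec hd (A *ᵥ Pi.single ⟨0, hd⟩ 1)).symm⟩

theorem aeval_companion_self {χ : F[X]} (hχ : χ.Monic) : aeval (companion F χ) χ = 0 := by
  rcases Nat.eq_zero_or_pos χ.natDegree with h0 | hd
  · have : IsEmpty (Fin χ.natDegree) := by rw [h0]; infer_instance
    ext i; exact isEmptyElim i
  · refine eq_of_comm_companion hd (commute_aeval_companion _ _) (Commute.zero_left _) ?_
    obtain ⟨k, hk⟩ : ∃ k, χ.natDegree = k + 1 := ⟨χ.natDegree - 1, by omega⟩
    have h1 : (companion F χ ^ χ.natDegree) *ᵥ Pi.single ⟨0, hd⟩ 1 =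
        fun i : Fin χ.natDegree => -χ.coeff (i : ℕ) := by
      have h2 := companion_pow_mulVec hd ⟨k, by omega⟩
      simp only at h2
      rw [show companion F χ ^ χ.natDegree = companion F χ ^ (k + 1) from congrArg _ hk,
        pow_succ', ← Matrix.mulVec_mulVec, h2]
      ext j
      have : (j : ℕ) ≠ k + 1 := by omega
      simp [companion, hk, this]
    have h3 : aeval (companion F χ) χ = aeval (companion F χ)
        (∑ i : Fin χ.natDegree, C (χ.coeff i) * X ^ (i : ℕ)) + companion F χ ^ χ.natDegree := by
      refine (congrArg (aeval (companion F χ)) hχ.as_sum).trans ?_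
      rw [Fin.sum_univ_eq_sum_range (fun i => C (χ.coeff i) * X ^ i), map_add, add_comm]
      simp
    rw [h3, Matrix.add_mulVec, h1, aeval_companion_mulVec]
    ext j; simp

end Companion

section Hensel

theorem hensel_norm (h2 : (2 : F) ≠ 0) {p u s : F[X]} (hp : Irreducible p)
    (hpp : p ∣ p.comp (-X)) (hu : u.comp (-X) = u) (hpu : ¬ p ∣ u)
    (hs : p ∣ s * s.comp (-X) - u) (k : ℕ) :
    ∃ t : F[X], p ^ (k + 1) ∣ t * t.comp (-X) - u := by
  induction k with
  | zero => exact ⟨s, by simpa using hs⟩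
  | succ k ih =>
    obtain ⟨t, e, he⟩ := ih
    have hpt : ¬ p ∣ t * t.comp (-X) := by
      intro h
      apply hpu
      have : u = t * t.comp (-X) - p ^ (k + 1) * e := by rw [← he]; ring
      rw [this]
      exact dvd_sub h (Dvd.dvd.mul_right (dvd_pow_self _ (by simp)) _)
    obtain ⟨a, c, hac⟩ : IsCoprime (t * t.comp (-X)) (p ^ (k + 1)) :=
      ((hp.coprime_iff_not_dvd.2 hpt).pow_left).symm
    obtain ⟨r, hr⟩ := hpp
    have hac' := congrArg (fun f => f.comp (-X)) hac
    simp only [add_comp, mul_comp, pow_comp, comp_neg_X_comp_neg_X, one_comp, hr] at hac'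
    set τ := t.comp (-X) with hτ
    have hττ : τ.comp (-X) = t := comp_neg_X_comp_neg_X t
    have he' : (t * τ - u).comp (-X) = t * τ - u := by
      simp only [sub_comp, mul_comp, hττ, hu, ← hτ]; ring
    have hC : (C (2⁻¹ : F)) * 2 = 1 := by
      have : (2 : F[X]) = C 2 := (map_ofNat C 2).symm
      rw [this, ← C_mul, inv_mul_cancel₀ h2, C_1]
    have h2C : (C (2⁻¹ : F)).comp (-X) = C (2⁻¹ : F) := C_comp
    generalize C (2⁻¹ : F) = H at hC h2C
    set a' := a.comp (-X) with ha'
    have haa' : a'.comp (-X) = a := comp_neg_X_comp_neg_X a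
    set b := H * (a + a') with hb
    refine ⟨t - H * (t * τ - u) * b * t, ?_⟩
    have hcomp : (t - H * (t * τ - u) * b * t).comp (-X) = τ - H * (t * τ - u) * b * τ := by
      have hbb : b.comp (-X) = b := by
        rw [hb, mul_comp, add_comp, h2C, haa', ← ha', add_comm]
      rw [sub_comp, mul_comp, mul_comp, mul_comp, he', h2C, hbb]
    rw [hcomp]
    have hb1 : 1 - b * (t * τ) = p ^ (k + 1) * (H * (c + c.comp (-X) * r ^ (k + 1))) := by
      rw [hb]
      linear_combination (-H) * hac - H * hac' - hC
    have : (t - H * (t * τ - u) * b * t) * (τ - H * (t * τ - u) * b * τ) - u =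
        (t * τ - u) * (1 - b * (t * τ)) + t * τ * (t * τ - u) ^ 2 * (H * b) ^ 2 := by
      linear_combination (-(t * τ * (t * τ - u) * b)) * hC
    rw [this, hb1, he]
    have h4 : p ^ (k + 1 + 1) ∣ p ^ (k + 1) * p ^ (k + 1) := by
      rw [← pow_add]; exact pow_dvd_pow p (by omega)
    obtain ⟨z, hz⟩ := h4
    refine ⟨z * (e * (H * (c + c.comp (-X) * r ^ (k + 1))) + t * τ * e ^ 2 * (H * b) ^ 2), ?_⟩
    linear_combination (e * (H * (c + c.comp (-X) * r ^ (k + 1))) +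
      t * τ * e ^ 2 * (H * b) ^ 2) * hz

theorem exists_norm_mod_even [Finite F] (h2 : (2 : F) ≠ 0) {p u : F[X]} (hp : Irreducible p)
    (hev : ∃ g : F[X], p = g.comp (X ^ 2)) (hu : u.comp (-X) = u) :
    ∃ s : F[X], p ∣ s * s.comp (-X) - u := by
  obtain ⟨g, rfl⟩ := hev
  obtain ⟨v, rfl⟩ := comp_X_sq_of_even h2 hu
  have hexp : ∀ f : F[X], f.comp (X ^ 2) = expand F 2 f := fun f => (expand_eq_comp_X_pow 2).symm
  have hg : Irreducible g := by
    rw [hexp] at hp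
    exact of_irreducible_expand two_ne_zero hp
  have : Fact (Irreducible g) := ⟨hg⟩
  let K := AdjoinRoot g
  have hfd : FiniteDimensional F K := (AdjoinRoot.powerBasis hg.ne_zero).finite
  have : Finite K := Module.finite_of_finite F
  have := Fintype.ofFinite K
  have h2K : (2 : K) ≠ 0 := by
    have : (2 : K) = algebraMap F K 2 := (map_ofNat (algebraMap F K) 2).symm
    rw [this]
    exact (_root_.map_ne_zero _).2 h2
  have hy : AdjoinRoot.root g ≠ 0 := by
    intro h0
    rw [← AdjoinRoot.mk_X, AdjoinRoot.mk_eq_zero] at h0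
    obtain ⟨c, hc⟩ := hg.associated_of_dvd irreducible_X h0
    have h3 : X * C (Polynomial.coeff (c⁻¹ : F[X]ˣ) 0) = g := by
      rw [← hc, ← eq_C_of_natDegree_eq_zero (natDegree_coe_units _)]; simp
    rw [← h3, mul_comp, X_comp, C_comp, sq, mul_assoc] at hp
    rcases hp.isUnit_or_isUnit rfl with h | h
    · exact not_isUnit_X h
    · exact not_isUnit_X (isUnit_of_mul_isUnit_left h)
  have hcard : Fintype.card K % 2 = 1 := by
    refine FiniteField.odd_card_of_char_ne_two fun hch => ?_
    have := ringChar.Nat.cast_ringChar (R := K)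
    rw [hch] at this
    exact h2K (by exact_mod_cast this)
  obtain ⟨α, β, hαβ⟩ := FiniteField.exists_root_sum_quadratic (R := K)
    (f := X ^ 2 - C (AdjoinRoot.mk g v)) (g := C (-AdjoinRoot.root g) * X ^ 2)
    (degree_X_pow_sub_C two_pos _) (degree_C_mul_X_pow 2 (neg_ne_zero.2 hy)) hcard
  obtain ⟨a, rfl⟩ := AdjoinRoot.mk_surjective α
  obtain ⟨b, rfl⟩ := AdjoinRoot.mk_surjective β
  simp only [eval_sub, eval_pow, eval_X, eval_C, eval_mul, ← AdjoinRoot.mk_X] at hαβ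
  have hdvd : g ∣ a ^ 2 - v - X * b ^ 2 := by
    rw [← AdjoinRoot.mk_eq_zero]
    simp only [map_sub, map_mul, map_pow]
    linear_combination hαβ
  obtain ⟨c, hc⟩ := hdvd
  refine ⟨a.comp (X ^ 2) + X * b.comp (X ^ 2), c.comp (X ^ 2), ?_⟩
  have h5 := congrArg (fun f => f.comp (X ^ 2)) hc
  simp only [sub_comp, mul_comp, pow_comp, X_comp] at h5
  simp only [add_comp, mul_comp, X_comp, comp_assoc, pow_comp, neg_sq]
  linear_combination h5

end Hensel

theorem aeval_transpose_mul {κ : Type*} [Fintype κ] [DecidableEq κ] {G Φ : Matrix κ κ F}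
    (h : Φᵀ * G = -(G * Φ)) (f : F[X]) :
    (aeval Φ f)ᵀ * G = G * aeval Φ (f.comp (-X)) := by
  induction f using Polynomial.induction_on with
  | C a => simp [Algebra.algebraMap_eq_smul_one]
  | add p q hp hq => simp [Matrix.add_mul, Matrix.mul_add, hp, hq]
  | monomial n a ih =>
    have e : (C a * X ^ (n + 1) : F[X]) = (C a * X ^ n) * X := by ring
    have e' : aeval Φ ((C a * X ^ (n + 1) : F[X]).comp (-X)) =
        -(Φ * aeval Φ ((C a * X ^ n : F[X]).comp (-X))) := by
      rw [e, Polynomial.mul_comp _ X, X_comp, mul_neg, map_neg, mul_comm, map_mul, aeval_X]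
    rw [e', e, map_mul (aeval Φ) (C a * X ^ n), aeval_X, Matrix.transpose_mul, Matrix.mul_assoc,
      ih, ← Matrix.mul_assoc, h, Matrix.neg_mul, Matrix.mul_assoc, mul_neg]

section Cyc
variable {p : F[X]} {l : ℕ} {G H : Mat F (p ^ l).natDegree}

theorem transpose_companion_mul {χ : F[X]} {G : Mat F χ.natDegree} {ε : F} (hε : ε * ε = 1)
    (hG : Gᵀ = ε • G) (hG' : (G * companion F χ)ᵀ = -ε • (G * companion F χ)) :
    (companion F χ)ᵀ * G = -(G * companion F χ) := by
  rw [Matrix.transpose_mul, hG, Matrix.mul_smul] at hG'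
  have := congrArg (fun M => ε • M) hG'
  simpa [smul_smul, hε] using this

theorem exists_even_quotient (h2 : (2 : F) ≠ 0) (hm : p.Monic) (hp : Irreducible p) (hl : 0 < l)
    (hG : IsUnit G.det) (hH : IsUnit H.det)
    (hG' : (companion F (p ^ l))ᵀ * G = -(G * companion F (p ^ l)))
    (hH' : (companion F (p ^ l))ᵀ * H = -(H * companion F (p ^ l)))
    {ε : F} (hε : ε * ε = 1) (hGs : Gᵀ = ε • G) (hHs : Hᵀ = ε • H) :
    ∃ u : F[X], u.comp (-X) = u ∧ ¬ p ∣ u ∧ H = G * aeval (companion F (p ^ l)) u := by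
  set Φ := companion F (p ^ l)
  have hd := natDegree_pow_pos hm hp hl
  have hc : Commute (G⁻¹ * H) Φ := by
    have h1 : G * Φ = -(Φᵀ * G) := by rw [hG', neg_neg]
    have h3 : H * Φ = -(Φᵀ * H) := by rw [hH', neg_neg]
    have h4 : G * (G⁻¹ * H * Φ) = G * (Φ * (G⁻¹ * H)) := by
      rw [← Matrix.mul_assoc, ← Matrix.mul_assoc, Matrix.mul_nonsing_inv _ hG, Matrix.one_mul, h3,
        ← Matrix.mul_assoc G Φ, h1, Matrix.neg_mul, Matrix.mul_assoc,
        ← Matrix.mul_assoc G, Matrix.mul_nonsing_inv _ hG, Matrix.one_mul]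
    have := congrArg (fun M => G⁻¹ * M) h4
    rw [commute_iff_eq]
    simpa [← Matrix.mul_assoc, Matrix.nonsing_inv_mul _ hG] using this
  obtain ⟨f, hf⟩ := exists_aeval_companion hd hc
  have hHf : H = G * aeval Φ f := by
    rw [← hf, ← Matrix.mul_assoc, Matrix.mul_nonsing_inv _ hG, Matrix.one_mul]
  have hHf' : H = G * aeval Φ (f.comp (-X)) := by
    have := hHs
    rw [hHf, Matrix.transpose_mul, hGs, Matrix.mul_smul, aeval_transpose_mul hG', ← hHf] at this
    have := congrArg (fun M => ε • M) this
    simpa [smul_smul, hε] using this.symm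
  have hcc : (f.comp (-X)).comp (-X) = f := by rw [comp_assoc]; simp
  have hu : H = G * aeval Φ (C (2⁻¹ : F) * (f + f.comp (-X))) := by
    rw [map_mul, map_add, aeval_C, Algebra.algebraMap_eq_smul_one, Matrix.smul_mul, Matrix.one_mul,
      Matrix.mul_smul, Matrix.mul_add, ← hHf, ← hHf', ← two_smul F H, smul_smul,
      inv_mul_cancel₀ h2, one_smul]
  refine ⟨_, by rw [mul_comp, add_comp, hcc, C_comp, add_comm], fun hdvd => ?_, hu⟩
  obtain ⟨c, hc⟩ := hdvd
  have hz : aeval Φ (p ^ l) = 0 := aeval_companion_self (hm.pow l)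
  have hnil : aeval Φ (C (2⁻¹ : F) * (f + f.comp (-X))) ^ l = 0 := by
    rw [hc, ← map_pow, mul_pow, map_mul, hz, Matrix.zero_mul]
  have hdet := congrArg Matrix.det hu
  rw [Matrix.det_mul] at hdet
  rw [hdet] at hH
  have hU := (isUnit_of_mul_isUnit_right hH).pow l
  rw [← Matrix.det_pow, hnil] at hU
  have : Nonempty (Fin (p ^ l).natDegree) := ⟨⟨0, hd⟩⟩
  rw [Matrix.det_zero] at hU
  exact not_isUnit_zero hU

theorem cg_of_norm (h2 : (2 : F) ≠ 0) (hm : p.Monic) (hp : Irreducible p) (hl : 0 < l)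
    (hpp : p ∣ p.comp (-X)) {u s : F[X]}
    (hG' : (companion F (p ^ l))ᵀ * G = -(G * companion F (p ^ l)))
    (hH : IsUnit (G * aeval (companion F (p ^ l)) u).det)
    (hu : u.comp (-X) = u) (hpu : ¬ p ∣ u) (hs : p ∣ s * s.comp (-X) - u) :
    Cg G (G * companion F (p ^ l)) (G * aeval (companion F (p ^ l)) u)
      (G * aeval (companion F (p ^ l)) u * companion F (p ^ l)) := by
  obtain ⟨k, rfl⟩ : ∃ k, l = k + 1 := ⟨l - 1, by omega⟩
  obtain ⟨t, c, ht⟩ := hensel_norm h2 hp hpp hu hpu hs k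
  set Φ := companion F (p ^ (k + 1))
  have hz : aeval Φ (p ^ (k + 1)) = 0 := aeval_companion_self (hm.pow _)
  have h1 : aeval Φ u = aeval Φ (t.comp (-X)) * aeval Φ t := by
    rw [← map_mul, show t.comp (-X) * t = u + p ^ (k + 1) * c by rw [← ht]; ring, map_add,
      map_mul, hz, zero_mul, add_zero]
  have h3 : (aeval Φ t)ᵀ * G * aeval Φ t = G * aeval Φ u := by
    rw [aeval_transpose_mul hG', h1, Matrix.mul_assoc]
  have hS : IsUnit (aeval Φ t).det := by
    rw [← h3, Matrix.det_mul] at hH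
    exact isUnit_of_mul_isUnit_right hH
  refine ⟨aeval Φ t, (aeval Φ t)⁻¹, Matrix.mul_nonsing_inv _ hS, Matrix.nonsing_inv_mul _ hS,
    h3, ?_⟩
  rw [← h3, Matrix.mul_assoc _ _ Φ, (commute_aeval_companion _ t).eq]
  simp only [Matrix.mul_assoc, Φ]

end Cyc

theorem cg_of_even [Finite F] (h2 : (2 : F) ≠ 0) {p : F[X]} {l : ℕ}
    {G H : Mat F (p ^ l).natDegree} (hm : p.Monic) (hp : Irreducible p)
    (hl : 0 < l) (hev : ∃ g : F[X], p = g.comp (X ^ 2)) (hG : IsUnit G.det) (hH : IsUnit H.det)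
    (hGs : Gᵀ = G) (hHs : Hᵀ = H)
    (hG' : (G * companion F (p ^ l))ᵀ = -(G * companion F (p ^ l)))
    (hH' : (H * companion F (p ^ l))ᵀ = -(H * companion F (p ^ l))) :
    Cg G (G * companion F (p ^ l)) H (H * companion F (p ^ l)) := by
  have hGc := transpose_companion_mul (ε := (1 : F)) (by simp) (by simpa using hGs)
    (by simpa using hG')
  have hHc := transpose_companion_mul (ε := (1 : F)) (by simp) (by simpa using hHs)
    (by simpa using hH')
  obtain ⟨u, hu, hpu, rfl⟩ := exists_even_quotient h2 hm hp hl hG hH hGc hHc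
    (ε := (1 : F)) (by simp) (by simpa using hGs) (by simpa using hHs)
  obtain ⟨s, hs⟩ := exists_norm_mod_even h2 hp hev hu
  exact cg_of_norm h2 hm hp hl (by rw [comp_neg_X_of_even hev]) hGc hH hu hpu hs

theorem cg_of_X [Finite F] (h2 : (2 : F) ≠ 0) {ζ : F} (hζ : ¬ IsSquare ζ) {l : ℕ}
    {G H : Mat F (X ^ l : F[X]).natDegree}
    (hl : 0 < l) (hG : IsUnit G.det) (hH : IsUnit H.det) {ε : F} (hε : ε * ε = 1)
    (hGs : Gᵀ = ε • G) (hHs : Hᵀ = ε • H)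
    (hG' : (G * companion F (X ^ l))ᵀ = -ε • (G * companion F (X ^ l)))
    (hH' : (H * companion F (X ^ l))ᵀ = -ε • (H * companion F (X ^ l))) :
    Cg G (G * companion F (X ^ l)) H (H * companion F (X ^ l)) ∨
      Cg G (G * companion F (X ^ l)) (ζ • H) (ζ • (H * companion F (X ^ l))) := by
  have hGc := transpose_companion_mul hε hGs hG'
  have hHc := transpose_companion_mul hε hHs hH'
  obtain ⟨u, hu, hpu, rfl⟩ := exists_even_quotient h2 monic_X irreducible_X hl hG hH hGc hHc
    hε hGs hHs
  have hdvd : (X : F[X]) ∣ X.comp (-X) := by simp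
  rw [X_dvd_iff] at hpu
  have hζ0 : ζ ≠ 0 := fun h => hζ (h ▸ IsSquare.zero)
  have key : IsSquare (u.coeff 0) ∨ IsSquare (ζ * u.coeff 0) := by
    by_contra hcon
    push Not at hcon
    have := Fintype.ofFinite F
    classical
    have e1 := quadraticChar_neg_one_iff_not_isSquare.2 hcon.1
    have e2 := quadraticChar_neg_one_iff_not_isSquare.2 hcon.2
    have e3 := quadraticChar_neg_one_iff_not_isSquare.2 hζ
    rw [map_mul, e1, e3] at e2
    norm_num at e2
  rcases key with ⟨s, hs⟩ | ⟨s, hs⟩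
  · left
    exact cg_of_norm h2 monic_X irreducible_X hl hdvd hGc hH hu (by rwa [X_dvd_iff])
      (s := C s) (by rw [X_dvd_iff]; simp [hs])
  · right
    have := cg_of_norm (u := C ζ * u) h2 monic_X irreducible_X hl hdvd hGc
      (by
        rw [map_mul, aeval_C, Algebra.algebraMap_eq_smul_one, Matrix.smul_mul, Matrix.one_mul,
          Matrix.mul_smul, Matrix.det_smul]
        exact ((Ne.isUnit hζ0).pow _).mul hH) (by rw [mul_comp, hu, C_comp])
      (by rw [X_dvd_iff]; simp [hζ0, hpu]) (s := C s) (by rw [X_dvd_iff]; simp [hs])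
    simpa only [map_mul, aeval_C, Algebra.algebraMap_eq_smul_one, Matrix.smul_mul, Matrix.one_mul,
          Matrix.mul_smul] using this

theorem companion_X_pow (n : ℕ) :
    companion F (X ^ n) = (J F n 0).submatrix (finCongr (natDegree_X_pow n))
      (finCongr (natDegree_X_pow n)) := by
  have hd := natDegree_X_pow (R := F) n
  ext i j
  have hi : (i : ℕ) ≠ n := by have := i.2; omega
  by_cases h : (i : ℕ) = (j : ℕ) + 1
  · have hij : i ≠ j := by rintro rfl; omega
    simp [companion, J, h, hij]
  · simp [companion, J, h, coeff_X_pow, hi]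

theorem mul_J_apply {ι : Type*} {n : ℕ} (G : Matrix ι (Fin n) F) (i : ι) (j : Fin n) :
    (G * J F n 0) i j = if h : (j : ℕ) + 1 < n then G i ⟨j + 1, h⟩ else 0 := by
  rw [Matrix.mul_apply]
  split_ifs with h
  · rw [Finset.sum_eq_single ⟨j + 1, h⟩]
    · have : (⟨j + 1, h⟩ : Fin n) ≠ j := by intro e; have := congrArg Fin.val e; simp at this
      simp [J, this]
    · intro k _ hk
      have : (k : ℕ) ≠ j + 1 := fun e => hk (Fin.ext e)
      simp [J, this]
    · simp
  · refine Finset.sum_eq_zero fun k _ => ?_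
    have : (k : ℕ) ≠ j + 1 := by have := k.2; omega
    simp [J, this]

theorem exists_cyclic_of_J {n : ℕ} {G P Q : Mat F n} {ε : F} (hG : IsUnit G.det)
    (hP : Gᵀ = ε • G) (hQ : (G * J F n 0)ᵀ = -ε • (G * J F n 0)) (hcg : Cg G (G * J F n 0) P Q) :
    ∃ H : Mat F (X ^ n : F[X]).natDegree, IsUnit H.det ∧ Hᵀ = ε • H ∧
      (H * companion F (X ^ n))ᵀ = -ε • (H * companion F (X ^ n)) ∧
      Cg H (H * companion F (X ^ n)) P Q := by
  let e := finCongr (natDegree_X_pow (R := F) n)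
  have hm : G.submatrix e e * companion F (X ^ n) = (G * J F n 0).submatrix e e := by
    rw [companion_X_pow, Matrix.submatrix_mul_equiv]
  refine ⟨G.submatrix e e, by rwa [Matrix.det_submatrix_equiv_self], ?_, ?_, ?_⟩
  · rw [Matrix.transpose_submatrix, hP]; rfl
  · rw [hm, Matrix.transpose_submatrix, hQ]; rfl
  · rw [hm]
    exact (Cg.submatrix G (G * J F n 0) e).symm.trans hcg

theorem cg_diagonal {n : ℕ} (P Q : Mat F n) {d : Fin n → F} (hd : ∀ i, d i ≠ 0) :
    Cg P Q (diagonal d * P * diagonal d) (diagonal d * Q * diagonal d) := by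
  refine ⟨diagonal d, diagonal fun i => (d i)⁻¹, ?_, ?_, ?_, ?_⟩ <;>
    simp [Matrix.diagonal_mul_diagonal, hd]

/-- the principal form of `Cpair`: the nondegenerate one comes first -/
def cModel (F : Type*) [Field F] (n : ℕ) : Mat F n × Mat F n :=
  if Odd n then Cpair F n else (Cpair F n).swap

theorem exists_diagonal_cModel (n : ℕ) : ∃ d : Fin n → F, (∀ i, d i ≠ 0) ∧
    diagonal d * (cModel F n).2 * diagonal d =
      diagonal d * (cModel F n).1 * diagonal d * J F n 0 := by
  let s : ℕ → F := fun t => if n < 2 * t + 3 then 1 else -1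
  have hs : ∀ t, s t * s t = 1 := by intro t; simp only [s]; split_ifs <;> simp
  let D : ℕ → F := fun i => ∏ t ∈ Finset.range i, s t
  have hD : ∀ i, D (i + 1) = D i * s i := fun i => Finset.prod_range_succ _ _
  have hD0 : ∀ i, D i ≠ 0 := fun i => Finset.prod_ne_zero_iff.2 fun t _ h => by
    simpa [h] using hs t
  refine ⟨fun i => D i, fun i => hD0 i, ?_⟩
  ext i j
  have hi := i.2
  have hj := j.2
  rw [mul_J_apply]
  simp only [Matrix.diagonal_mul, Matrix.mul_diagonal]
  unfold cModel Cpair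
  by_cases hn : Odd n
  · obtain ⟨k, hk⟩ := hn
    have hn : Odd n := ⟨k, hk⟩
    simp only [hn, if_true, Matrix.of_apply, Fin.lt_def]
    by_cases h : (i : ℕ) + j + 2 = n
    · have e : s j = if i < (j : ℕ) then 1 else -1 := by
        simp only [s]; split_ifs <;> first | rfl | omega
      rw [dif_pos (by omega), if_pos (show (i : ℕ) + (j + 1) + 1 = n by omega), hD, e]
      split_ifs <;> first | omega | ring
    · split_ifs <;> first | omega | simp
  · have hn' := Nat.not_odd_iff_even.1 hn
    obtain ⟨k, hk⟩ := hn'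
    simp only [hn, if_false, Matrix.of_apply, Prod.swap, Fin.lt_def]
    by_cases h : (i : ℕ) + j + 2 = n
    · have e : s j = if i < (j : ℕ) + 1 then 1 else -1 := by
        simp only [s]; split_ifs <;> first | rfl | omega
      rw [dif_pos (by omega), hD]
      rw [e]
      split_ifs <;> first | omega | ring
    · split_ifs <;> first | omega | simp

theorem cModel_transpose (n : ℕ) (hn : 0 < n) :
    (cModel F n).1ᵀ = (-1 : F) ^ (n - 1) • (cModel F n).1 ∧
    (cModel F n).2ᵀ = -(-1 : F) ^ (n - 1) • (cModel F n).2 ∧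
    (cModel F n).1 * (cModel F n).1 = (-1 : F) ^ (n - 1) • 1 := by
  unfold cModel Cpair
  by_cases hn' : Odd n
  · have e : (-1 : F) ^ (n - 1) = 1 := by
      obtain ⟨k, hk⟩ := hn'
      rw [show n - 1 = 2 * k by omega, pow_mul]; simp
    simp only [hn', if_true, e]
    refine ⟨?_, ?_, ?_⟩
    · ext i j
      simp [add_comm]
    · ext i j
      simp only [Matrix.transpose_apply, Matrix.of_apply, Matrix.smul_apply, Fin.lt_def]
      split_ifs <;> first | omega | simp
    · ext i j
      rw [Matrix.mul_apply, Finset.sum_eq_single ⟨n - 1 - i, by omega⟩]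
      · simp [Matrix.one_apply, Fin.ext_iff]
        split_ifs <;> first | omega | simp
      · intro b _ hb
        have : ¬ (i : ℕ) + b + 1 = n := fun h => hb (Fin.ext (by simp; omega))
        simp [this]
      · simp
  · have e : (-1 : F) ^ (n - 1) = -1 := by
      obtain ⟨k, hk⟩ := Nat.not_odd_iff_even.1 hn'
      rw [show n - 1 = 2 * (k - 1) + 1 by omega, pow_succ, pow_mul]; simp
    simp only [hn', if_false, e, Prod.swap]
    refine ⟨?_, ?_, ?_⟩
    · ext i j
      simp only [Matrix.transpose_apply, Matrix.of_apply, Matrix.smul_apply, Fin.lt_def]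
      split_ifs <;> first | omega | simp
    · ext i j
      simp [add_comm]
    · ext i j
      rw [Matrix.mul_apply, Finset.sum_eq_single ⟨n - 1 - i, by omega⟩]
      · have hne : ¬ 2 * (i : ℕ) + 1 = n := by
          intro h; exact hn' ⟨i, h.symm⟩
        simp only [Matrix.of_apply, Fin.lt_def, Matrix.smul_apply, Matrix.one_apply, Fin.ext_iff]
        split_ifs <;> first | omega | simp
      · intro b _ hb
        have : ¬ (i : ℕ) + b + 1 = n := fun h => hb (Fin.ext (by simp; omega))
        simp [this]
      · simp

theorem exists_cyclic_cModel (n : ℕ) (hn : 0 < n) :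
    ∃ H : Mat F (X ^ n : F[X]).natDegree, IsUnit H.det ∧ Hᵀ = (-1 : F) ^ (n - 1) • H ∧
      (H * companion F (X ^ n))ᵀ = -(-1 : F) ^ (n - 1) • (H * companion F (X ^ n)) ∧
      Cg H (H * companion F (X ^ n)) (cModel F n).1 (cModel F n).2 := by
  obtain ⟨d, hd, h⟩ := exists_diagonal_cModel (F := F) n
  obtain ⟨h1, h2, h3⟩ := cModel_transpose (F := F) n hn
  refine exists_cyclic_of_J (G := diagonal d * (cModel F n).1 * diagonal d) ?_ ?_ ?_ ?_
  · have : IsUnit (cModel F n).1.det := by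
      have := congrArg Matrix.det h3
      rw [Matrix.det_mul, Matrix.det_smul, Matrix.det_one] at this
      refine isUnit_of_mul_isUnit_left (y := (cModel F n).1.det) ?_
      rw [this]
      simp
    rw [Matrix.det_mul, Matrix.det_mul, Matrix.det_diagonal]
    have hu : IsUnit (∏ i, d i) := (Finset.prod_ne_zero_iff.2 fun i _ => hd i).isUnit
    exact (hu.mul this).mul hu
  · rw [Matrix.transpose_mul, Matrix.transpose_mul, h1]
    simp [Matrix.mul_assoc]
  · rw [← h, Matrix.transpose_mul, Matrix.transpose_mul, h2]
    simp [Matrix.mul_assoc]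
  · rw [← h]
    exact (cg_diagonal _ _ hd).symm

/-- the summands allowed in the canonical form -/
def IsSummand (ζ : F) (N : (q : F[X]) → Mat F q.natDegree) (b : PBlock F) : Prop :=
  T3i b ∨ T3ii b ∨ T3iii N b ∨ T3iv b ∨ T3va b ∨ ∃ n, T3vb ζ n b

/-- interchange the two matrices of a pair -/
def swapBlock (b : PBlock F) : PBlock F := ⟨b.1, b.2.swap⟩

theorem psum_map_swapBlock (L : List (PBlock F)) :
    psum (L.map swapBlock) = swapBlock (psum L) := by
  induction L with
  | nil => rfl
  | cons b L ih => rw [List.map_cons, psum, ih]; rfl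

theorem exists_summand_list {ζ : F} {N : (q : F[X]) → Mat F q.natDegree} {L : List (PBlock F)}
    (h : ∀ b ∈ L, ∃ c, IsSummand ζ N c ∧ PCg b c) :
    ∃ L', (∀ c ∈ L', IsSummand ζ N c) ∧ PCg (psum L) (psum L') := by
  induction L with
  | nil => exact ⟨[], by simp, PCg.refl _⟩
  | cons b L ih =>
    obtain ⟨c, hc, hbc⟩ := h b (by simp)
    obtain ⟨L', hL', hLL'⟩ := ih fun b hb => h b (by simp [hb])
    exact ⟨c :: L', by simpa using ⟨hc, hL'⟩, PCg.cons hbc hLL'⟩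

theorem neg_one_pow_pred_eq {l : ℕ} (h2 : (2 : F) ≠ 0) (hl : 0 < l) :
    (Odd l → (-1 : F) ^ (l - 1) = 1) ∧ ((-1 : F) ^ (l - 1) = 1 → Odd l) := by
  constructor
  · rintro ⟨k, rfl⟩
    simp
  · intro h
    by_contra hn
    obtain ⟨k, hk⟩ := Nat.not_odd_iff_even.1 hn
    rw [show l - 1 = 2 * (k - 1) + 1 by omega, pow_succ, pow_mul] at h
    simp only [even_two, Even.neg_pow, one_pow, mul_neg, mul_one] at h
    apply h2
    linear_combination h.symm

section
variable [Finite F] {ζ : F} {N : (q : F[X]) → Mat F q.natDegree}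

theorem pcg_cModel (h2 : (2 : F) ≠ 0) (hζ : ¬ IsSquare ζ) {l : ℕ} (hl : 0 < l) {ε : F}
    (hε : ε = (-1) ^ (l - 1)) {G : Mat F (X ^ l : F[X]).natDegree} (hG : IsUnit G.det)
    (hGs : Gᵀ = ε • G) (hG' : (G * companion F (X ^ l))ᵀ = -ε • (G * companion F (X ^ l))) :
    PCg ⟨_, (G, G * companion F (X ^ l))⟩ ⟨l, cModel F l⟩ ∨
      PCg ⟨_, (G, G * companion F (X ^ l))⟩ ⟨l, (ζ • (cModel F l).1, ζ • (cModel F l).2)⟩ := by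
  obtain ⟨H, hH, hHs, hH', hcg⟩ := exists_cyclic_cModel (F := F) l hl
  rw [← hε] at hHs hH'
  have hε2 : ε * ε = 1 := by rw [hε, ← mul_pow]; simp
  rcases cg_of_X h2 hζ hl hG hH hε2 hGs hHs hG' hH' with h | h
  · exact Or.inl (h.trans hcg)
  · exact Or.inr (h.trans (hcg.smul ζ))

theorem Good.exists_summand (h2 : (2 : F) ≠ 0) (hζ : ¬ IsSquare ζ)
    (hN : ∀ (pp : F[X]) (l : ℕ), pp.Monic → Irreducible pp → 0 < l →
      (∃ g : F[X], pp = g.comp (X ^ 2)) →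
      IsUnit (N (pp ^ l)).det ∧ (N (pp ^ l))ᵀ = N (pp ^ l) ∧
        (N (pp ^ l) * companion F (pp ^ l))ᵀ = -(N (pp ^ l) * companion F (pp ^ l)))
    {b : PBlock F} (h : Good 1 b) : ∃ c, IsSummand ζ N c ∧ PCg b c := by
  obtain ⟨p, l, hm, hp, hl, ⟨hev, hX, -, rfl⟩ | ⟨hc, G, hG, hGs, hG', rfl⟩⟩ := h
  · refine ⟨_, Or.inr (Or.inl ⟨p, l, hm, hp, hl, hev, ?_, rfl⟩), ?_⟩
    · rintro ⟨rfl, ho⟩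
      exact hX ⟨rfl, by rw [(neg_one_pow_pred_eq h2 hl).1 ho, mul_one]⟩
    · have : hypBlock 1 (p ^ l) = pairSkew3 (p ^ l) := by simp [hypBlock, pairSkew3]
      rw [this]
      exact PCg.refl _
  · rcases hc with ⟨-, hev⟩ | ⟨rfl, h1⟩
    · obtain ⟨hN1, hN2, hN3⟩ := hN p l hm hp hl hev
      refine ⟨_, Or.inr (Or.inr (Or.inl ⟨p, l, hm, hp, hl, hev, rfl⟩)), ?_⟩
      exact cg_of_even h2 hm hp hl hev hG hN1 (by simpa using hGs) hN2
        (by simpa using hG') hN3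
    · rw [one_mul] at h1
      have ho := (neg_one_pow_pred_eq h2 hl).2 h1
      rcases pcg_cModel h2 hζ hl h1.symm hG hGs hG' with h | h <;>
        rw [cModel, if_pos ho] at h
      · exact ⟨_, Or.inr (Or.inr (Or.inr (Or.inr (Or.inl ⟨l, hl, rfl⟩)))), h⟩
      · exact ⟨_, Or.inr (Or.inr (Or.inr (Or.inr (Or.inr ⟨l, hl, rfl⟩)))), h⟩

theorem Good.exists_summand_swap (h2 : (2 : F) ≠ 0) (hζ : ¬ IsSquare ζ)
    {b : PBlock F} (h : Good (-1) b) : ∃ c, IsSummand ζ N c ∧ PCg (swapBlock b) c := by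
  have hne : ¬ (-1 : F) = 1 := fun h => h2 (by linear_combination -h)
  obtain ⟨p, l, hm, hp, hl, ⟨hev, hX, h1, rfl⟩ | ⟨hc, G, hG, hGs, hG', rfl⟩⟩ := h
  · obtain rfl := h1.resolve_left hne
    have ho : Odd l := by
      by_contra hn
      obtain ⟨k, hk⟩ := Nat.not_odd_iff_even.1 hn
      refine hX ⟨rfl, ?_⟩
      rw [show l - 1 = 2 * (k - 1) + 1 by omega, pow_succ, pow_mul]
      simp
    refine ⟨_, Or.inr (Or.inr (Or.inr (Or.inl ⟨l, ho, rfl⟩))), ?_⟩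
    let e := finCongr (natDegree_X_pow (R := F) l)
    have h3 := (Cg.submatrix
      (fromBlocks 0 (-(-1 : F) • (companion F (X ^ l))ᵀ) (companion F (X ^ l)) 0)
      (fromBlocks 0 ((-1 : F) • 1) 1 0) (Equiv.sumCongr e.symm e.symm))
    refine ((Cg.reindex _ _ finSumFinEquiv).symm.trans h3).trans ?_
    have h4 := Cg.reindex (fromBlocks 0 (J F l 0)ᵀ (J F l 0) 0) (fromBlocks 0 (-1) 1 0)
      (finSumFinEquiv (m := l) (n := l))
    convert h4 using 1
    · rw [neg_neg, one_smul, companion_X_pow]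
      ext (i | i) (j | j) <;> simp [e]
    · ext (i | i) (j | j) <;> simp [e, Matrix.one_apply]
    · rfl
    · rfl
  · obtain ⟨rfl, h1⟩ := hc.resolve_left fun h => hne h.1
    have hε : (-1 : F) = (-1) ^ (l - 1) := by
      linear_combination h1
    have ho : ¬ Odd l := fun ho => hne (hε.trans ((neg_one_pow_pred_eq h2 hl).1 ho))
    rcases pcg_cModel h2 hζ hl hε hG hGs hG' with h | h <;>
        rw [cModel, if_neg ho] at h
    · exact ⟨_, Or.inr (Or.inr (Or.inr (Or.inr (Or.inl ⟨l, hl, rfl⟩)))), Cg.swap h⟩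
    · exact ⟨_, Or.inr (Or.inr (Or.inr (Or.inr (Or.inr ⟨l, hl, rfl⟩)))), Cg.swap h⟩
end

theorem exists_sq_add_sq [Finite F] (h2 : (2 : F) ≠ 0) (z : F) : ∃ a b : F, a ^ 2 + b ^ 2 = z := by
  have := Fintype.ofFinite F
  have hcard : Fintype.card F % 2 = 1 := by
    refine FiniteField.odd_card_of_char_ne_two fun hch => h2 ?_
    have := ringChar.Nat.cast_ringChar (R := F)
    rw [hch] at this
    exact_mod_cast this
  obtain ⟨a, b, hab⟩ := FiniteField.exists_root_sum_quadratic (R := F)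
    (f := X ^ 2) (g := X ^ 2 - C z) (degree_X_pow 2) (degree_X_pow_sub_C two_pos _) hcard
  simp only [eval_sub, eval_pow, eval_X, eval_C] at hab
  exact ⟨a, b, by linear_combination hab⟩

theorem Cg.double_smul {κ : Type*} [Fintype κ] [DecidableEq κ] (A B : Matrix κ κ F) {a b z : F}
    (hz : z ≠ 0) (hab : a ^ 2 + b ^ 2 = z) :
    Cg (Matrix.fromBlocks A 0 0 A) (Matrix.fromBlocks B 0 0 B)
      (Matrix.fromBlocks (z • A) 0 0 (z • A)) (Matrix.fromBlocks (z • B) 0 0 (z • B)) := by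
  have key : ∀ M : Matrix κ κ F,
      (Matrix.fromBlocks (a • (1 : Matrix κ κ F)) (-b • 1) (b • 1) (a • 1))ᵀ *
        Matrix.fromBlocks M 0 0 M *
        Matrix.fromBlocks (a • (1 : Matrix κ κ F)) (-b • 1) (b • 1) (a • 1) =
      Matrix.fromBlocks (z • M) 0 0 (z • M) := by
    intro M
    simp only [fromBlocks_transpose, fromBlocks_multiply, Matrix.transpose_smul,
      Matrix.transpose_one, Matrix.smul_mul, Matrix.mul_smul, Matrix.one_mul, Matrix.mul_one,
      Matrix.mul_zero, add_zero, zero_add, smul_smul, ← add_smul, ← hab]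
    rw [← zero_smul F M]
    congr 2 <;> ring
  have h1 := key 1
  rw [Matrix.fromBlocks_one, Matrix.mul_one] at h1
  have h3 : (z⁻¹ • (Matrix.fromBlocks (a • (1 : Matrix κ κ F)) (-b • (1 : Matrix κ κ F)) (b • (1 : Matrix κ κ F))
      (a • (1 : Matrix κ κ F)))ᵀ) * Matrix.fromBlocks (a • (1 : Matrix κ κ F)) (-b • 1) (b • 1)
      (a • 1) = 1 := by
    rw [Matrix.smul_mul, h1, Matrix.fromBlocks_smul, smul_smul, inv_mul_cancel₀ hz, smul_zero,
      one_smul, Matrix.fromBlocks_one]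
  exact ⟨_, _, mul_eq_one_comm.1 h3, h3, key A, key B⟩

theorem smul_Cpair_ne {ζ : F} (hζ : ζ ≠ 1) {n : ℕ} (hn : 0 < n) :
    ((ζ • (Cpair F n).1, ζ • (Cpair F n).2) : Mat F n × Mat F n) ≠ Cpair F n := by
  intro h
  obtain ⟨h1, h2⟩ := Prod.ext_iff.1 h
  have h3 : ζ • (cModel F n).1 = (cModel F n).1 := by
    unfold cModel
    split_ifs
    exacts [h1, h2]
  have h4 := (cModel_transpose (F := F) n hn).2.2
  have h5 : ζ • ((cModel F n).1 * (cModel F n).1) = (cModel F n).1 * (cModel F n).1 := by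
    rw [← Matrix.smul_mul, h3]
  rw [h4] at h5
  have h6 := congrFun (congrFun h5 ⟨0, hn⟩) ⟨0, hn⟩
  simp only [Matrix.smul_apply, Matrix.one_apply_eq, smul_eq_mul, mul_one] at h6
  have h7 : ((-1 : F) ^ (n - 1)) ≠ 0 := by simp
  exact hζ (mul_right_cancel₀ h7 (h6.trans (one_mul _).symm))

theorem exists_canon [Finite F] (h2 : (2 : F) ≠ 0) {ζ : F} (hζ : ¬ IsSquare ζ)
    {N : (q : F[X]) → Mat F q.natDegree} (m : ℕ) :
    ∀ L : List (PBlock F), (open Classical in L.countP fun b => ∃ n, T3vb ζ n b) = m →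
      (∀ b ∈ L, IsSummand ζ N b) → ∃ L', Canon3 ζ N L' ∧ PCg (psum L) (psum L') := by
  classical
  induction m using Nat.strong_induction_on with
  | _ m ih =>
    intro L hm hL
    by_cases hone : ∀ n, AtMostOne (T3vb ζ n) L
    · exact ⟨L, ⟨hL, hone⟩, PCg.refl _⟩
    simp only [AtMostOne, not_forall, not_not] at hone
    obtain ⟨n, b₁, b₂, hsub, ⟨hn, rfl⟩, ⟨-, rfl⟩⟩ := hone
    obtain ⟨K, hK⟩ := hsub.exists_perm_append
    have hζ0 : ζ ≠ 0 := fun h => hζ (h ▸ IsSquare.zero)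
    have hζ1 : ζ ≠ 1 := fun h => hζ (h ▸ IsSquare.one)
    obtain ⟨a, b, hab⟩ := exists_sq_add_sq h2 ζ
    have hnot : ¬ ∃ k, T3vb ζ k ⟨n, Cpair F n⟩ := by
      rintro ⟨k, -, hk⟩
      obtain rfl : n = k := congrArg Sigma.fst hk
      exact smul_Cpair_ne hζ1 hn (eq_of_heq (Sigma.mk.inj hk).2).symm
    obtain ⟨L', hL', hcg⟩ := ih _ (by
      rw [← hm, hK.countP_eq]
      simp only [List.cons_append, List.nil_append, List.countP_cons, hnot]
      have : ∃ k, T3vb ζ k ⟨n, (ζ • (Cpair F n).1, ζ • (Cpair F n).2)⟩ := ⟨n, hn, rfl⟩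
      simp only [this]
      simp) (⟨n, Cpair F n⟩ :: ⟨n, Cpair F n⟩ :: K) rfl (by
        intro c hc
        rw [List.mem_cons, List.mem_cons] at hc
        rcases hc with rfl | rfl | hc
        · exact Or.inr (Or.inr (Or.inr (Or.inr (Or.inl ⟨n, hn, rfl⟩))))
        · exact Or.inr (Or.inr (Or.inr (Or.inr (Or.inl ⟨n, hn, rfl⟩))))
        · exact hL c (hK.symm.subset (by simp [hc])))
    refine ⟨L', hL', (PCg.perm hK).trans (PCg.trans ?_ hcg)⟩
    refine (((cg_psum_cons_cons _ _ K).symm.trans (Cg.fromBlocks ?_ (Cg.refl _ _))).trans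
      (cg_psum_cons_cons ⟨n, Cpair F n⟩ ⟨n, Cpair F n⟩ K))
    exact (Cg.double_smul _ _ hζ0 hab).symm

section Pencil
variable {V : Type*} [AddCommGroup V] [Module F V] {A B : LinearMap.BilinForm F V}

/-- the Wong sequence of a pair of forms -/
def wong (A B : LinearMap.BilinForm F V) : ℕ → Submodule F V
  | 0 => ⊥
  | k + 1 => ((wong A B k).map B).comap A

theorem mem_wong_succ {k : ℕ} {x : V} :
    x ∈ wong A B (k + 1) ↔ ∃ y ∈ wong A B k, B y = A x := Iff.rfl

theorem wong_mono (A B : LinearMap.BilinForm F V) : Monotone (wong A B) := by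
  refine monotone_nat_of_le_succ fun n => ?_
  induction n with
  | zero => exact bot_le
  | succ n ih => exact Submodule.comap_mono (Submodule.map_mono ih)

theorem exists_wong_stable [FiniteDimensional F V] (A B : LinearMap.BilinForm F V) :
    ∃ m, wong A B (m + 1) = wong A B m := by
  obtain ⟨m, hm⟩ := WellFoundedGT.monotone_chain_condition ⟨wong A B, wong_mono A B⟩
  exact ⟨m, (hm (m + 1) (Nat.le_succ m)).symm⟩

theorem exists_lift_of_injective {U Z : Type*} [AddCommGroup U] [Module F U] [AddCommGroup Z]
    [Module F Z] (f g : U →ₗ[F] Z) (hf : Function.Injective f) (h : ∀ x, ∃ y, f y = g x) :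
    ∃ N : Module.End F U, ∀ x, f (N x) = g x := by
  refine ⟨(LinearEquiv.ofInjective f hf).symm.toLinearMap ∘ₗ
    g.codRestrict (LinearMap.range f) (fun x => h x), fun x => ?_⟩
  have := LinearEquiv.apply_symm_apply (LinearEquiv.ofInjective f hf)
    (g.codRestrict (LinearMap.range f) (fun x => h x) x)
  exact congrArg Subtype.val this

/-- a pencil without minimal indices splits into an infinite and a finite part -/
theorem exists_regular_split [FiniteDimensional F V] (hA : ∀ x y, A x y = A y x)
    (hB : ∀ x y, B x y = -B y x) (hreg : ∀ k, ∀ x ∈ wong A B k, B x = 0 → x = 0) :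
    ∃ (U W : Submodule F V) (N : Module.End F U) (T : Module.End F W), IsCompl U W ∧
      (∀ u ∈ U, ∀ w ∈ W, A u w = 0 ∧ A w u = 0) ∧ (∀ u ∈ U, ∀ w ∈ W, B u w = 0 ∧ B w u = 0) ∧
      SkewAdj (res B U) N (-1) ∧ IsNilpotent N ∧ res A U = twist (res B U) N ∧
      SkewAdj (res A W) T 1 ∧ res B W = twist (res A W) T := by
  obtain ⟨m, hm⟩ := exists_wong_stable A B
  set U := wong A B m with hU
  have hU1 : ∀ x, x ∈ U ↔ ∃ y ∈ U, B y = A x := fun x => by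
    conv_lhs => rw [← hm]
    exact mem_wong_succ
  set W : Submodule F V := (U.map B).dualCoannihilator with hW
  have hWmem : ∀ w, w ∈ W ↔ ∀ x ∈ U, B x w = 0 := fun w => by
    rw [hW, Submodule.mem_dualCoannihilator]
    simp
  have hBU : ∀ x ∈ U, ∀ w ∈ W, B x w = 0 := fun x hx w hw => (hWmem w).1 hw x hx
  have hAU : ∀ x ∈ U, ∀ w ∈ W, A x w = 0 := fun x hx w hw => by
    obtain ⟨y, hy, hyx⟩ := (hU1 x).1 hx
    rw [← hyx, hBU y hy w hw]
  have hWd : W.dualAnnihilator = U.map B := Subspace.dualCoannihilator_dualAnnihilator_eq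
  have hAW : (W.map A).dualCoannihilator = U := by
    ext z
    rw [Submodule.mem_dualCoannihilator, hU1]
    have : (∃ y ∈ U, B y = A z) ↔ A z ∈ W.dualAnnihilator := by rw [hWd]; rfl
    rw [this, Submodule.mem_dualAnnihilator]
    simp only [Submodule.mem_map, forall_exists_index, and_imp, forall_apply_eq_imp_iff₂]
    exact forall₂_congr fun y _ => by rw [hA]
  have hBW : ∀ y ∈ W, ∃ y' ∈ W, A y' = B y := fun y hy => by
    have h1 : W.map A = U.dualAnnihilator := by
      rw [← hAW, Subspace.dualCoannihilator_dualAnnihilator_eq]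
    have h2 : B y ∈ W.map A := by
      rw [h1, Submodule.mem_dualAnnihilator]
      intro x hx
      rw [hB, hBU x hx y hy, neg_zero]
    exact h2
  have hinj : Function.Injective (B ∘ₗ U.subtype) := by
    rw [injective_iff_map_eq_zero]
    intro x hx
    exact Subtype.ext (hreg m x x.2 hx)
  obtain ⟨N, hN⟩ := exists_lift_of_injective (B ∘ₗ U.subtype) (-(A ∘ₗ U.subtype)) hinj fun x => by
    obtain ⟨y, hy, hyx⟩ := (hU1 x).1 x.2
    exact ⟨-⟨y, hy⟩, by simp [hyx]⟩
  have hN' : ∀ x : U, B (N x) = -A x := hN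
  have hNk : ∀ k, ∀ x : U, (x : V) ∈ wong A B k → (N ^ k) x = 0 := by
    intro k
    induction k with
    | zero =>
      intro x hx
      exact Subtype.ext hx
    | succ k ih =>
      intro x hx
      obtain ⟨y, hy, hyx⟩ := mem_wong_succ.1 hx
      have hyU : y ∈ U := by
        rw [hU1]
        by_cases hkm : k ≤ m
        · exact (hU1 y).1 (wong_mono A B hkm hy)
        · have hst : ∀ j, wong A B (m + j) = U := by
            intro j
            induction j with
            | zero => rfl
            | succ j ihj =>
              rw [← add_assoc, wong, ihj]; exact hm
          refine (hU1 y).1 ?_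
          rw [← hst (k - m), Nat.add_sub_cancel' (by omega)]
          exact hy
      have : N x = -⟨y, hyU⟩ := hinj (by
        rw [map_neg]
        change B (N x) = -B y
        rw [hN', hyx])
      rw [pow_succ, Module.End.mul_apply, this, map_neg, ih _ hy, neg_zero]
  have hnil : N ^ m = 0 := LinearMap.ext fun x => hNk m x x.2
  have hdisj : Disjoint U W := by
    rw [Submodule.disjoint_def]
    have key : ∀ k, ∀ z : U, (z : V) ∈ W → ∃ z' : U, (z' : V) ∈ W ∧ (N ^ k) z' = z := by
      intro k
      induction k with
      | zero => exact fun z hz => ⟨z, hz, rfl⟩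
      | succ k ih =>
        intro z hz
        obtain ⟨z₁, hz₁, rfl⟩ := ih z hz
        obtain ⟨y, hy, hyz⟩ := hBW z₁ hz₁
        have hyU : y ∈ U := (hU1 y).2 ⟨z₁, z₁.2, hyz.symm⟩
        refine ⟨-⟨y, hyU⟩, W.neg_mem hy, ?_⟩
        rw [pow_succ, Module.End.mul_apply]
        congr 1
        refine hinj ?_
        change B (N (-⟨y, hyU⟩)) = B z₁
        rw [hN']
        simp [hyz]
    intro x hx hxW
    obtain ⟨z', -, hz'⟩ := key m ⟨x, hx⟩ hxW
    rw [hnil] at hz'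
    exact (congrArg Subtype.val hz').symm
  have hcompl : IsCompl U W := by
    refine ⟨hdisj, codisjoint_iff.2 (Submodule.eq_top_of_disjoint _ _ ?_ hdisj)⟩
    have h1 := Subspace.finrank_add_finrank_dualCoannihilator_eq (U.map B)
    have h2 : Module.finrank F (U.map B) = Module.finrank F U := by
      rw [← U.range_subtype, ← LinearMap.range_comp,
        LinearMap.finrank_range_of_inj hinj, U.range_subtype]
    rw [h2] at h1
    exact h1.ge
  have hker : ∀ w ∈ W, A w = 0 → w = 0 := fun w hw h => by
    refine (Submodule.disjoint_def.1 hdisj) w ((hU1 w).2 ⟨0, U.zero_mem, ?_⟩) hw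
    rw [h, map_zero]
  have hinjW : Function.Injective (A ∘ₗ W.subtype) := by
    rw [injective_iff_map_eq_zero]
    intro x hx
    exact Subtype.ext (hker x x.2 hx)
  obtain ⟨T, hT⟩ := exists_lift_of_injective (A ∘ₗ W.subtype) (-(B ∘ₗ W.subtype)) hinjW fun x => by
    obtain ⟨y, hy, hyx⟩ := hBW x x.2
    exact ⟨-⟨y, hy⟩, by simp [hyx]⟩
  have hT' : ∀ x : W, A (T x) = -B x := hT
  refine ⟨U, W, N, T, hcompl, fun u hu w hw => ⟨hAU u hu w hw, by rw [hA, hAU u hu w hw]⟩,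
    fun u hu w hw => ⟨hBU u hu w hw, by rw [hB, hBU u hu w hw, neg_zero]⟩,
    ⟨by simp, fun x y => ?_, fun x hx => ?_, fun x y => ?_⟩, ⟨m, hnil⟩, ?_,
    ⟨by simp, fun x y => ?_, fun x hx => ?_, fun x y => ?_⟩, ?_⟩
  · change B x y = -1 * B y x
    rw [hB, neg_one_mul]
  · refine Subtype.ext (Submodule.disjoint_def.1 hdisj x x.2 ((hWmem _).2 fun y hy => ?_))
    rw [hB, neg_eq_zero]
    exact hx ⟨y, hy⟩
  · change B (N x) y = -B x (N y)
    rw [hN', hB x, hN', LinearMap.neg_apply, LinearMap.neg_apply, neg_neg, hA]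
  · ext x y
    change A x y = B x (N y)
    rw [hB, hN', LinearMap.neg_apply, neg_neg, hA]
  · change A x y = 1 * A y x
    rw [hA, one_mul]
  · refine Subtype.ext (hker x x.2 ?_)
    ext z
    obtain ⟨a, ha, b, hb, rfl⟩ := Submodule.mem_sup.1
      (show z ∈ U ⊔ W from hcompl.sup_eq_top ▸ Submodule.mem_top)
    rw [map_add, hA, hAU a ha x x.2, zero_add]
    exact hx ⟨b, hb⟩
  · change A (T x) y = -A x (T y)
    rw [hT', hA x, hT', LinearMap.neg_apply, LinearMap.neg_apply, neg_neg, hB x y, neg_neg]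
  · ext x y
    change B x y = A x (T y)
    rw [hA, hT', LinearMap.neg_apply, hB]

end Pencil

section Chain
variable {V : Type*} [AddCommGroup V] [Module F V] {A B : LinearMap.BilinForm F V}

/-- the coefficients of a polynomial null vector of degree at most `k` of the pencil `B + tA` -/
structure IsChain (A B : LinearMap.BilinForm F V) (k : ℕ) (u : ℕ → V) : Prop where
  zero : B (u 0) = 0
  succ : ∀ i, B (u (i + 1)) = -A (u i)
  eq_zero : ∀ i, k < i → u i = 0

/-- a nonzero chain of minimal length -/
structure IsMinChain (A B : LinearMap.BilinForm F V) (k : ℕ) (u : ℕ → V) : Prop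
    extends IsChain A B k u where
  ne : u ≠ 0
  min : ∀ l < k, ∀ v, IsChain A B l v → v = 0

theorem exists_of_mem_wong (k : ℕ) : ∀ x ∈ wong A B k, ∃ u : ℕ → V, u 0 = x ∧
    (∀ i, B (u (i + 1)) = -A (u i)) ∧ ∀ i, k ≤ i → u i = 0 := by
  induction k with
  | zero =>
    intro x hx
    exact ⟨0, ((Submodule.mem_bot F).1 hx).symm, by simp, by simp⟩
  | succ k ih =>
    intro x hx
    obtain ⟨y, hy, hyx⟩ := mem_wong_succ.1 hx
    obtain ⟨u, hu0, hu, hk⟩ := ih (-y) (neg_mem hy)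
    refine ⟨fun i => Nat.casesOn i x u, rfl, fun i => ?_, fun i hi => ?_⟩
    · cases i with
      | zero => change B (u 0) = -A x; rw [hu0, map_neg, hyx]
      | succ i => exact hu i
    · cases i with
      | zero => omega
      | succ i => exact hk i (by omega)

theorem exists_isMinChain (h : ¬ ∀ k, ∀ x ∈ wong A B k, B x = 0 → x = 0) :
    ∃ k u, IsMinChain A B k u := by
  classical
  have hex : ∃ k u, IsChain A B k u ∧ u ≠ 0 := by
    push Not at h
    obtain ⟨k, x, hx, hBx, hne⟩ := h
    obtain ⟨u, rfl, h1, h2⟩ := exists_of_mem_wong k x hx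
    exact ⟨k, u, ⟨hBx, h1, fun i hi => h2 i hi.le⟩, fun h => hne (by rw [h]; rfl)⟩
  obtain ⟨u, hu, hne⟩ := Nat.find_spec hex
  refine ⟨_, u, hu, hne, fun l hl v hv => ?_⟩
  by_contra hv0
  exact Nat.find_min hex hl ⟨v, hv, hv0⟩

variable {k : ℕ} {u : ℕ → V}

theorem IsMinChain.ne_zero (h : IsMinChain A B k u) : u 0 ≠ 0 := by
  intro h0
  refine h.ne (funext fun i => ?_)
  obtain _ | i := i
  · exact h0
  rcases Nat.eq_zero_or_pos k with rfl | hk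
  · exact h.eq_zero _ i.succ_pos
  · exact congrFun (h.min (k - 1) (by omega) (fun i => u (i + 1))
      ⟨by rw [h.succ, h0, map_zero, neg_zero], fun i => h.succ _,
        fun i hi => h.eq_zero _ (by omega)⟩) i

theorem IsMinChain.last_ne_zero (h : IsMinChain A B k u) : u k ≠ 0 := by
  intro h0
  rcases Nat.eq_zero_or_pos k with rfl | hk
  · exact h.ne_zero h0
  · refine h.ne (h.min (k - 1) (by omega) u ⟨h.zero, h.succ, fun i hi => ?_⟩)
    rcases Nat.lt_or_ge k i with hi' | hi'
    · exact h.eq_zero _ hi'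
    · rwa [show i = k by omega]

theorem IsChain.map_last (h : IsChain A B k u) : A (u k) = 0 := by
  have := h.succ k
  rwa [h.eq_zero _ k.lt_succ_self, map_zero, eq_comm, neg_eq_zero] at this

theorem IsChain.form_eq_zero (h : IsChain A B k u) (hA : ∀ x y, A x y = A y x)
    (hB : ∀ x y, B x y = -B y x) (i j : ℕ) : A (u i) (u j) = 0 := by
  induction j generalizing i with
  | zero =>
    have := congrArg (· (u 0)) (h.succ i)
    simp only [LinearMap.neg_apply] at this
    rw [← neg_eq_zero, ← this, hB, h.zero]
    simp
  | succ j ih =>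
    have h1 := congrArg (· (u (j + 1))) (h.succ i)
    have h2 := congrArg (· (u (i + 1))) (h.succ j)
    simp only [LinearMap.neg_apply] at h1 h2
    rw [← neg_eq_zero, ← h1, hB, h2, hA, ih]
    simp

theorem IsChain.skew_form_eq_zero (h : IsChain A B k u) (hA : ∀ x y, A x y = A y x)
    (hB : ∀ x y, B x y = -B y x) (i j : ℕ) : B (u i) (u j) = 0 := by
  cases i with
  | zero => rw [h.zero]; rfl
  | succ i => rw [h.succ, LinearMap.neg_apply, h.form_eq_zero hA hB, neg_zero]

theorem IsMinChain.linearIndependent_map (h : IsMinChain A B k u) :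
    LinearIndependent F fun i : Fin k => A (u i) := by
  rw [Fintype.linearIndependent_iff]
  intro c hc
  obtain _ | m := k
  · exact fun i => i.elim0
  let d : ℕ → F := fun a => if ha : a ≤ m then c ⟨m - a, by omega⟩ else 0
  let v : ℕ → V := fun i => ∑ p ∈ Finset.HasAntidiagonal.antidiagonal i, d p.1 • u p.2
  have hv : ∀ i, B (v (i + 1)) = -A (v i) := fun i => by
    simp only [v, map_sum, map_add, map_smul, Finset.Nat.sum_antidiagonal_succ']
    rw [h.zero, smul_zero, zero_add, ← Finset.sum_neg_distrib]
    exact Finset.sum_congr rfl fun p _ => by rw [h.succ, smul_neg]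
  have hlast : A (v m) = 0 := by
    simp only [v, map_sum, map_smul]
    rw [← hc, ← Finset.Nat.sum_antidiagonal_swap, Finset.Nat.sum_antidiagonal_eq_sum_range_succ_mk,
      Finset.sum_range]
    refine Finset.sum_congr rfl fun i _ => ?_
    simp only [Prod.fst_swap, Prod.snd_swap, d, dif_pos (Nat.sub_le m i)]
    congr 2
    ext
    simp
    omega
  have hv0 : (fun i => if i ≤ m then v i else 0) = 0 := by
    refine h.min m (by omega) _ ⟨?_, fun i => ?_, fun i hi => if_neg (by omega)⟩
    · simp [v, h.zero]
    · rcases lt_trichotomy i m with hi | rfl | hi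
      · simp only [if_pos hi.le, if_pos (Nat.succ_le_of_lt hi), hv]
      · simp [hlast]
      · rw [if_neg (by omega), if_neg (by omega), map_zero, map_zero, neg_zero]
  have hd : ∀ i, i ≤ m → d i = 0 := by
    intro i
    induction i using Nat.strong_induction_on with
    | _ i ih =>
      intro hi
      have := congrFun hv0 i
      simp only [if_pos hi, v, Pi.zero_apply] at this
      rw [Finset.sum_eq_single (i, 0)] at this
      · exact (smul_eq_zero.1 this).resolve_right h.ne_zero
      · rintro ⟨a, b⟩ hab hne
        rw [Finset.HasAntidiagonal.mem_antidiagonal] at hab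
        dsimp only at hab
        have hb : b ≠ 0 := fun hb => hne (by ext <;> simp <;> omega)
        rw [ih a (by omega) (by omega), zero_smul]
      · simp
  intro i
  have := hd (m - i) (by omega)
  simp only [d, dif_pos (Nat.sub_le m i)] at this
  rw [← this]
  congr 1
  ext
  simp
  omega

theorem IsMinChain.linearIndependent (h : IsMinChain A B k u) :
    LinearIndependent F fun i : Fin (k + 1) => u i := by
  rw [Fintype.linearIndependent_iff]
  intro c hc
  have h1 : ∀ i : Fin k, c i.castSucc = 0 := by
    refine Fintype.linearIndependent_iff.1 h.linearIndependent_map _ ?_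
    have := congrArg A hc
    rw [Fin.sum_univ_castSucc] at this
    simpa [h.map_last] using this
  rw [Fin.sum_univ_castSucc] at hc
  simp only [h1, zero_smul, Finset.sum_const_zero, zero_add, Fin.val_last] at hc
  intro i
  refine Fin.lastCases ?_ h1 i
  exact (smul_eq_zero.1 hc).resolve_right h.last_ne_zero

end Chain

section Chain
variable {V : Type*} [AddCommGroup V] [Module F V] {A B : LinearMap.BilinForm F V}
  {k : ℕ} {u : ℕ → V}

theorem exists_eq_of_forall_eq_zero {E X : Type*} [AddCommGroup E] [Module F E] [AddCommGroup X]
    [Module F X] [FiniteDimensional F X] (β : E →ₗ[F] Module.Dual F X) (θ : Module.Dual F X)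
    (h : ∀ x, (∀ e, β e x = 0) → θ x = 0) : ∃ e, β e = θ := by
  change θ ∈ LinearMap.range β
  rw [← Subspace.dualCoannihilator_dualAnnihilator_eq (W := LinearMap.range β),
    Submodule.mem_dualAnnihilator]
  intro x hx
  rw [Submodule.mem_dualCoannihilator] at hx
  exact h x fun e => hx _ ⟨e, rfl⟩

/-- multiplication by the pencil `B + tA` on sequences of coefficients -/
def pencilMap (A B : LinearMap.BilinForm F V) : (ℕ → V) →ₗ[F] (ℕ → Module.Dual F V) where
  toFun x i := Nat.casesOn i (B (x 0)) fun i => B (x (i + 1)) + A (x i)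
  map_add' x y := by
    ext i v
    cases i
    · simp
    · simp only [Pi.add_apply, map_add, LinearMap.add_apply]; ring
  map_smul' c x := by
    ext i v
    cases i
    · simp
    · simp

theorem isChain_iff_pencilMap : IsChain A B k u ↔ pencilMap A B u = 0 ∧ ∀ i, k < i → u i = 0 := by
  constructor
  · rintro ⟨h0, hs, hk⟩
    refine ⟨funext fun i => ?_, hk⟩
    cases i with
    | zero => exact h0
    | succ i => exact (congrArg (· + A (u i)) (hs i)).trans (neg_add_cancel _)
  · rintro ⟨h, hk⟩
    exact ⟨congrFun h 0, fun i => eq_neg_of_add_eq_zero_left (congrFun h (i + 1)), hk⟩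

/-- extension of a finite sequence by zero -/
def extendZero (m : ℕ) (P : Submodule F V) : (Fin m → P) →ₗ[F] (ℕ → V) where
  toFun p i := if hi : i < m then p ⟨i, hi⟩ else 0
  map_add' p q := by ext i; by_cases hi : i < m <;> simp [hi]
  map_smul' c p := by ext i; by_cases hi : i < m <;> simp [hi]

theorem extendZero_mem {m : ℕ} {P : Submodule F V} (p : Fin m → P) (i : ℕ) :
    extendZero m P p i ∈ P := by
  by_cases hi : i < m <;> simp [extendZero, hi]

theorem extendZero_of_le {m : ℕ} {P : Submodule F V} (p : Fin m → P) {i : ℕ} (hi : m ≤ i) :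
    extendZero m P p i = 0 := by
  simp [extendZero, hi.not_gt]

theorem IsMinChain.finrank_span (h : IsMinChain A B k u) :
    Module.finrank F (Submodule.span F (Set.range u)) = k + 1 := by
  have : Submodule.span F (Set.range u) =
      Submodule.span F (Set.range fun i : Fin (k + 1) => u i) := by
    refine le_antisymm (Submodule.span_le.2 ?_) (Submodule.span_mono ?_)
    · rintro _ ⟨i, rfl⟩
      by_cases hi : i < k + 1
      · exact Submodule.subset_span ⟨⟨i, hi⟩, rfl⟩
      · rw [h.eq_zero i (by omega)]; exact zero_mem _
    · rintro _ ⟨i, rfl⟩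
      exact ⟨i, rfl⟩
  rw [this, finrank_span_eq_card h.linearIndependent, Fintype.card_fin]

theorem IsMinChain.map_eq_zero (h : IsMinChain A B k u) {i : ℕ} (hi : k ≤ i) : A (u i) = 0 := by
  rcases hi.eq_or_lt with rfl | hi
  · exact h.map_last
  · rw [h.eq_zero i hi, map_zero]

theorem IsMinChain.finrank_span_map (h : IsMinChain A B k u) :
    Module.finrank F (Submodule.span F (Set.range fun i => A (u i))) = k := by
  have : Submodule.span F (Set.range fun i => A (u i)) =
      Submodule.span F (Set.range fun i : Fin k => A (u i)) := by
    refine le_antisymm (Submodule.span_le.2 ?_) (Submodule.span_mono ?_)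
    · rintro _ ⟨i, rfl⟩
      by_cases hi : i < k
      · exact Submodule.subset_span ⟨⟨i, hi⟩, rfl⟩
      · dsimp only
        rw [h.map_eq_zero (by omega)]; exact zero_mem _
    · rintro _ ⟨i, rfl⟩
      exact ⟨i, rfl⟩
  rw [this, finrank_span_eq_card h.linearIndependent_map, Fintype.card_fin]

theorem IsChain.map_mem_span (h : IsChain A B k u) {x : V}
    (hx : x ∈ Submodule.span F (Set.range u)) :
    A x ∈ Submodule.span F (Set.range fun i => A (u i)) ∧
      B x ∈ Submodule.span F (Set.range fun i => A (u i)) := by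
  induction hx using Submodule.span_induction with
  | mem x hx =>
    obtain ⟨i, rfl⟩ := hx
    refine ⟨Submodule.subset_span ⟨i, rfl⟩, ?_⟩
    cases i with
    | zero => rw [h.zero]; exact zero_mem _
    | succ i => rw [h.succ]; exact neg_mem (Submodule.subset_span ⟨i, rfl⟩)
  | zero => simp
  | add x y _ _ hx hy => simp only [map_add]; exact ⟨add_mem hx.1 hy.1, add_mem hx.2 hy.2⟩
  | smul a x _ hx =>
    simp only [map_smul]
    exact ⟨Submodule.smul_mem _ _ hx.1, Submodule.smul_mem _ _ hx.2⟩

/-- a shortcut that instance search needs for submodules of a dual space -/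
instance dualAddCommGroup : AddCommGroup (V →ₗ[F] F) := LinearMap.addCommGroup

theorem IsMinChain.mem_span (h : IsMinChain A B k u) [FiniteDimensional F V] (x : ℕ → V)
    (hx : ∀ i, k ≤ i → x i = 0)
    (hZ : ∀ i, pencilMap A B x i ∈ Submodule.span F (Set.range fun i => A (u i))) (i : ℕ) :
    x i ∈ Submodule.span F (Set.range u) := by
  set U := Submodule.span F (Set.range u) with hU
  set Z := Submodule.span F (Set.range fun i => A (u i)) with hZdef
  obtain _ | m := k
  · rw [hx i (by omega)]; exact zero_mem _
  have hmin : ∀ y : ℕ → V, (∀ i, m + 1 ≤ i → y i = 0) →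
      (∀ i : Fin (m + 2), pencilMap A B y i = 0) → y = 0 := by
    intro y hy hy'
    refine h.min m m.lt_succ_self y (isChain_iff_pencilMap.2 ⟨funext fun i => ?_, hy⟩)
    by_cases hi : i < m + 2
    · exact hy' ⟨i, hi⟩
    · obtain ⟨j, rfl⟩ := Nat.exists_eq_add_of_le (Nat.le_of_not_lt hi)
      change pencilMap A B y (m + 2 + j) = 0
      rw [show m + 2 + j = (m + 1 + j) + 1 by ring]
      change B (y (m + 1 + j + 1)) + A (y (m + 1 + j)) = 0
      rw [hy _ (by omega), hy _ (by omega)]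
      simp
  have hmem : ∀ (p : Fin (m + 1) → U) i, pencilMap A B (extendZero _ U p) i ∈ Z := by
    rintro p (_ | i)
    · exact (h.map_mem_span (extendZero_mem p 0)).2
    · exact add_mem (h.map_mem_span (extendZero_mem p _)).2 (h.map_mem_span (extendZero_mem p _)).1
  let Ψ : (Fin (m + 1) → U) →ₗ[F] (Fin (m + 2) → Z) := LinearMap.pi fun j =>
    LinearMap.codRestrict Z (LinearMap.proj (j : ℕ) ∘ₗ pencilMap A B ∘ₗ extendZero _ U)
      fun p => hmem p j
  have hinj : Function.Injective Ψ := by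
    rw [injective_iff_map_eq_zero]
    intro p hp
    have := hmin (extendZero _ U p) (fun i hi => extendZero_of_le p hi)
      fun i => congrArg Subtype.val (congrFun hp i)
    ext i
    have := congrFun this i
    simpa [extendZero, Fin.is_le] using this
  have hsurj : Function.Surjective Ψ := by
    have hfin : Module.finrank F (Fin (m + 1) → U) = Module.finrank F (Fin (m + 2) → Z) := ?_
    · exact (LinearMap.injective_iff_surjective_of_finrank_eq_finrank hfin).1 hinj
    rw [Module.finrank_pi_fintype, Module.finrank_pi_fintype]
    rw [h.finrank_span, h.finrank_span_map]
    simp [mul_comm]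
  obtain ⟨p, hp⟩ := hsurj fun j => ⟨_, hZ j⟩
  have := hmin (x - extendZero _ U p) (fun i hi => by
    rw [Pi.sub_apply, hx i hi, extendZero_of_le p hi, sub_zero]) fun i => by
      rw [map_sub, Pi.sub_apply, sub_eq_zero]
      exact (congrArg Subtype.val (congrFun hp i)).symm
  rw [sub_eq_zero.1 this]
  exact extendZero_mem p i

end Chain

section Chain
variable {V : Type*} [AddCommGroup V] [Module F V] {A B : LinearMap.BilinForm F V}
  {k : ℕ} {u : ℕ → V}

theorem IsMinChain.exists_dual_family (h : IsMinChain A B k u) [FiniteDimensional F V] :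
    ∃ w : ℕ → V, ∀ i < k, ∀ j, A (u j) (w i) = if i = j then 1 else 0 := by
  have key : ∀ i : Fin k, ∃ w : V, ∀ j : Fin k, A (u j) w = if i = j then 1 else 0 := by
    intro i
    obtain ⟨w, hw⟩ := exists_eq_of_forall_eq_zero
      (Fintype.linearCombination F (fun j : Fin k => A (u j))).flip
      (LinearMap.proj i) (fun c hc => congrFun (Fintype.linearIndependent_iff.1
        h.linearIndependent_map c (LinearMap.ext fun x => by
          simpa [Fintype.linearCombination_apply] using hc x)|> funext) i)
    refine ⟨w, fun j => ?_⟩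
    have := LinearMap.congr_fun hw (Pi.single j 1)
    simpa [Fintype.linearCombination_apply, Pi.single_apply] using this
  choose w hw using key
  refine ⟨fun i => if hi : i < k then w ⟨i, hi⟩ else 0, fun i hi j => ?_⟩
  simp only [dif_pos hi]
  by_cases hj : j < k
  · simpa using hw ⟨i, hi⟩ ⟨j, hj⟩
  · rw [h.map_eq_zero (by omega), if_neg (by omega)]
    rfl

theorem IsMinChain.exists_dual_chain (h : IsMinChain A B k u) [FiniteDimensional F V]
    (hA : ∀ x y, A x y = A y x) (hB : ∀ x y, B x y = -B y x) :
    ∃ w : ℕ → V, (∀ i < k, ∀ j, A (u j) (w i) = if i = j then 1 else 0) ∧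
      ∀ i, i + 1 < k → ∀ x, (∀ j, A (u j) x = 0) → B (w i) x = A (w (i + 1)) x := by
  obtain ⟨w, hw⟩ := h.exists_dual_family
  obtain _ | m := k
  · exact ⟨w, hw, by simp⟩
  set Z := Submodule.span F (Set.range fun i => A (u i)) with hZ
  set P : Submodule F V := Z.dualCoannihilator with hP
  have hPmem : ∀ x, x ∈ P ↔ ∀ j, A (u j) x = 0 := by
    intro x
    rw [hP, Submodule.mem_dualCoannihilator]
    constructor
    · exact fun hx j => hx _ (Submodule.subset_span ⟨j, rfl⟩)
    · intro hx f hf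
      induction hf using Submodule.span_induction with
      | mem f hf => obtain ⟨j, rfl⟩ := hf; exact hx j
      | zero => rfl
      | add f g _ _ hf hg => rw [LinearMap.add_apply, hf, hg, add_zero]
      | smul a f _ hf => rw [LinearMap.smul_apply, hf, smul_zero]
  have hZP : P.dualAnnihilator = Z := Subspace.dualCoannihilator_dualAnnihilator_eq
  let β : (ℕ → P) →ₗ[F] Module.Dual F (Fin m → P) := LinearMap.mk₂ F
    (fun p x => ∑ i ∈ Finset.range m,
      (A (p (i + 1)) (extendZero m P x i) - B (p i) (extendZero m P x i)))
    (fun p q x => by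
      rw [← Finset.sum_add_distrib]
      refine Finset.sum_congr rfl fun i _ => ?_
      simp only [Pi.add_apply, Submodule.coe_add, map_add, LinearMap.add_apply]
      ring)
    (fun c p x => by
      rw [Finset.smul_sum]
      refine Finset.sum_congr rfl fun i _ => ?_
      simp only [Pi.smul_apply, Submodule.coe_smul, map_smul, LinearMap.smul_apply, smul_sub])
    (fun p x y => by
      rw [← Finset.sum_add_distrib]
      refine Finset.sum_congr rfl fun i _ => ?_
      simp only [map_add, Pi.add_apply]
      ring)
    (fun c p x => by
      rw [Finset.smul_sum]
      refine Finset.sum_congr rfl fun i _ => ?_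
      simp only [map_smul, Pi.smul_apply, smul_sub])
  let θ : Module.Dual F (Fin m → P) := ∑ i ∈ Finset.range m,
    (B (w i) - A (w (i + 1))) ∘ₗ LinearMap.proj i ∘ₗ extendZero m P
  have hθ : ∀ x, θ x = ∑ i ∈ Finset.range m,
      (B (w i) (extendZero m P x i) - A (w (i + 1)) (extendZero m P x i)) := fun x => by
    simp [θ, LinearMap.sum_apply]
  have hB0 : ∀ i < m, ∀ l, B (w i) (u l) = A (w (i + 1)) (u l) := by
    intro i hi l
    rw [hB, hA, hw _ (by omega)]
    cases l with
    | zero => rw [h.zero]; simp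
    | succ l => rw [h.succ, LinearMap.neg_apply, neg_neg, hw i (by omega)]; simp
  obtain ⟨p, hp⟩ := exists_eq_of_forall_eq_zero β θ (fun x hx => by
    rw [hθ]
    refine Finset.sum_eq_zero fun i hi => ?_
    have hmem := h.mem_span (extendZero m P x) (fun i hi => extendZero_of_le x (by omega))
      (fun j => by
        rw [← hZ, ← hZP, Submodule.mem_dualAnnihilator]
        intro q hq
        have := hx (Pi.single j ⟨q, hq⟩)
        have hβ : β (Pi.single j ⟨q, hq⟩) x = ∑ i ∈ Finset.range m,
          (A ((Pi.single j q : ℕ → V) (i + 1)) (extendZero m P x i) -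
            B ((Pi.single j q : ℕ → V) i) (extendZero m P x i)) := by
          have hs : ∀ i, ((Pi.single j ⟨q, hq⟩ : ℕ → P) i : V) = (Pi.single j q : ℕ → V) i := by
            intro i
            simp only [Pi.single_apply]
            split_ifs <;> rfl
          simp only [← hs]
          rfl
        rw [hβ, Finset.sum_sub_distrib] at this
        have h1 : ∀ j, ∑ i ∈ Finset.range m, B ((Pi.single j q : ℕ → V) i) (extendZero m P x i) =
            B q (extendZero m P x j) := by
          intro j
          by_cases hj : j < m
          · rw [Finset.sum_eq_single j]
            · simp
            · intro b _ hb; simp [hb]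
            · intro hj'; exact absurd (Finset.mem_range.2 hj) hj'
          · rw [extendZero_of_le x (by omega), map_zero]
            refine Finset.sum_eq_zero fun i hi => ?_
            rw [Pi.single_eq_of_ne (by rw [Finset.mem_range] at hi; omega)]
            simp
        rw [h1] at this
        cases j with
        | zero =>
          change B (extendZero m P x 0) q = 0
          rw [hB, ← this, Finset.sum_eq_zero]
          · ring
          · intro i _; simp
        | succ j =>
          change B (extendZero m P x (j + 1)) q + A (extendZero m P x j) q = 0
          rw [hB, hA, neg_add_eq_sub, ← this]
          congr 1
          by_cases hj : j < m
          · rw [Finset.sum_eq_single j]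
            · simp
            · intro b _ hb; simp [hb]
            · intro hj'; exact absurd (Finset.mem_range.2 hj) hj'
          · rw [extendZero_of_le x (by omega), map_zero]
            symm
            refine Finset.sum_eq_zero fun i hi => ?_
            rw [Pi.single_eq_of_ne (by rw [Finset.mem_range] at hi; omega)]
            simp) i
    have hle : Submodule.span F (Set.range u) ≤ LinearMap.ker (B (w i) - A (w (i + 1))) := by
      rw [Submodule.span_le]
      rintro _ ⟨l, rfl⟩
      simp [hB0 i (Finset.mem_range.1 hi) l]
    exact hle hmem)
  refine ⟨fun i => w i + p i, fun i hi j => ?_, fun i hi x hx => ?_⟩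
  · rw [map_add, hw i hi, (hPmem _).1 (p i).2, add_zero]
  · have hi' : i < m := by omega
    have := LinearMap.congr_fun hp (Pi.single ⟨i, hi'⟩ ⟨x, (hPmem x).2 hx⟩)
    rw [hθ] at this
    change (∑ l ∈ Finset.range m, _) = _ at this
    rw [Finset.sum_eq_single_of_mem i (Finset.mem_range.2 hi'),
      Finset.sum_eq_single_of_mem i (Finset.mem_range.2 hi')] at this
    · simp only [extendZero, LinearMap.coe_mk, AddHom.coe_mk, dif_pos hi', Pi.single_eq_same] at this
      simp only [map_add, LinearMap.add_apply]
      linear_combination -this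
    all_goals
      intro l hl hne
      have : extendZero m P (Pi.single ⟨i, hi'⟩ ⟨x, (hPmem x).2 hx⟩) l = 0 := by
        simp [extendZero, hne]
      rw [this]
      simp

end Chain

/-- a solution of the equations `l i j + l j i = -a i j` and `l j (i + 1) - l i (j + 1) = -b i j`,
given below the diagonal -/
def correctionAux (a b : ℕ → ℕ → F) : ℕ → ℕ → F
  | 0, _ => -a 0 0 / 2
  | i + 1, j => if j = i + 1 then -a (i + 1) (i + 1) / 2
      else if j < i then b i j - a (i + 1) j - correctionAux a b i (j + 1) else 0

theorem exists_correction (h2 : (2 : F) ≠ 0) (a b : ℕ → ℕ → F) (ha : ∀ i j, a i j = a j i)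
    (hb : ∀ i j, b i j = -b j i) :
    ∃ l : ℕ → ℕ → F, (∀ i j, l i j + l j i = -a i j) ∧
      ∀ i j, l j (i + 1) - l i (j + 1) = -b i j := by
  let l : ℕ → ℕ → F := fun i j => if j ≤ i then correctionAux a b i j
    else -a i j - correctionAux a b j i
  have hdiag : ∀ i, correctionAux a b i i + correctionAux a b i i = -a i i := by
    intro i
    have : correctionAux a b i i = -a i i / 2 := by
      cases i with
      | zero => rfl
      | succ i => rw [correctionAux, if_pos rfl]
    rw [this]
    field_simp
    ring
  have h1 : ∀ i j, l i j + l j i = -a i j := by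
    intro i j
    rcases lt_trichotomy i j with h | rfl | h
    · simp [l, h.le, h.not_ge]
    · simp [l, hdiag]
    · simp [l, h.le, h.not_ge, ha j i]
  have hlt : ∀ i j, j < i → l j (i + 1) - l i (j + 1) = -b i j := by
    intro i j hij
    have e1 := h1 j (i + 1)
    have e2 : l (i + 1) j = b i j - a (i + 1) j - l i (j + 1) := by
      simp only [l]
      rw [if_pos (by omega), if_pos (by omega), correctionAux, if_neg (by omega), if_pos hij]
    rw [e2, ha j (i + 1)] at e1
    linear_combination e1
  refine ⟨l, h1, fun i j => ?_⟩
  rcases lt_trichotomy i j with h | rfl | h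
  · have := hlt j i h
    rw [hb i j]
    linear_combination -this
  · have : b i i = 0 := by
      have := hb i i
      have h3 : (2 : F) * b i i = 0 := by linear_combination this
      exact (mul_eq_zero.1 h3).resolve_left h2
    rw [sub_self, this, neg_zero]
  · exact hlt i j h

section Chain
variable {V : Type*} [AddCommGroup V] [Module F V] {A B : LinearMap.BilinForm F V}
  {k : ℕ} {u : ℕ → V}

theorem IsMinChain.exists_isotropic_dual_chain (h2 : (2 : F) ≠ 0) (h : IsMinChain A B k u)
    [FiniteDimensional F V] (hA : ∀ x y, A x y = A y x) (hB : ∀ x y, B x y = -B y x) :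
    ∃ w : ℕ → V, (∀ i < k, ∀ j, A (u j) (w i) = if i = j then 1 else 0) ∧
      (∀ i, i + 1 < k → ∀ x, (∀ j, A (u j) x = 0) → B (w i) x = A (w (i + 1)) x) ∧
      ∀ i < k, ∀ j < k, A (w i) (w j) = 0 ∧ B (w i) (w j) = 0 := by
  obtain ⟨w, hw, hwB⟩ := h.exists_dual_chain hA hB
  obtain ⟨l, hl1, hl2⟩ := exists_correction h2 (fun i j => A (w i) (w j)) (fun i j => B (w i) (w j))
    (fun i j => hA _ _) (fun i j => hB _ _)
  let c : ℕ → V := fun i => ∑ s ∈ Finset.range (k + 1), l i s • u s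
  have hwB' : ∀ i < k, ∀ j, B (u (j + 1)) (w i) = if i = j then -1 else 0 := by
    intro i hi j
    rw [h.succ, LinearMap.neg_apply, hw i hi]
    split_ifs <;> simp
  have hcA : ∀ i, ∀ j < k, A (c i) (w j) = l i j := by
    intro i j hj
    simp only [c, map_sum, map_smul, LinearMap.sum_apply, LinearMap.smul_apply, smul_eq_mul]
    rw [Finset.sum_eq_single_of_mem j (Finset.mem_range.2 (by omega))]
    · rw [hw j hj, if_pos rfl, mul_one]
    · intro s _ hs
      rw [hw j hj, if_neg hs.symm, mul_zero]
  have hcB : ∀ i, ∀ j < k, B (c i) (w j) = -l i (j + 1) := by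
    intro i j hj
    simp only [c, map_sum, map_smul, LinearMap.sum_apply, LinearMap.smul_apply, smul_eq_mul]
    rw [Finset.sum_range_succ', h.zero, LinearMap.zero_apply, mul_zero, add_zero,
      Finset.sum_eq_single_of_mem j (Finset.mem_range.2 hj)]
    · rw [hwB' j hj, if_pos rfl, mul_neg_one]
    · intro s _ hs
      rw [hwB' j hj, if_neg hs.symm, mul_zero]
  have hcx : ∀ i x, (∀ j, A (u j) x = 0) → A (c i) x = 0 ∧ B (c i) x = 0 := by
    intro i x hx
    simp only [c, map_sum, map_smul, LinearMap.sum_apply, LinearMap.smul_apply, smul_eq_mul]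
    refine ⟨Finset.sum_eq_zero fun s _ => by rw [hx, mul_zero], Finset.sum_eq_zero fun s _ => ?_⟩
    cases s with
    | zero => rw [h.zero, LinearMap.zero_apply, mul_zero]
    | succ s => rw [h.succ, LinearMap.neg_apply, hx, neg_zero, mul_zero]
  have huc : ∀ j i, A (u j) (c i) = 0 := by
    intro j i
    simp only [c, map_sum, map_smul, smul_eq_mul]
    exact Finset.sum_eq_zero fun s _ => by rw [h.form_eq_zero hA hB, mul_zero]
  refine ⟨fun i => w i + c i, fun i hi j => ?_, fun i hi x hx => ?_, fun i hi j hj => ⟨?_, ?_⟩⟩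
  · rw [map_add, huc, hw i hi, add_zero]
  · simp only [map_add, LinearMap.add_apply]
    rw [(hcx _ x hx).1, (hcx _ x hx).2, hwB i hi x hx]
  · simp only [map_add, LinearMap.add_apply]
    rw [hA (w i) (c j), hcA j i hi, hcA i j hj, (hcx i (c j) fun s => huc s j).1]
    linear_combination hl1 i j
  · simp only [map_add, LinearMap.add_apply]
    rw [hB (w i) (c j), hcB j i hi, hcB i j hj, (hcx i (c j) fun s => huc s j).2]
    linear_combination hl2 i j

/-- the canonical singular block -/
abbrev singBlock (F : Type*) [Field F] (n : ℕ) : PBlock F :=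
  ⟨n + (n - 1), (skewSum (Fmat F n) (Fmat F n)ᵀ, skewSum (Gmat F n) (-(Gmat F n)ᵀ))⟩

theorem IsMinChain.exists_split (h2 : (2 : F) ≠ 0) (h : IsMinChain A B k u)
    [FiniteDimensional F V] (hA : ∀ x y, A x y = A y x) (hB : ∀ x y, B x y = -B y x) :
    ∃ W : Submodule F V, Module.finrank F W < Module.finrank F V ∧
      ∀ {μ : Type} [Fintype μ] [DecidableEq μ] (M N : Matrix μ μ F), Rep (res A W) (res B W) M N →
        Rep A B (fromBlocks (singBlock F (k + 1)).2.1 0 0 M)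
          (fromBlocks (singBlock F (k + 1)).2.2 0 0 N) := by
  obtain ⟨w, hw, hwB, hww⟩ := h.exists_isotropic_dual_chain h2 hA hB
  have hwuB : ∀ i < k, ∀ j, B (w i) (u j) = if i + 1 = j then 1 else 0 := by
    intro i hi j
    rw [hB]
    cases j with
    | zero => rw [h.zero]; simp
    | succ j => rw [h.succ, LinearMap.neg_apply, neg_neg, hw i hi]; simp
  obtain ⟨g, hgu, hgw, hg⟩ : ∃ g : Module.Dual F V, (∀ j ≤ k, g (u j) = if j = k then 1 else 0) ∧
      (∀ i < k, g (w i) = 0) ∧ ∀ i, i + 1 = k → g = B (w i) := by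
    obtain _ | m := k
    · obtain ⟨f, hf⟩ : ∃ f : Module.Dual F V, f (u 0) ≠ 0 := by
        by_contra! hcon
        exact h.ne_zero ((Module.forall_dual_apply_eq_zero_iff F _).1 hcon)
      refine ⟨(f (u 0))⁻¹ • f, fun j hj => ?_, by simp, by simp⟩
      obtain rfl : j = 0 := by omega
      simp [hf]
    · refine ⟨B (w m), fun j _ => ?_, fun i hi => (hww m m.lt_succ_self i hi).2, fun i hi => ?_⟩
      · rw [hwuB m m.lt_succ_self]
        simp [eq_comm]
      · rw [Nat.succ_injective hi]
  let e : Fin (k + 1) ⊕ Fin (k + 1 - 1) → V := Sum.elim (fun j => u j) fun i => w i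
  let π : V →ₗ[F] (Fin (k + 1) ⊕ Fin (k + 1 - 1) → F) := LinearMap.pi
    (Sum.elim (fun j => if (j : ℕ) < k then A (w j) else g) fun i => A (u i))
  have hik : ∀ i : Fin (k + 1 - 1), (i : ℕ) < k := fun i => i.2
  have hπ : ∀ i, π (e i) = Pi.single i 1 := by
    rintro (i | i) <;> ext (j | j) <;> simp only [π, e, LinearMap.pi_apply, Sum.elim_inl, Sum.elim_inr]
    · split_ifs with hj
      · rw [hA, hw j hj]
        simp [Pi.single_apply, Fin.ext_iff]
      · rw [hgu i (by omega)]
        have : (j : ℕ) = k := by omega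
        simp [Pi.single_apply, Fin.ext_iff, this, eq_comm]
    · rw [h.form_eq_zero hA hB]; simp
    · split_ifs with hj
      · rw [(hww j hj i (hik i)).1]; simp
      · rw [hgw i (hik i)]; simp
    · rw [hw i (hik i)]; simp [Pi.single_apply, Fin.ext_iff, eq_comm]
  have hker : ∀ x ∈ LinearMap.ker π, (∀ j, A (u j) x = 0) ∧ (∀ i < k, A (w i) x = 0) ∧ g x = 0 := by
    intro x hx
    rw [LinearMap.mem_ker] at hx
    refine ⟨fun j => ?_, fun i hi => ?_, ?_⟩
    · by_cases hj : j < k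
      · exact congrFun hx (Sum.inr ⟨j, hj⟩)
      · rw [h.map_eq_zero (by omega)]; rfl
    · have := congrFun hx (Sum.inl ⟨i, by omega⟩)
      simpa [π, hi] using this
    · have := congrFun hx (Sum.inl ⟨k, by omega⟩)
      simpa [π] using this
  have hkA : ∀ i, ∀ x ∈ LinearMap.ker π, A (e i) x = 0 := by
    rintro (i | i) x hx
    · exact (hker x hx).1 i
    · exact (hker x hx).2.1 i (hik i)
  have hkB : ∀ i, ∀ x ∈ LinearMap.ker π, B (e i) x = 0 := by
    rintro (⟨_ | i, hi⟩ | i) x hx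
    · change B (u 0) x = 0
      rw [h.zero]; rfl
    · change B (u (i + 1)) x = 0
      rw [h.succ, LinearMap.neg_apply, (hker x hx).1, neg_zero]
    · change B (w i) x = 0
      rcases (Nat.succ_le_of_lt (hik i)).eq_or_lt with hi | hi
      · rw [← hg i hi]; exact (hker x hx).2.2
      · rw [hwB i hi x (hker x hx).1]; exact (hker x hx).2.1 _ hi
  refine ⟨LinearMap.ker π, Submodule.finrank_lt fun htop => ?_, fun M N hMN => ?_⟩
  · have := hπ (Sum.inl 0)
    rw [LinearMap.ker_eq_top.1 htop] at this
    have := congrFun this (Sum.inl 0)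
    simp at this
  · have hsplit := Rep.split e π hπ (fun i x hx => ⟨hkA i x hx, by rw [hA, hkA i x hx]⟩)
      (fun i x hx => ⟨hkB i x hx, by rw [hB, hkB i x hx, neg_zero]⟩) hMN
    refine hsplit.cg (Cg.fromBlocks ?_ (Cg.refl M N))
    have hA' : (Matrix.of fun i j => A (e i) (e j)) =
        fromBlocks 0 (Fmat F (k + 1))ᵀ (Fmat F (k + 1)) 0 := by
      ext (i | i) (j | j)
      · simp [e, h.form_eq_zero hA hB]
      · simp [e, Fmat, hw j (hik j)]
      · simp [e, Fmat, hA (w i), hw i (hik i)]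
      · simp [e, (hww i (hik i) j (hik j)).1]
    have hB' : (Matrix.of fun i j => B (e i) (e j)) =
        fromBlocks 0 (-(Gmat F (k + 1))ᵀ) (Gmat F (k + 1)) 0 := by
      ext (i | i) (j | j)
      · simp [e, h.skew_form_eq_zero hA hB]
      · simp [e, Gmat, hB (u i), hwuB j (hik j)]
      · simp [e, Gmat, hwuB i (hik i)]
      · simp [e, (hww i (hik i) j (hik j)).2]
    rw [hA', hB']
    exact Cg.reindex _ _ _

end Chain

theorem exists_summand_list_of_forms [Finite F] (h2 : (2 : F) ≠ 0) {ζ : F} (hζ : ¬ IsSquare ζ)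
    {N : (q : F[X]) → Mat F q.natDegree}
    (hN : ∀ (pp : F[X]) (l : ℕ), pp.Monic → Irreducible pp → 0 < l →
      (∃ g : F[X], pp = g.comp (X ^ 2)) →
      IsUnit (N (pp ^ l)).det ∧ (N (pp ^ l))ᵀ = N (pp ^ l) ∧
        (N (pp ^ l) * companion F (pp ^ l))ᵀ = -(N (pp ^ l) * companion F (pp ^ l))) (n : ℕ) :
    ∀ {V : Type*} [AddCommGroup V] [Module F V] [FiniteDimensional F V]
      {A B : LinearMap.BilinForm F V}, (∀ x y, A x y = A y x) → (∀ x y, B x y = -B y x) →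
      Module.finrank F V = n →
      ∃ L : List (PBlock F), (∀ b ∈ L, IsSummand ζ N b) ∧ Rep A B (psum L).2.1 (psum L).2.2 := by
  induction n using Nat.strong_induction_on with
  | _ n ih =>
    intro V _ _ _ A B hA hB hn
    by_cases hreg : ∀ k, ∀ x ∈ wong A B k, B x = 0 → x = 0
    · obtain ⟨U, W, T, T', hUW, hAo, hBo, hT, hnil, hresA, hT', hresB⟩ :=
        exists_regular_split hA hB hreg
      obtain ⟨L₁, hL₁, hrep₁⟩ := SkewAdj.exists_list h2 _ hT (Or.inr hnil) rfl
      obtain ⟨L₂, hL₂, hrep₂⟩ := SkewAdj.exists_list h2 _ hT' (Or.inl rfl) rfl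
      rw [← hresA] at hrep₁
      rw [← hresB] at hrep₂
      obtain ⟨L₁', hL₁', hc₁⟩ := exists_summand_list (L := L₁.map swapBlock) (ζ := ζ) (N := N)
        fun b hb => by
          obtain ⟨c, hc, rfl⟩ := List.mem_map.1 hb
          exact (hL₁ c hc).exists_summand_swap h2 hζ
      obtain ⟨L₂', hL₂', hc₂⟩ := exists_summand_list (L := L₂) (ζ := ζ) (N := N)
        fun b hb => (hL₂ b hb).exists_summand h2 hζ hN
      rw [psum_map_swapBlock] at hc₁
      refine ⟨L₁' ++ L₂', fun b hb => (List.mem_append.1 hb).elim (hL₁' b) (hL₂' b), ?_⟩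
      have hrep₁' : Rep (res A U) (res B U) (psum L₁).2.2 (psum L₁).2.1 := by
        obtain ⟨b, h1, h2⟩ := hrep₁
        exact ⟨b, h2, h1⟩
      exact (Rep.sum_of_isCompl hUW hAo hBo (hrep₁'.cg hc₁) (hrep₂.cg hc₂)).cg (cg_psum_append _ _)
    · obtain ⟨k, u, hu⟩ := exists_isMinChain hreg
      obtain ⟨W, hW, hsplit⟩ := hu.exists_split h2 hA hB
      obtain ⟨L, hL, hrep⟩ := ih _ (hn ▸ hW) (V := W) (A := res A W) (B := res B W)
        (fun x y => hA x y) (fun x y => hB x y) rfl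
      refine ⟨singBlock F (k + 1) :: L, ?_, (hsplit _ _ hrep).cg (cg_psum_cons _ L)⟩
      intro b hb
      rcases List.mem_cons.1 hb with rfl | hb
      · exact Or.inl ⟨k + 1, k.succ_pos, rfl⟩
      · exact hL b hb

theorem exists_canonical_list [Finite F] (h2 : (2 : F) ≠ 0) {ζ : F} (hζ : ¬ IsSquare ζ)
    {N : (q : F[X]) → Mat F q.natDegree}
    (hN : ∀ (pp : F[X]) (l : ℕ), pp.Monic → Irreducible pp → 0 < l →
      (∃ g : F[X], pp = g.comp (X ^ 2)) →
      IsUnit (N (pp ^ l)).det ∧ (N (pp ^ l))ᵀ = N (pp ^ l) ∧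
        (N (pp ^ l) * companion F (pp ^ l))ᵀ = -(N (pp ^ l) * companion F (pp ^ l))) {n : ℕ}
    {A B : Mat F n} (hA : Aᵀ = A) (hB : Bᵀ = -B) :
    ∃ L : List (PBlock F), Canon3 ζ N L ∧ PCong ⟨n, (A, B)⟩ (psum L) := by
  have htb : ∀ (M : Mat F n) i j, (Matrix.toBilin' M) (Pi.basisFun F (Fin n) i)
      (Pi.basisFun F (Fin n) j) = M i j := fun M i j => by
    simp [Matrix.toBilin'_single]
  have hflip : ∀ (M : Mat F n) x y, Matrix.toBilin' Mᵀ x y = Matrix.toBilin' M y x := by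
    intro M x y
    simp only [Matrix.toBilin'_apply', mulVec_transpose, dotProduct_comm x, ← dotProduct_mulVec]
  obtain ⟨L, hL, hrep⟩ := exists_summand_list_of_forms h2 hζ hN _ (A := Matrix.toBilin' A)
    (B := Matrix.toBilin' B) (fun x y => by rw [← hflip, hA])
    (fun x y => by rw [← hflip, hB]; simp) rfl
  obtain ⟨L', hL', hLL'⟩ := exists_canon h2 hζ _ L rfl hL
  refine ⟨L', hL', PCg.pcong (PCg.trans ?_ hLL')⟩
  exact Rep.cg_of ⟨Pi.basisFun F (Fin n), htb A, htb B⟩ hrep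

section Sol
variable {ι ι' κ κ' δ ε : Type*} [Fintype ι] [Fintype ι'] [Fintype δ]

/-- the solutions of the matrix equation `A f P = B f Q` -/
def Sol (A B : Matrix κ ι F) (P Q : Matrix δ ε F) : Submodule F (Matrix ι δ F) where
  carrier := {f | A * f * P = B * f * Q}
  add_mem' {f g} (hf : _ = _) (hg : _ = _) := by
    simp only [Set.mem_ofPred_eq, Matrix.mul_add, Matrix.add_mul, hf, hg]
  zero_mem' := by simp
  smul_mem' c f (hf : _ = _) := by
    simp only [Set.mem_ofPred_eq, Matrix.mul_smul, Matrix.smul_mul, hf]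

theorem mem_Sol {A B : Matrix κ ι F} {P Q : Matrix δ ε F} {f : Matrix ι δ F} :
    f ∈ Sol A B P Q ↔ A * f * P = B * f * Q := Iff.rfl

/-- the dimension of the space of solutions of `A f P = B f Q` -/
def sd (A B : Matrix κ ι F) (P Q : Matrix δ ε F) : ℕ := Module.finrank F (Sol A B P Q)

section Basic
variable {A B : Matrix κ ι F} {P Q : Matrix δ ε F}

theorem sd_eq_zero (h : ∀ f : Matrix ι δ F, A * f * P = B * f * Q → f = 0) : sd A B P Q = 0 := by
  have : Sol A B P Q = ⊥ := (Submodule.eq_bot_iff _).2 h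
  rw [sd, this, finrank_bot]

theorem fromBlocks_mem_Sol {A' B' : Matrix κ' ι' F} {f : Matrix ι δ F} {g : Matrix ι' δ F} :
    fromRows f g ∈ Sol (fromBlocks A 0 0 A') (fromBlocks B 0 0 B') P Q ↔
      f ∈ Sol A B P Q ∧ g ∈ Sol A' B' P Q := by
  simp only [mem_Sol, fromBlocks_mul_fromRows, Matrix.zero_mul, add_zero, zero_add, fromRows_mul]
  exact fromRows_inj.eq_iff

/-- the solutions for a direct sum -/
def SolProd (A B : Matrix κ ι F) (A' B' : Matrix κ' ι' F) (P Q : Matrix δ ε F) :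
    Sol (fromBlocks A 0 0 A') (fromBlocks B 0 0 B') P Q ≃ₗ[F] Sol A B P Q × Sol A' B' P Q where
  toFun f := (⟨toRows₁ f.1, (fromBlocks_mem_Sol.1 (by rw [fromRows_toRows]; exact f.2)).1⟩,
    ⟨toRows₂ f.1, (fromBlocks_mem_Sol.1 (by rw [fromRows_toRows]; exact f.2)).2⟩)
  invFun p := ⟨fromRows p.1.1 p.2.1, fromBlocks_mem_Sol.2 ⟨p.1.2, p.2.2⟩⟩
  map_add' _ _ := rfl
  map_smul' _ _ := rfl
  left_inv f := Subtype.ext (fromRows_toRows _)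
  right_inv p := by
    refine Prod.ext (Subtype.ext ?_) (Subtype.ext ?_)
    · exact toRows₁_fromRows _ _
    · exact toRows₂_fromRows _ _

theorem sd_fromBlocks (A B : Matrix κ ι F) (A' B' : Matrix κ' ι' F) (P Q : Matrix δ ε F) :
    sd (fromBlocks A 0 0 A') (fromBlocks B 0 0 B') P Q = sd A B P Q + sd A' B' P Q := by
  rw [sd, (SolProd A B A' B' P Q).finrank_eq, Module.finrank_prod, sd, sd]

end Basic

variable [Fintype κ] [Fintype κ'] [DecidableEq ι] [DecidableEq ι'] [DecidableEq κ]

/-- left multiplication by an invertible matrix -/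
def mulLeftEquiv {S : Matrix ι ι' F} {R : Matrix ι' ι F} (h1 : S * R = 1) (h2 : R * S = 1) :
    Matrix ι' δ F ≃ₗ[F] Matrix ι δ F where
  toFun f := S * f
  invFun f := R * f
  map_add' := Matrix.mul_add _
  map_smul' c f := Matrix.mul_smul _ _ _
  left_inv f := by simp only [← Matrix.mul_assoc, h2, Matrix.one_mul]
  right_inv f := by simp only [← Matrix.mul_assoc, h1, Matrix.one_mul]

theorem sd_mul {U : Matrix κ' κ F} {V : Matrix κ κ' F} (hVU : V * U = 1) {S : Matrix ι ι' F}
    {R : Matrix ι' ι F} (h1 : S * R = 1) (h2 : R * S = 1) (A B : Matrix κ ι F)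
    (P Q : Matrix δ ε F) : sd (U * A * S) (U * B * S) P Q = sd A B P Q := by
  rw [sd, sd, ← LinearEquiv.finrank_map_eq (mulLeftEquiv h1 h2)]
  suffices h : (Sol (U * A * S) (U * B * S) P Q).map
      (mulLeftEquiv (δ := δ) h1 h2 : Matrix ι' δ F →ₗ[F] Matrix ι δ F) = Sol A B P Q by rw [h]
  ext f
  have key : ∀ g, g ∈ Sol (U * A * S) (U * B * S) P Q ↔ S * g ∈ Sol A B P Q := by
    intro g
    have e : ∀ (M : Matrix κ ι F) (T : Matrix δ ε F),
        U * M * S * g * T = U * (M * (S * g) * T) := by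
      intros; simp only [Matrix.mul_assoc]
    rw [mem_Sol, mem_Sol, e, e]
    refine ⟨fun h => ?_, fun h => by rw [h]⟩
    have := congrArg (V * ·) h
    simpa only [← Matrix.mul_assoc V U, hVU, Matrix.one_mul] using this
  constructor
  · rintro ⟨g, hg, rfl⟩
    exact (key g).1 hg
  · intro hf
    refine ⟨R * f, (key _).2 ?_, ?_⟩
    · rwa [← Matrix.mul_assoc, h1, Matrix.one_mul]
    · exact (mulLeftEquiv h1 h2).right_inv f

theorem sd_mul_left {U : Matrix κ' κ F} {V : Matrix κ κ' F} (hVU : V * U = 1) (A B : Matrix κ ι F)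
    (P Q : Matrix δ ε F) : sd (U * A) (U * B) P Q = sd A B P Q := by
  simpa using sd_mul hVU (Matrix.one_mul (1 : Matrix ι ι F)) (Matrix.one_mul _) A B P Q

theorem Cg.sd_eq {A B : Matrix ι ι F} {A' B' : Matrix κ κ F} (h : Cg A B A' B')
    (P Q : Matrix δ ε F) : sd A' B' P Q = sd A B P Q := by
  obtain ⟨S, R, h1, h2, rfl, rfl⟩ := h
  refine sd_mul (V := Rᵀ) ?_ h1 h2 A B P Q
  rw [← transpose_mul, h1, transpose_one]

theorem sd_submatrix (A B : Matrix κ ι F) (P Q : Matrix δ ε F) (e : κ' ≃ κ) (e' : ι' ≃ ι) :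
    sd (A.submatrix e e') (B.submatrix e e') P Q = sd A B P Q := by
  have hM : ∀ M : Matrix κ ι F, M.submatrix e e' =
      (1 : Matrix κ κ F).submatrix e id * M * (1 : Matrix ι ι F).submatrix id e' := by
    intro M
    ext i j
    simp [Matrix.mul_apply, Matrix.one_apply]
  rw [hM, hM]
  refine sd_mul (V := (1 : Matrix κ κ F).submatrix id e)
    (R := (1 : Matrix ι ι F).submatrix e' id) ?_ ?_ ?_ A B P Q
  · rw [submatrix_mul_equiv]; simp
  · rw [submatrix_mul_equiv]; simp
  · rw [← submatrix_mul _ _ _ _ _ Function.bijective_id]; simp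

theorem sd_skewSum {k l : ℕ} (A B : Matrix (Fin k) (Fin l) F) (A' B' : Matrix (Fin l) (Fin k) F)
    (P Q : Matrix δ ε F) :
    sd (skewSum A A') (skewSum B B') P Q = sd A B P Q + sd A' B' P Q := by
  rw [← sd_fromBlocks]
  have h : ∀ (A : Matrix (Fin k) (Fin l) F) (A' : Matrix (Fin l) (Fin k) F), skewSum A A' =
      (fromBlocks A 0 0 A').submatrix (finSumFinEquiv.symm.trans (Equiv.sumComm _ _))
        finSumFinEquiv.symm := by
    intro A A'
    rw [skewSum, Matrix.reindex_apply]
    ext i j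
    simp only [Matrix.submatrix_apply, Equiv.trans_apply]
    rcases finSumFinEquiv.symm i with i | i <;> rcases finSumFinEquiv.symm j with j | j <;> rfl
  rw [h, h, sd_submatrix]

theorem sd_one_of_gram {G Φ : Matrix ι ι F} (hG : IsUnit G.det) (P Q : Matrix δ ε F) :
    sd G (G * Φ) P Q = sd 1 Φ P Q := by
  have := sd_mul_left (Matrix.nonsing_inv_mul _ hG) 1 Φ P Q
  rwa [Matrix.mul_one] at this

theorem sd_psum (P Q : Matrix δ ε F) (L : List (PBlock F)) :
    sd (psum L).2.1 (psum L).2.2 P Q = (L.map fun b => sd b.2.1 b.2.2 P Q).sum := by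
  induction L with
  | nil =>
    refine sd_eq_zero fun f _ => ?_
    ext i
    exact i.elim0
  | cons b L ih => rw [(cg_psum_cons b L).sd_eq, sd_fromBlocks, ih, List.map_cons, List.sum_cons]

end Sol

section Intertwine
variable {ι κ δ : Type*} [Fintype ι] [Fintype δ] [DecidableEq ι] [DecidableEq δ]

theorem sd_intertwine_transpose (X : Matrix ι ι F) (Y : Matrix δ δ F) :
    sd 1 Xᵀ Yᵀ 1 = sd 1 Y X 1 := by
  rw [sd, sd, ← LinearEquiv.finrank_map_eq (Matrix.transposeLinearEquiv ι δ F F)]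
  suffices h : (Sol 1 Xᵀ Yᵀ 1).map (Matrix.transposeLinearEquiv ι δ F F :
      Matrix ι δ F →ₗ[F] Matrix δ ι F) = Sol 1 Y X 1 by rw [h]
  ext f
  constructor
  · rintro ⟨g, hg, rfl⟩
    have h := congrArg Matrix.transpose (mem_Sol.1 hg)
    simp only [Matrix.one_mul, Matrix.mul_one, transpose_mul, transpose_transpose] at h
    rw [mem_Sol]
    simpa using h.symm
  · intro h
    refine ⟨fᵀ, ?_, transpose_transpose _⟩
    have h := congrArg Matrix.transpose (mem_Sol.1 h)
    simp only [Matrix.one_mul, Matrix.mul_one, transpose_mul] at h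
    change 1 * fᵀ * Yᵀ = Xᵀ * fᵀ * 1
    simpa using h.symm

open Kronecker in
/-- intertwiners between two matrices, in either direction, form spaces of the same dimension -/
theorem sd_intertwine_comm (X : Matrix ι ι F) (Y : Matrix δ δ F) :
    sd 1 X Y 1 = sd 1 Y X 1 := by
  have key : ∀ (X : Matrix ι ι F) (Y : Matrix δ δ F), sd 1 X Y 1 = Module.finrank F
      (LinearMap.ker (Yᵀ ⊗ₖ (1 : Matrix ι ι F) - (1 : Matrix δ δ F) ⊗ₖ X).mulVecLin) := by
    intro X Y
    let e : Matrix ι δ F ≃ₗ[F] (δ × ι → F) :=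
      { toFun := vec
        invFun := fun v => Matrix.of fun i j => v (j, i)
        map_add' := fun _ _ => rfl
        map_smul' := fun _ _ => rfl
        left_inv := fun _ => rfl
        right_inv := fun _ => rfl }
    have he : ∀ f, f ∈ Sol 1 X Y 1 ↔ e f ∈
        LinearMap.ker (Yᵀ ⊗ₖ (1 : Matrix ι ι F) - (1 : Matrix δ δ F) ⊗ₖ X).mulVecLin := by
      intro f
      rw [LinearMap.mem_ker, mulVecLin_apply, Matrix.sub_mulVec]
      change _ ↔ _ *ᵥ vec f - _ *ᵥ vec f = 0
      rw [kronecker_mulVec_vec, kronecker_mulVec_vec, sub_eq_zero, mem_Sol, transpose_transpose,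
        transpose_one]
      exact e.injective.eq_iff.symm
    rw [sd, ← LinearEquiv.finrank_map_eq e]
    suffices h : (Sol 1 X Y 1).map (e : Matrix ι δ F →ₗ[F] (δ × ι → F)) = _ by rw [h]
    ext v
    constructor
    · rintro ⟨f, hf, rfl⟩
      exact (he f).1 hf
    · intro hv
      exact ⟨e.symm v, (he _).2 (by rwa [e.apply_symm_apply]), e.apply_symm_apply v⟩
  rw [← sd_intertwine_transpose X Y, key, key]
  have h1 := (Yᵀ ⊗ₖ (1 : Matrix ι ι F) - (1 : Matrix δ δ F) ⊗ₖ X).rank_transpose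
  have h2 := LinearMap.finrank_range_add_finrank_ker
    (Yᵀ ⊗ₖ (1 : Matrix ι ι F) - (1 : Matrix δ δ F) ⊗ₖ X).mulVecLin
  have h3 := LinearMap.finrank_range_add_finrank_ker
    (Yᵀᵀ ⊗ₖ (1 : Matrix ι ι F) - (1 : Matrix δ δ F) ⊗ₖ Xᵀ).mulVecLin
  rw [Matrix.transpose_sub, ← kroneckerMap_transpose, ← kroneckerMap_transpose, transpose_one,
    transpose_one] at h1
  rw [Matrix.rank, Matrix.rank] at h1
  omega

theorem aeval_mul_of_intertwine {X : Matrix ι ι F} {Y : Matrix δ δ F} {f : Matrix ι δ F}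
    (h : f * Y = X * f) (q : F[X]) : f * aeval Y q = aeval X q * f := by
  induction q using Polynomial.induction_on with
  | C a => simp [Algebra.algebraMap_eq_smul_one]
  | add p q hp hq => simp [Matrix.add_mul, Matrix.mul_add, hp, hq]
  | monomial n a ih =>
    rw [pow_succ, ← mul_assoc, map_mul (aeval Y), map_mul (aeval X), aeval_X, aeval_X,
      ← Matrix.mul_assoc, ih, Matrix.mul_assoc, h, ← Matrix.mul_assoc]

theorem sd_intertwine_coprime {X : Matrix ι ι F} {Y : Matrix δ δ F} {a b : F[X]}
    (hab : IsCoprime a b) (ha : aeval X a = 0) (hb : aeval Y b = 0) : sd 1 X Y 1 = 0 := by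
  refine sd_eq_zero fun f hf => ?_
  rw [Matrix.one_mul, Matrix.mul_one] at hf
  obtain ⟨u, v, huv⟩ := hab
  have : f * aeval Y (u * a + v * b) = 0 := by
    rw [map_add, Matrix.mul_add, aeval_mul_of_intertwine hf (u * a), map_mul, map_mul, ha, hb]
    simp
  rw [huv] at this
  simpa using this

theorem sd_intertwine_companion {X : Matrix ι ι F} {χ : F[X]} (hχ : χ.Monic)
    (hd : 0 < χ.natDegree) (hX : aeval X χ = 0) :
    sd 1 X (companion F χ) 1 = Fintype.card ι := by
  let e : Sol 1 X (companion F χ) 1 →ₗ[F] (ι → F) :=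
    { toFun := fun f => f.1 *ᵥ Pi.single ⟨0, hd⟩ 1
      map_add' := fun f g => Matrix.add_mulVec _ _ _
      map_smul' := fun c f => Matrix.smul_mulVec _ _ _ }
  have he : Function.Bijective e := by
    constructor
    · intro f g hfg
      refine Subtype.ext (Matrix.ext_of_mulVec_single fun i => ?_)
      have hcol : ∀ f : Sol 1 X (companion F χ) 1, f.1 *ᵥ Pi.single i 1 =
          (X ^ (i : ℕ)) *ᵥ e f := by
        intro f
        have hf := mem_Sol.1 f.2
        rw [Matrix.one_mul, Matrix.mul_one] at hf
        have := aeval_mul_of_intertwine hf (Polynomial.X ^ (i : ℕ))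
        rw [map_pow, map_pow, aeval_X, aeval_X] at this
        rw [← companion_pow_mulVec hd i, Matrix.mulVec_mulVec, this, ← Matrix.mulVec_mulVec]
        rfl
      rw [hcol, hcol, hfg]
    · intro v
      have hpow : ∀ n w, ((Matrix.toLin' X) ^ n) w = (X ^ n) *ᵥ w := by
        intro n w
        rw [← Matrix.toLin'_pow, Matrix.toLin'_apply]
      have hv : aeval (Matrix.toLin' X) χ v = 0 := by
        have := Polynomial.aeval_algHom_apply (Matrix.toLinAlgEquiv' (R := F) (n := ι)) X χ
        change aeval (Matrix.toLinAlgEquiv' X) χ v = 0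
        rw [this, hX]
        simp
      refine ⟨⟨Matrix.of fun i j => (X ^ (j : ℕ) *ᵥ v) i, ?_⟩, ?_⟩
      · rw [mem_Sol, Matrix.one_mul, Matrix.mul_one]
        ext i j
        have h := congrFun (aeval_companion_chain hχ hv j) i
        simp only [hpow, Matrix.toLin'_apply, Finset.sum_apply, Pi.smul_apply, smul_eq_mul] at h
        rw [Matrix.mul_apply]
        simp only [Matrix.of_apply]
        rw [Finset.sum_congr rfl fun x _ => mul_comm _ _, ← h]
        rfl
      · ext i
        change ((Matrix.of fun i (j : Fin χ.natDegree) => (X ^ (j : ℕ) *ᵥ v) i) *ᵥ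
          Pi.single ⟨0, hd⟩ 1) i = _
        simp
  rw [sd, (LinearEquiv.ofBijective e he).finrank_eq, Module.finrank_fintype_fun_eq_card]
end Intertwine

/-- the monic polynomial whose roots are the negatives of those of `q` -/
def negPoly (q : F[X]) : F[X] := C ((-1 : F) ^ q.natDegree) * q.comp (-X)

theorem natDegree_comp_neg_X (q : F[X]) : (q.comp (-X)).natDegree = q.natDegree := by
  rw [natDegree_comp, natDegree_neg, natDegree_X, mul_one]

theorem neg_one_pow_ne_zero (n : ℕ) : ((-1 : F) ^ n) ≠ 0 :=
  pow_ne_zero _ (neg_ne_zero.2 one_ne_zero)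

theorem natDegree_negPoly (q : F[X]) : (negPoly q).natDegree = q.natDegree := by
  rw [negPoly, natDegree_C_mul (neg_one_pow_ne_zero _), natDegree_comp_neg_X]

theorem negPoly_monic {q : F[X]} (hq : q.Monic) : (negPoly q).Monic := by
  rw [Monic, leadingCoeff, natDegree_negPoly, negPoly, coeff_C_mul, coeff_comp_neg_X,
    hq.coeff_natDegree, mul_one, neg_one_pow_mul_self]

theorem negPoly_negPoly (q : F[X]) : negPoly (negPoly q) = q := by
  rw [negPoly, natDegree_negPoly, negPoly, mul_comp, C_comp, ← mul_assoc, ← C_mul,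
    neg_one_pow_mul_self, C_1, one_mul, comp_assoc]
  simp

theorem negPoly_pow {q : F[X]} (l : ℕ) : negPoly (q ^ l) = negPoly q ^ l := by
  rw [negPoly, negPoly, natDegree_pow, pow_comp, mul_pow, ← C_pow, ← pow_mul, mul_comm l]

theorem negPoly_irreducible {q : F[X]} (hq : Irreducible q) : Irreducible (negPoly q) := by
  have hu : IsUnit (C ((-1 : F) ^ q.natDegree)) :=
    Polynomial.isUnit_C.2 (neg_one_pow_ne_zero _).isUnit
  exact (irreducible_isUnit_mul hu).2 (comp_neg_X_irreducible hq)

theorem negPoly_of_even {q : F[X]} (h : ∃ g : F[X], q = g.comp (X ^ 2)) : negPoly q = q := by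
  rw [negPoly, comp_neg_X_of_even h]
  obtain ⟨g, rfl⟩ := h
  rw [natDegree_comp, natDegree_X_pow, mul_comm _ 2, pow_mul]
  simp

theorem negPoly_X : negPoly (X : F[X]) = X := by simp [negPoly]

section Values

theorem sd_neg {ι δ ε κ : Type*} [Fintype ι] [Fintype δ] (A B : Matrix κ ι F)
    (P Q : Matrix δ ε F) : sd (-A) (-B) P Q = sd A B P Q := by
  have : Sol (-A) (-B) P Q = Sol A B P Q := by
    ext f
    simp only [mem_Sol, Matrix.neg_mul, neg_inj]
  rw [sd, this, sd]

variable {ι δ : Type*} [Fintype ι] [Fintype δ] [DecidableEq ι] [DecidableEq δ]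

theorem sd_intertwine_neg_transpose (X : Matrix ι ι F) (Y : Matrix δ δ F) :
    sd 1 (-Xᵀ) Y 1 = sd 1 (-Yᵀ) X 1 := by
  have h : Sol 1 Y (-Xᵀ) 1 = Sol 1 (-Yᵀ)ᵀ Xᵀ 1 := by
    ext f
    simp only [mem_Sol, transpose_neg, transpose_transpose, Matrix.mul_neg, Matrix.neg_mul,
      Matrix.one_mul, Matrix.mul_one, neg_eq_iff_eq_neg]
  rw [sd_intertwine_comm, sd, h, ← sd, sd_intertwine_transpose, sd_intertwine_comm]

theorem aeval_neg_transpose_negPoly (X : Matrix ι ι F) (q : F[X]) (h : aeval X q = 0) :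
    aeval (-Xᵀ) (negPoly q) = 0 := by
  have h1 : aeval (-Xᵀ) (q.comp (-Polynomial.X)) = aeval Xᵀ q := by
    rw [aeval_comp]; simp
  have h2 : aeval Xᵀ q = (aeval X q)ᵀ := by
    rw [aeval_eq_sum_range, aeval_eq_sum_range, transpose_sum]
    simp [transpose_pow]
  rw [negPoly, map_mul, h1, h2, h]
  simp

theorem isCoprime_pow_of_ne {p q : F[X]} (hpm : p.Monic) (hp : Irreducible p) (hqm : q.Monic)
    (hq : Irreducible q) (h : p ≠ q) (l m : ℕ) : IsCoprime (p ^ l) (q ^ m) := by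
  refine IsCoprime.pow ((hp.coprime_iff_not_dvd).2 fun hd => h ?_)
  exact eq_of_monic_of_associated hpm hqm (hp.associated_of_dvd hq hd)

theorem companion_X_pow_nilpotent (l : ℕ) : companion F (X ^ l) ^ l = 0 := by
  have := aeval_companion_self (monic_X_pow (R := F) l)
  rwa [map_pow, aeval_X] at this

theorem sd_nilpotent {X : Matrix ι ι F} {Y : Matrix δ δ F} {k : ℕ} (h : X ^ k = 0 ∨ Y ^ k = 0) :
    sd X 1 Y 1 = 0 := by
  refine sd_eq_zero fun f hf => ?_
  rw [Matrix.one_mul, Matrix.mul_one] at hf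
  have : ∀ k, X ^ k * f * Y ^ k = f := by
    intro k
    induction k with
    | zero => simp
    | succ k ih =>
      calc X ^ (k + 1) * f * Y ^ (k + 1) = X ^ k * (X * f * Y) * Y ^ k := by
            simp only [pow_succ X, pow_succ' Y, Matrix.mul_assoc]
        _ = f := by rw [hf, ih]
  rw [← this k]
  rcases h with h | h <;> simp [h]

variable [DecidableEq F[X]]

theorem sd_companion {p q : F[X]} (hpm : p.Monic) (hp : Irreducible p) (hqm : q.Monic)
    (hq : Irreducible q) {m : ℕ} (hm : 0 < m) (l : ℕ) :
    sd 1 (companion F (q ^ m)) (companion F (p ^ l)) 1 =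
      if p = q then min l m * p.natDegree else 0 := by
  rcases Nat.eq_zero_or_pos l with rfl | hl
  · have : IsEmpty (Fin (p ^ 0 : F[X]).natDegree) := by rw [pow_zero, natDegree_one]; infer_instance
    rw [Nat.zero_min, zero_mul, ite_self]
    exact sd_eq_zero fun f _ => by ext i j; exact isEmptyElim j
  have hps := aeval_companion_self (hpm.pow l)
  have hqs := aeval_companion_self (hqm.pow m)
  split_ifs with h
  · subst h
    rcases le_total l m with hlm | hlm
    · rw [sd_intertwine_comm, sd_intertwine_companion (hpm.pow m) (natDegree_pow_pos hpm hp hm),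
        min_eq_left hlm, Fintype.card_fin, natDegree_pow]
      rw [← Nat.add_sub_of_le hlm, pow_add, map_mul, hps, zero_mul]
    · rw [sd_intertwine_companion (hpm.pow l) (natDegree_pow_pos hpm hp hl),
        min_eq_right hlm, Fintype.card_fin, natDegree_pow]
      rw [← Nat.add_sub_of_le hlm, pow_add, map_mul, hqs, zero_mul]
  · exact sd_intertwine_coprime (isCoprime_pow_of_ne hqm hq hpm hp (Ne.symm h) m l) hqs hps

theorem sd_neg_transpose_companion {p q : F[X]} (hpm : p.Monic) (hp : Irreducible p)
    (hqm : q.Monic) (hq : Irreducible q) {m : ℕ} (hm : 0 < m) (l : ℕ) :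
    sd 1 (-(companion F (q ^ m))ᵀ) (companion F (p ^ l)) 1 =
      if p = negPoly q then min l m * p.natDegree else 0 := by
  rcases Nat.eq_zero_or_pos l with rfl | hl
  · have : IsEmpty (Fin (p ^ 0 : F[X]).natDegree) := by rw [pow_zero, natDegree_one]; infer_instance
    rw [Nat.zero_min, zero_mul, ite_self]
    exact sd_eq_zero fun f _ => by ext i j; exact isEmptyElim j
  have hps := aeval_companion_self (hpm.pow l)
  have hqs := aeval_neg_transpose_negPoly _ _ (aeval_companion_self (hqm.pow m))
  rw [negPoly_pow] at hqs
  split_ifs with h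
  · rcases le_total l m with hlm | hlm
    · rw [sd_intertwine_neg_transpose,
        sd_intertwine_companion (hqm.pow m) (natDegree_pow_pos hqm hq hm),
        min_eq_left hlm, Fintype.card_fin, natDegree_pow]
      have := aeval_neg_transpose_negPoly _ _ hps
      have hq' : negPoly p = q := by rw [h, negPoly_negPoly]
      rw [negPoly_pow, hq'] at this
      rw [← Nat.add_sub_of_le hlm, pow_add, map_mul, this, zero_mul]
    · rw [sd_intertwine_companion (hpm.pow l) (natDegree_pow_pos hpm hp hl),
        min_eq_right hlm, Fintype.card_fin, natDegree_pow, h, natDegree_negPoly]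
      rw [← Nat.add_sub_of_le hlm, pow_add, map_mul, h, hqs, zero_mul]
  · exact sd_intertwine_coprime
      (isCoprime_pow_of_ne (negPoly_monic hqm) (negPoly_irreducible hq) hpm hp (Ne.symm h) m l)
      hqs hps

end Values

section Shift
variable {ι δ : Type*}

theorem Fmat_mul_apply {n : ℕ} (f : Matrix (Fin n) δ F) (i : Fin (n - 1)) (j : δ) :
    (Fmat F n * f) i j = f ⟨i, by omega⟩ j := by
  have h : ∀ k : Fin n, (i : ℕ) = k ↔ k = ⟨i, by omega⟩ := fun k => by rw [Fin.ext_iff, eq_comm]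
  simp only [Matrix.mul_apply, Fmat, of_apply, h, ite_mul, one_mul, zero_mul,
    Finset.sum_ite_eq', Finset.mem_univ, if_true]

theorem Gmat_mul_apply {n : ℕ} (f : Matrix (Fin n) δ F) (i : Fin (n - 1)) (j : δ) :
    (Gmat F n * f) i j = f ⟨i + 1, by omega⟩ j := by
  have h : ∀ k : Fin n, (i : ℕ) + 1 = k ↔ k = ⟨i + 1, by omega⟩ := fun k => by
    rw [Fin.ext_iff, eq_comm]
  simp only [Matrix.mul_apply, Gmat, of_apply, h, ite_mul, one_mul, zero_mul,
    Finset.sum_ite_eq', Finset.mem_univ, if_true]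

theorem mul_Fmat_apply {n : ℕ} (f : Matrix ι (Fin (n - 1)) F) (i : ι) (j : Fin n) :
    (f * Fmat F n) i j = if h : (j : ℕ) < n - 1 then f i ⟨j, h⟩ else 0 := by
  rw [Matrix.mul_apply]
  split_ifs with h
  · rw [Finset.sum_eq_single ⟨j, h⟩]
    · simp [Fmat]
    · intro k _ hk
      have : (k : ℕ) ≠ j := fun h' => hk (Fin.ext h')
      simp [Fmat, this]
    · simp
  · refine Finset.sum_eq_zero fun k _ => ?_
    have : (k : ℕ) ≠ j := by omega
    simp [Fmat, this]

theorem mul_Gmat_apply {n : ℕ} (f : Matrix ι (Fin (n - 1)) F) (i : ι) (j : Fin n) :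
    (f * Gmat F n) i j = if h : 0 < (j : ℕ) then f i ⟨j - 1, by omega⟩ else 0 := by
  rw [Matrix.mul_apply]
  split_ifs with h
  · rw [Finset.sum_eq_single ⟨j - 1, by omega⟩]
    · simp [Gmat, Nat.sub_add_cancel h]
    · intro k _ hk
      have : (k : ℕ) + 1 ≠ j := fun h' => hk (Fin.ext (by simp; omega))
      simp [Gmat, this]
    · simp
  · refine Finset.sum_eq_zero fun k _ => ?_
    have : (k : ℕ) + 1 ≠ j := by omega
    simp [Gmat, this]

variable [Fintype ι] [Fintype δ]

theorem sd_regular_shift [DecidableEq ι] (X : Matrix ι ι F) (d : ℕ) :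
    sd 1 X (Fmat F (d + 1)) (Gmat F (d + 1)) = 0 := by
  refine sd_eq_zero fun f hf => ?_
  rw [Matrix.one_mul] at hf
  have key : ∀ k (hk : k < d) i, f i ⟨k, hk⟩ = 0 := by
    intro k
    induction k with
    | zero =>
      intro hk i
      have := congr_fun (congr_fun hf i) ⟨0, by omega⟩
      rw [mul_Fmat_apply, mul_Gmat_apply] at this
      simpa [hk] using this
    | succ k ih =>
      intro hk i
      have := congr_fun (congr_fun hf i) ⟨k + 1, by omega⟩
      rw [mul_Fmat_apply, mul_Gmat_apply, dif_pos (by simp; omega), dif_pos (by simp)] at this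
      refine this.trans ?_
      exact Finset.sum_eq_zero fun a _ => (congrArg _ (ih (by omega) a)).trans (mul_zero _)
  ext i k
  exact key k k.2 i

theorem sd_regular_shift_swap [DecidableEq ι] (X : Matrix ι ι F) (d : ℕ) :
    sd X 1 (Fmat F (d + 1)) (Gmat F (d + 1)) = 0 := by
  refine sd_eq_zero fun f hf => ?_
  rw [Matrix.one_mul] at hf
  have key : ∀ t k (hk : k < d), k + t + 1 = d → ∀ i, f i ⟨k, hk⟩ = 0 := by
    intro t
    induction t with
    | zero =>
      intro k hk hkt i
      have := congr_fun (congr_fun hf i) ⟨k + 1, by omega⟩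
      rw [mul_Fmat_apply, mul_Gmat_apply, dif_neg (by simp; omega), dif_pos (by simp)] at this
      exact this.symm
    | succ t ih =>
      intro k hk hkt i
      have := congr_fun (congr_fun hf i) ⟨k + 1, by omega⟩
      rw [mul_Fmat_apply, mul_Gmat_apply, dif_pos (by simp; omega), dif_pos (by simp)] at this
      refine this.symm.trans ?_
      exact Finset.sum_eq_zero fun a _ =>
        (congrArg _ (ih (k + 1) (by omega) (by omega) a)).trans (mul_zero _)
  ext i k
  exact key (d - k - 1) k k.2 (by have : (k : ℕ) < d := k.2; omega) i

theorem sing_shift_row {n d : ℕ} {f : Matrix (Fin n) (Fin d) F}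
    (hf : f ∈ Sol (Fmat F n) (Gmat F n) (Fmat F (d + 1)) (Gmat F (d + 1))) :
    ∀ t j (ht : t < n), j ≤ d →
      (if hj : j < d then f ⟨n - 1 - t, by omega⟩ ⟨j, hj⟩ else 0) =
        if hj : t ≤ j ∧ j - t < d then f ⟨n - 1, by omega⟩ ⟨j - t, hj.2⟩ else 0 := by
  intro t
  induction t with
  | zero => intro j ht hj; simp
  | succ t ih =>
    intro j ht hj
    have h := congr_fun (congr_fun hf ⟨n - 1 - (t + 1), by omega⟩) ⟨j, by omega⟩
    rw [mul_Fmat_apply, mul_Gmat_apply] at h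
    simp only [Fmat_mul_apply, Gmat_mul_apply] at h
    refine (show _ = _ from h).trans ?_
    rcases Nat.eq_zero_or_pos j with rfl | hj0
    · simp
    · have := ih (j - 1) (by omega) (by omega)
      rw [dif_pos (by omega)] at this
      rw [dif_pos hj0]
      have e : n - 1 - (t + 1) + 1 = n - 1 - t := by omega
      simp only [e]
      refine this.trans ?_
      have e1 : j - 1 - t = j - (t + 1) := by omega
      have e2 : t ≤ j - 1 ↔ t + 1 ≤ j := by omega
      simp only [e1, e2]

theorem sd_sing_shift {n : ℕ} (hn : 0 < n) (d : ℕ) :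
    sd (Fmat F n) (Gmat F n) (Fmat F (d + 1)) (Gmat F (d + 1)) = d + 1 - n := by
  let e : Sol (Fmat F n) (Gmat F n) (Fmat F (d + 1)) (Gmat F (d + 1)) →ₗ[F]
      (Fin (d + 1 - n) → F) :=
    { toFun := fun f k => f.1 ⟨n - 1, by omega⟩ (⟨k, by omega⟩ : Fin d)
      map_add' := fun f g => rfl
      map_smul' := fun c f => rfl }
  have he : Function.Bijective e := by
    constructor
    · rw [← LinearMap.ker_eq_bot, LinearMap.ker_eq_bot']
      rintro ⟨f, hf⟩ h
      have hrow := sing_shift_row hf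
      have hlast : ∀ k (hk : k < d), f ⟨n - 1, by omega⟩ (⟨k, hk⟩ : Fin d) = 0 := by
        intro k hk
        by_cases hk' : k < d + 1 - n
        · exact congr_fun h ⟨k, hk'⟩
        · have := hrow (d - k) d (by omega) le_rfl
          rw [dif_neg (by omega), dif_pos (by omega)] at this
          rw [this]
          congr 2
          omega
      ext i (j : Fin d)
      have := hrow (n - 1 - i) j (by omega) j.2.le
      rw [dif_pos j.2] at this
      have hi : n - 1 - (n - 1 - (i : ℕ)) = i := by omega
      simp only [hi] at this
      refine this.trans ?_
      split_ifs with hj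
      · exact hlast _ _
      · rfl
    · intro c
      let f : Matrix (Fin n) (Fin d) F := Matrix.of fun i j =>
        if h : n - 1 - i ≤ j ∧ j - (n - 1 - i) < d + 1 - n then c ⟨j - (n - 1 - i), h.2⟩ else 0
      refine ⟨⟨f, ?_⟩, ?_⟩
      · rw [mem_Sol]
        ext i j
        rw [mul_Fmat_apply, mul_Gmat_apply]
        simp only [Fmat_mul_apply, Gmat_mul_apply, f, of_apply]
        have hj := j.2
        have hi := i.2
        split_ifs <;> first | rfl | (exfalso; omega) | (congr 2; omega)
      · ext k
        have := k.2
        change f _ _ = _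
        simp only [f, of_apply]
        rw [dif_pos (by omega)]
        congr 1
        ext
        simp
  rw [sd, (LinearEquiv.ofBijective e he).finrank_eq, Module.finrank_fin_fun]

theorem sd_sing_transpose_shift (n : ℕ) (d : ℕ) :
    sd (Fmat F n)ᵀ (-(Gmat F n)ᵀ) (Fmat F (d + 1)) (Gmat F (d + 1)) = 0 := by
  refine sd_eq_zero fun f hf => ?_
  have hT : ((Fmat F n)ᵀ * f) = (fᵀ * Fmat F n)ᵀ := by simp
  have hT' : ((Gmat F n)ᵀ * f) = (fᵀ * Gmat F n)ᵀ := by simp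
  rw [Matrix.neg_mul, Matrix.neg_mul, hT, hT'] at hf
  have key : ∀ a b (ha : a < n - 1) (hb : b < d), f ⟨a, ha⟩ (⟨b, hb⟩ : Fin d) = 0 := by
    intro a
    induction a with
    | zero =>
      intro b ha hb
      have := congr_fun (congr_fun hf ⟨0, by omega⟩) ⟨b, by omega⟩
      rw [Matrix.neg_apply, mul_Fmat_apply, mul_Gmat_apply, dif_pos (by simpa using hb)] at this
      simp only [transpose_apply, mul_Fmat_apply, mul_Gmat_apply, dif_pos ha] at this
      simpa using this
    | succ a ih =>
      intro b ha hb
      have := congr_fun (congr_fun hf ⟨a + 1, by omega⟩) ⟨b, by omega⟩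
      rw [Matrix.neg_apply, mul_Fmat_apply, mul_Gmat_apply, dif_pos (by simpa using hb)] at this
      simp only [transpose_apply, mul_Fmat_apply, mul_Gmat_apply, dif_pos ha] at this
      refine this.trans ?_
      split_ifs
      · exact neg_eq_zero.2 (ih (b - 1) (by omega) (by omega))
      all_goals exact neg_zero
  ext i j
  exact key i j i.2 j.2

theorem sd_sing [DecidableEq δ] {n : ℕ} (hn : 0 < n) (Y : Matrix δ δ F) :
    sd (Fmat F n) (Gmat F n) Y 1 = Fintype.card δ := by
  let e : Sol (Fmat F n) (Gmat F n) Y 1 →ₗ[F] (δ → F) :=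
    { toFun := fun f => f.1 ⟨0, hn⟩
      map_add' := fun f g => rfl
      map_smul' := fun c f => rfl }
  have he : Function.Bijective e := by
    constructor
    · rw [← LinearMap.ker_eq_bot, LinearMap.ker_eq_bot']
      rintro ⟨f, hf⟩ h
      rw [mem_Sol, Matrix.mul_one] at hf
      have key : ∀ k (hk : k < n) j, f ⟨k, hk⟩ j = 0 := by
        intro k
        induction k with
        | zero => intro hk j; exact congr_fun h j
        | succ k ih =>
          intro hk j
          have := congr_fun (congr_fun hf ⟨k, by omega⟩) j
          rw [Gmat_mul_apply, Matrix.mul_apply] at this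
          refine this.symm.trans (Finset.sum_eq_zero fun a _ => ?_)
          rw [Fmat_mul_apply, ih, zero_mul]
      ext i j
      exact key i i.2 j
    · intro w
      refine ⟨⟨Matrix.of fun i j => (w ᵥ* Y ^ (i : ℕ)) j, ?_⟩, ?_⟩
      · rw [mem_Sol, Matrix.mul_one]
        ext i j
        rw [Gmat_mul_apply, Matrix.mul_apply]
        simp only [Fmat_mul_apply, of_apply, pow_succ, ← vecMul_vecMul]
        rfl
      · ext j
        change (w ᵥ* Y ^ 0) j = w j
        rw [pow_zero, vecMul_one]
  rw [sd, (LinearEquiv.ofBijective e he).finrank_eq, Module.finrank_fintype_fun_eq_card]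

theorem sd_sing_transpose [DecidableEq δ] (n : ℕ) (Y : Matrix δ δ F) :
    sd (Fmat F n)ᵀ (-(Gmat F n)ᵀ) Y 1 = 0 := by
  refine sd_eq_zero fun f hf => ?_
  rw [Matrix.mul_one, Matrix.neg_mul] at hf
  have hT : ((Fmat F n)ᵀ * f) = (fᵀ * Fmat F n)ᵀ := by simp
  have hT' : ((Gmat F n)ᵀ * f) = (fᵀ * Gmat F n)ᵀ := by simp
  rw [hT, hT'] at hf
  have key : ∀ t a (ha : a < n - 1), a + t + 1 = n - 1 → ∀ j, f ⟨a, ha⟩ j = 0 := by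
    intro t
    induction t with
    | zero =>
      intro a ha hat j
      have := congr_fun (congr_fun hf ⟨a + 1, by omega⟩) j
      rw [Matrix.neg_apply, Matrix.mul_apply, transpose_apply, mul_Gmat_apply,
        dif_pos (by simp)] at this
      refine neg_eq_zero.1 (this.symm.trans (Finset.sum_eq_zero fun b _ => ?_))
      rw [transpose_apply, mul_Fmat_apply, dif_neg (by simp; omega), zero_mul]
    | succ t ih =>
      intro a ha hat j
      have := congr_fun (congr_fun hf ⟨a + 1, by omega⟩) j
      rw [Matrix.neg_apply, Matrix.mul_apply, transpose_apply, mul_Gmat_apply,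
        dif_pos (by simp)] at this
      refine neg_eq_zero.1 (this.symm.trans (Finset.sum_eq_zero fun b _ => ?_))
      rw [transpose_apply, mul_Fmat_apply, dif_pos (by simp; omega), transpose_apply,
        ih (a + 1) (by omega) (by omega), zero_mul]
  ext i j
  exact key (n - 1 - i - 1) i i.2 (by omega) j
end Shift

/-- minus the second difference of a sequence -/
def diff2 (u : ℕ → ℕ) (l : ℕ) : ℤ := 2 * (u l : ℤ) - u (l - 1) - u (l + 1)

theorem diff2_add (u v : ℕ → ℕ) (l : ℕ) :
    diff2 (fun l => u l + v l) l = diff2 u l + diff2 v l := by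
  simp only [diff2]; push_cast; ring

theorem diff2_zero (l : ℕ) : diff2 (fun _ => 0) l = 0 := by simp [diff2]

theorem diff2_mul {l : ℕ} (hl : 0 < l) (c : ℕ) : diff2 (fun l => l * c) l = 0 := by
  obtain ⟨k, rfl⟩ := Nat.exists_eq_add_of_lt hl
  simp only [diff2, zero_add, Nat.add_sub_cancel]
  push_cast
  ring

theorem diff2_min {l : ℕ} (hl : 0 < l) (m c : ℕ) :
    diff2 (fun l => min l m * c) l = if l = m then (c : ℤ) else 0 := by
  have h : (2 * (min l m : ℕ) - (min (l - 1) m : ℕ) - (min (l + 1) m : ℕ) : ℤ) =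
      if l = m then 1 else 0 := by split_ifs <;> omega
  have h' : diff2 (fun l => min l m * c) l =
      (2 * (min l m : ℕ) - (min (l - 1) m : ℕ) - (min (l + 1) m : ℕ) : ℤ) * c := by
    simp only [diff2, Nat.cast_mul]; ring
  rw [h', h, ite_mul, one_mul, zero_mul]

theorem diff2_ite_min {l : ℕ} (hl : 0 < l) (m c : ℕ) (P : Prop) [Decidable P] :
    diff2 (fun l => if P then min l m * c else 0) l = if P ∧ l = m then (c : ℤ) else 0 := by
  by_cases hP : P
  · simp only [hP, if_true, true_and, diff2_min hl]
  · simp only [hP, if_false, false_and, diff2_zero]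

theorem diff2_sub {m n : ℕ} (hm : 0 < m) (hn : 0 < n) :
    diff2 (fun d => d + 1 - m) (n - 1) = if n = m then -1 else 0 := by
  simp only [diff2]
  split_ifs <;> omega

/-- integral functions of pairs that are invariant under congruence and additive -/
structure IsInv (ψ : PBlock F → ℤ) : Prop where
  pcg : ∀ X Y, PCg X Y → ψ X = ψ Y
  psum : ∀ L, ψ (psum L) = (L.map ψ).sum

theorem isInv_sd {δ ε : Type*} [Fintype δ] (P Q : Matrix δ ε F) :
    IsInv fun b : PBlock F => (sd b.2.1 b.2.2 P Q : ℤ) where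
  pcg X Y h := by rw [Cg.sd_eq h]
  psum L := by
    rw [sd_psum, Nat.cast_list_sum, List.map_map]
    rfl

theorem isInv_sd_swap {δ ε : Type*} [Fintype δ] (P Q : Matrix δ ε F) :
    IsInv fun b : PBlock F => (sd b.2.2 b.2.1 P Q : ℤ) where
  pcg X Y h := by rw [Cg.sd_eq h.swap]
  psum L := by
    have := (isInv_sd P Q).psum (L.map swapBlock)
    rwa [psum_map_swapBlock, List.map_map] at this

theorem isInv_diff2 {u : PBlock F → ℕ → ℕ} (hu : ∀ l, IsInv fun b => (u b l : ℤ)) (l : ℕ) :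
    IsInv fun b => diff2 (u b) l where
  pcg X Y h := by
    have := fun l => (hu l).pcg X Y h
    simp only [diff2, this]
  psum L := by
    have := fun l => (hu l).psum L
    simp only [diff2, this]
    clear this
    induction L with
    | nil => simp
    | cons b L ih => simp only [List.map_cons, List.sum_cons]; linarith

section Blocks
variable {δ ε : Type*} [Fintype δ] (P Q : Matrix δ ε F)

theorem sd_smul {ι κ : Type*} [Fintype ι] {c : F} (hc : c ≠ 0) (A B : Matrix κ ι F) :
    sd (c • A) (c • B) P Q = sd A B P Q := by
  have : Sol (c • A) (c • B) P Q = Sol A B P Q := by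
    ext f
    simp only [mem_Sol, Matrix.smul_mul]
    exact (smul_right_injective _ hc).eq_iff
  rw [sd, this, sd]

theorem sd_pairSkew3 (χ : F[X]) : sd (pairSkew3 χ).2.1 (pairSkew3 χ).2.2 P Q =
    sd 1 (companion F χ) P Q + sd 1 (-(companion F χ)ᵀ) P Q :=
  sd_skewSum _ _ _ _ _ _

theorem sd_pairSkew3_swap (χ : F[X]) : sd (pairSkew3 χ).2.2 (pairSkew3 χ).2.1 P Q =
    sd (companion F χ) 1 P Q + sd (-(companion F χ)ᵀ) 1 P Q :=
  sd_skewSum _ _ _ _ _ _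

theorem sd_gram_swap {ι : Type*} [Fintype ι] [DecidableEq ι] {G Φ : Matrix ι ι F}
    (hG : IsUnit G.det) : sd (G * Φ) G P Q = sd Φ 1 P Q := by
  have := sd_mul_left (Matrix.nonsing_inv_mul _ hG) Φ 1 P Q
  rwa [Matrix.mul_one] at this

theorem sd_cModel {n : ℕ} (hn : 0 < n) : sd (cModel F n).1 (cModel F n).2 P Q =
    sd 1 (companion F (X ^ n)) P Q := by
  obtain ⟨H, hH, -, -, h⟩ := exists_cyclic_cModel (F := F) n hn
  rw [h.sd_eq, sd_one_of_gram hH]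

theorem sd_cModel_swap {n : ℕ} (hn : 0 < n) : sd (cModel F n).2 (cModel F n).1 P Q =
    sd (companion F (X ^ n)) 1 P Q := by
  obtain ⟨H, hH, -, -, h⟩ := exists_cyclic_cModel (F := F) n hn
  rw [h.swap.sd_eq, sd_gram_swap _ _ hH]

theorem sd_J (n : ℕ) : sd (J F n 0) 1 P Q = sd (companion F (X ^ n)) 1 P Q ∧
    sd 1 (J F n 0) P Q = sd 1 (companion F (X ^ n)) P Q ∧
    sd (-(J F n 0)ᵀ) 1 P Q = sd (-(companion F (X ^ n))ᵀ) 1 P Q ∧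
    sd 1 (-(J F n 0)ᵀ) P Q = sd 1 (-(companion F (X ^ n))ᵀ) P Q := by
  rw [companion_X_pow n]
  have h1 : (1 : Mat F (X ^ n : F[X]).natDegree) =
      (1 : Mat F n).submatrix (finCongr (natDegree_X_pow n)) (finCongr (natDegree_X_pow n)) :=
    (submatrix_one_equiv _).symm
  rw [h1, transpose_submatrix]
  refine ⟨?_, ?_, ?_, ?_⟩
  · exact (sd_submatrix _ _ _ _ _ _).symm
  · exact (sd_submatrix _ _ _ _ _ _).symm
  · exact (sd_submatrix (-(J F n 0)ᵀ) _ _ _ _ _).symm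
  · exact (sd_submatrix _ (-(J F n 0)ᵀ) _ _ _ _).symm

theorem sd_skew_J (n : ℕ) :
    sd (skewSum (J F n 0) (J F n 0)ᵀ) (skewSum (1 : Mat F n) (-1)) P Q =
      sd (companion F (X ^ n)) 1 P Q + sd (-(companion F (X ^ n))ᵀ) 1 P Q := by
  rw [sd_skewSum, ← (sd_J P Q n).1, ← (sd_J P Q n).2.2.1, ← sd_neg ((J F n 0)ᵀ), neg_neg]

theorem sd_skew_J_swap (n : ℕ) :
    sd (skewSum (1 : Mat F n) (-1)) (skewSum (J F n 0) (J F n 0)ᵀ) P Q =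
      sd 1 (companion F (X ^ n)) P Q + sd 1 (-(companion F (X ^ n))ᵀ) P Q := by
  rw [sd_skewSum, ← (sd_J P Q n).2.1, ← (sd_J P Q n).2.2.2, ← sd_neg (-1) ((J F n 0)ᵀ), neg_neg]

theorem Gmat_submatrix_rev (n : ℕ) : (Gmat F n).submatrix Fin.revPerm Fin.revPerm = Fmat F n := by
  ext i j
  have : (n - 1 - ((i : ℕ) + 1) + 1 = n - ((j : ℕ) + 1)) ↔ (i : ℕ) = j := by omega
  simp [Gmat, Fmat, Fin.val_rev, this]

theorem Fmat_submatrix_rev (n : ℕ) : (Fmat F n).submatrix Fin.revPerm Fin.revPerm = Gmat F n := by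
  ext i j
  have : (n - 1 - ((i : ℕ) + 1) = n - ((j : ℕ) + 1)) ↔ (i : ℕ) + 1 = j := by omega
  simp [Gmat, Fmat, Fin.val_rev, this]

theorem sd_singBlock_swap (n : ℕ) :
    sd (singBlock F n).2.2 (singBlock F n).2.1 P Q =
      sd (singBlock F n).2.1 (singBlock F n).2.2 P Q := by
  refine (sd_skewSum _ _ _ _ _ _).trans ((sd_skewSum _ _ _ _ _ _).trans ?_).symm
  rw [← sd_submatrix (Fmat F n) (Gmat F n) P Q Fin.revPerm Fin.revPerm,
    ← sd_submatrix (Fmat F n)ᵀ (-(Gmat F n)ᵀ) P Q Fin.revPerm Fin.revPerm,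
    ← sd_neg (-(Gmat F n)ᵀ) (Fmat F n)ᵀ]
  simp only [submatrix_neg, ← transpose_submatrix, Gmat_submatrix_rev, Fmat_submatrix_rev,
    Pi.neg_apply, neg_neg]

end Blocks

/-- counts the summands whose regular part belongs to `p ^ l` -/
def phiInv (p : F[X]) (l : ℕ) (b : PBlock F) : ℤ :=
  diff2 (fun l => sd b.2.1 b.2.2 (companion F (p ^ l)) 1) l

/-- counts the summands with infinite elementary divisors of degree `l` -/
def muInv (l : ℕ) (b : PBlock F) : ℤ :=
  diff2 (fun l => sd b.2.2 b.2.1 (companion F (X ^ l)) 1) l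

/-- minus the number of singular summands of index `n` -/
def sigmaInv (n : ℕ) (b : PBlock F) : ℤ :=
  diff2 (fun d => sd b.2.1 b.2.2 (Fmat F (d + 1)) (Gmat F (d + 1))) (n - 1)

theorem isInv_phiInv (p : F[X]) (l : ℕ) : IsInv (phiInv p l) :=
  isInv_diff2 (fun l => isInv_sd (companion F (p ^ l)) 1) l

theorem isInv_muInv (l : ℕ) : IsInv (muInv (F := F) l) :=
  isInv_diff2 (fun l => isInv_sd_swap (companion F (X ^ l)) 1) l

theorem isInv_sigmaInv (n : ℕ) : IsInv (sigmaInv (F := F) n) :=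
  isInv_diff2 (fun d => isInv_sd (Fmat F (d + 1)) (Gmat F (d + 1))) (n - 1)

/-- the pair `c Cₙ` -/
def scaledC (c : F) (n : ℕ) : PBlock F := ⟨n, (c • (Cpair F n).1, c • (Cpair F n).2)⟩

section ScaledC
variable {δ ε : Type*} [Fintype δ] (P Q : Matrix δ ε F) {c : F} {n : ℕ}

theorem sd_scaledC_odd (hc : c ≠ 0) (hn : Odd n) :
    sd (scaledC c n).2.1 (scaledC c n).2.2 P Q = sd 1 (companion F (X ^ n)) P Q := by
  have := sd_cModel P Q hn.pos
  rw [cModel, if_pos hn] at this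
  rw [← this]
  exact sd_smul P Q hc _ _

theorem sd_scaledC_odd_swap (hc : c ≠ 0) (hn : Odd n) :
    sd (scaledC c n).2.2 (scaledC c n).2.1 P Q = sd (companion F (X ^ n)) 1 P Q := by
  have := sd_cModel_swap P Q hn.pos
  rw [cModel, if_pos hn] at this
  rw [← this]
  exact sd_smul P Q hc _ _

theorem sd_scaledC_even (hc : c ≠ 0) (hn : 0 < n) (ho : ¬ Odd n) :
    sd (scaledC c n).2.1 (scaledC c n).2.2 P Q = sd (companion F (X ^ n)) 1 P Q := by
  have := sd_cModel_swap P Q hn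
  rw [cModel, if_neg ho] at this
  rw [← this]
  exact sd_smul P Q hc _ _

theorem sd_scaledC_even_swap (hc : c ≠ 0) (hn : 0 < n) (ho : ¬ Odd n) :
    sd (scaledC c n).2.2 (scaledC c n).2.1 P Q = sd 1 (companion F (X ^ n)) P Q := by
  have := sd_cModel P Q hn
  rw [cModel, if_neg ho] at this
  rw [← this]
  exact sd_smul P Q hc _ _

end ScaledC

theorem sd_companion_X_left {δ : Type*} [Fintype δ] [DecidableEq δ] (n : ℕ) (Y : Matrix δ δ F) :
    sd (companion F (X ^ n)) 1 Y 1 = 0 := sd_nilpotent (.inl (companion_X_pow_nilpotent n))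

theorem sd_companion_X_right {ι : Type*} [Fintype ι] [DecidableEq ι] (n : ℕ) (Z : Matrix ι ι F) :
    sd Z 1 (companion F (X ^ n)) 1 = 0 := sd_nilpotent (.inr (companion_X_pow_nilpotent n))

theorem sd_companion_X_neg {δ : Type*} [Fintype δ] [DecidableEq δ] (n : ℕ) (Y : Matrix δ δ F) :
    sd (-(companion F (X ^ n))ᵀ) 1 Y 1 = 0 := by
  refine sd_nilpotent (k := n) (.inl ?_)
  rw [neg_pow, ← transpose_pow, companion_X_pow_nilpotent]
  simp

theorem sigmaInv_eq_zero {n : ℕ} {b : PBlock F}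
    (h : ∀ d, sd b.2.1 b.2.2 (Fmat F (d + 1)) (Gmat F (d + 1)) = 0) : sigmaInv n b = 0 := by
  simp only [sigmaInv, h, diff2_zero]

theorem muInv_eq_zero {l : ℕ} {b : PBlock F}
    (h : ∀ l, sd b.2.2 b.2.1 (companion F (X ^ l)) 1 = 0) : muInv l b = 0 := by
  simp only [muInv, h, diff2_zero]

theorem phiInv_eq_zero {p : F[X]} {l : ℕ} {b : PBlock F}
    (h : ∀ l, sd b.2.1 b.2.2 (companion F (p ^ l)) 1 = 0) : phiInv p l b = 0 := by
  simp only [phiInv, h, diff2_zero]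

theorem sigmaInv_singBlock {m n : ℕ} (hm : 0 < m) (hn : 0 < n) :
    sigmaInv n (singBlock F m) = if n = m then -1 else 0 := by
  rw [← diff2_sub hm hn]
  have : ∀ d, sd (singBlock F m).2.1 (singBlock F m).2.2 (Fmat F (d + 1)) (Gmat F (d + 1)) =
      d + 1 - m := fun d => by
    refine (sd_skewSum _ _ _ _ _ _).trans ?_
    rw [sd_sing_shift hm, sd_sing_transpose_shift, add_zero]
  simp only [sigmaInv, this]

theorem sd_singBlock {m : ℕ} (hm : 0 < m) {δ : Type*} [Fintype δ] [DecidableEq δ]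
    (Y : Matrix δ δ F) : sd (singBlock F m).2.1 (singBlock F m).2.2 Y 1 = Fintype.card δ := by
  refine (sd_skewSum _ _ _ _ _ _).trans ?_
  rw [sd_sing hm, sd_sing_transpose, add_zero]

theorem phiInv_singBlock (p : F[X]) {l m : ℕ} (hl : 0 < l) (hm : 0 < m) :
    phiInv p l (singBlock F m) = 0 := by
  simp only [phiInv, sd_singBlock hm, Fintype.card_fin, natDegree_pow, diff2_mul hl]

theorem muInv_singBlock {l m : ℕ} (hl : 0 < l) (hm : 0 < m) : muInv l (singBlock F m) = 0 := by
  have h : ∀ l, sd (singBlock F m).2.2 (singBlock F m).2.1 (companion F (X ^ l)) 1 = l * 1 := by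
    intro l
    rw [sd_singBlock_swap, sd_singBlock hm, Fintype.card_fin, natDegree_X_pow, mul_one]
  exact (congrArg (diff2 · l) (funext h)).trans (diff2_mul hl 1)

theorem sigmaInv_pairSkew3 (n : ℕ) (χ : F[X]) : sigmaInv n (pairSkew3 χ) = 0 :=
  sigmaInv_eq_zero fun d => by
    rw [sd_pairSkew3, sd_regular_shift, sd_regular_shift]

theorem muInv_pairSkew3 (l : ℕ) (χ : F[X]) : muInv l (pairSkew3 χ) = 0 :=
  muInv_eq_zero fun d => by
    rw [sd_pairSkew3_swap, sd_companion_X_right, sd_companion_X_right]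

theorem sigmaInv_gram (n : ℕ) {χ : F[X]} {G : Mat F χ.natDegree} (hG : IsUnit G.det) :
    sigmaInv n ⟨χ.natDegree, (G, G * companion F χ)⟩ = 0 :=
  sigmaInv_eq_zero fun d => by
    rw [sd_one_of_gram hG, sd_regular_shift]

theorem muInv_gram (l : ℕ) {χ : F[X]} {G : Mat F χ.natDegree} (hG : IsUnit G.det) :
    muInv l ⟨χ.natDegree, (G, G * companion F χ)⟩ = 0 :=
  muInv_eq_zero fun d => by
    rw [sd_gram_swap _ _ hG, sd_companion_X_right]

/-- the summand of type (iv) -/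
def skewJ (F : Type*) [Field F] (n : ℕ) : PBlock F :=
  ⟨n + n, (skewSum (J F n 0) (J F n 0)ᵀ, skewSum (1 : Mat F n) (-1))⟩

theorem sigmaInv_skewJ (n m : ℕ) : sigmaInv n (skewJ F m) = 0 :=
  sigmaInv_eq_zero fun d => by
    refine (sd_skew_J _ _ m).trans ?_
    rw [sd_regular_shift_swap, sd_regular_shift_swap]

theorem phiInv_skewJ (p : F[X]) (l m : ℕ) : phiInv p l (skewJ F m) = 0 :=
  phiInv_eq_zero fun d => by
    refine (sd_skew_J _ _ m).trans ?_
    rw [sd_companion_X_left, sd_companion_X_neg]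

section ScaledC
variable {c : F} {n : ℕ}

theorem sigmaInv_scaledC (hc : c ≠ 0) (hn : 0 < n) (m : ℕ) : sigmaInv m (scaledC c n) = 0 :=
  sigmaInv_eq_zero fun d => by
    by_cases ho : Odd n
    · rw [sd_scaledC_odd _ _ hc ho, sd_regular_shift]
    · rw [sd_scaledC_even _ _ hc hn ho, sd_regular_shift_swap]

theorem phiInv_scaledC_even (hc : c ≠ 0) (hn : 0 < n) (ho : ¬ Odd n) (p : F[X]) (l : ℕ) :
    phiInv p l (scaledC c n) = 0 :=
  phiInv_eq_zero fun d => by rw [sd_scaledC_even _ _ hc hn ho, sd_companion_X_left]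

theorem muInv_scaledC_odd (hc : c ≠ 0) (ho : Odd n) (l : ℕ) : muInv l (scaledC c n) = 0 :=
  muInv_eq_zero fun d => by rw [sd_scaledC_odd_swap _ _ hc ho, sd_companion_X_right]

end ScaledC

theorem phiInv_pairSkew3 [DecidableEq F[X]] {p q : F[X]} (hpm : p.Monic) (hp : Irreducible p)
    (hqm : q.Monic) (hq : Irreducible q) {l m : ℕ} (hl : 0 < l) (hm : 0 < m) :
    phiInv p l (pairSkew3 (q ^ m)) = (if p = q ∧ l = m then (p.natDegree : ℤ) else 0) +
      if p = negPoly q ∧ l = m then (p.natDegree : ℤ) else 0 := by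
  rw [← diff2_ite_min hl, ← diff2_ite_min hl, ← diff2_add]
  simp only [phiInv, sd_pairSkew3, sd_companion hpm hp hqm hq hm,
    sd_neg_transpose_companion hpm hp hqm hq hm]

theorem phiInv_gram [DecidableEq F[X]] {p q : F[X]} (hpm : p.Monic) (hp : Irreducible p)
    (hqm : q.Monic) (hq : Irreducible q) {l m : ℕ} (hl : 0 < l) (hm : 0 < m)
    {G : Mat F (q ^ m).natDegree} (hG : IsUnit G.det) :
    phiInv p l ⟨(q ^ m).natDegree, (G, G * companion F (q ^ m))⟩ =
      if p = q ∧ l = m then (p.natDegree : ℤ) else 0 := by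
  rw [← diff2_ite_min hl]
  simp only [phiInv, sd_one_of_gram hG, sd_companion hpm hp hqm hq hm]

theorem phiInv_scaledC_odd [DecidableEq F[X]] {p : F[X]} (hpm : p.Monic) (hp : Irreducible p)
    {l n : ℕ} (hl : 0 < l) {c : F} (hc : c ≠ 0) (ho : Odd n) :
    phiInv p l (scaledC c n) = if p = X ∧ l = n then (p.natDegree : ℤ) else 0 := by
  rw [← diff2_ite_min hl]
  simp only [phiInv, sd_scaledC_odd _ _ hc ho, sd_companion hpm hp monic_X irreducible_X ho.pos]

theorem muInv_scaledC_even {l n : ℕ} (hl : 0 < l) {c : F} (hc : c ≠ 0) (hn : 0 < n)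
    (ho : ¬ Odd n) : muInv l (scaledC c n) = if l = n then 1 else 0 := by
  classical
  have := diff2_min hl n 1
  rw [Nat.cast_one] at this
  rw [← this]
  simp only [muInv, sd_scaledC_even_swap _ _ hc hn ho,
    sd_companion monic_X irreducible_X monic_X irreducible_X hn, if_true, natDegree_X]

theorem muInv_skewJ {l n : ℕ} (hl : 0 < l) (hn : 0 < n) :
    muInv l (skewJ F n) = if l = n then 2 else 0 := by
  classical
  have h : ∀ l, sd (skewJ F n).2.2 (skewJ F n).2.1 (companion F (X ^ l)) 1 = min l n * 2 := by
    intro l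
    refine (sd_skew_J_swap _ _ n).trans ?_
    rw [sd_companion monic_X irreducible_X monic_X irreducible_X hn,
      sd_neg_transpose_companion monic_X irreducible_X monic_X irreducible_X hn, if_pos rfl,
      if_pos negPoly_X.symm, natDegree_X, mul_one, mul_two]
  simp only [muInv, h, diff2_min hl, Nat.cast_ofNat]

/-- the isomorphism types of the canonical summands -/
inductive Key (F : Type*) [Field F]
  | sing (n : ℕ)
  | reg (s : Sym2 F[X]) (l : ℕ)
  | iv (n : ℕ)
  | v (scaled : Bool) (n : ℕ)

/-- the canonical summands with their isomorphism types -/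
inductive HasKey (ζ : F) (N : (q : F[X]) → Mat F q.natDegree) : PBlock F → Key F → Prop
  | sing {n : ℕ} (hn : 0 < n) : HasKey ζ N (singBlock F n) (.sing n)
  | skew {q : F[X]} {m : ℕ} (hqm : q.Monic) (hq : Irreducible q) (hm : 0 < m)
      (hne : ¬ ∃ g : F[X], q = g.comp (X ^ 2)) (hX : ¬ (q = X ∧ Odd m)) :
      HasKey ζ N (pairSkew3 (q ^ m)) (.reg s(q, negPoly q) m)
  | form {q : F[X]} {m : ℕ} (hqm : q.Monic) (hq : Irreducible q) (hm : 0 < m)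
      (he : ∃ g : F[X], q = g.comp (X ^ 2)) :
      HasKey ζ N ⟨(q ^ m).natDegree, (N (q ^ m), N (q ^ m) * companion F (q ^ m))⟩
        (.reg s(q, negPoly q) m)
  | iv {n : ℕ} (hn : Odd n) : HasKey ζ N (skewJ F n) (.iv n)
  | va {n : ℕ} (hn : 0 < n) : HasKey ζ N (scaledC 1 n) (.v false n)
  | vb {n : ℕ} (hn : 0 < n) : HasKey ζ N (scaledC ζ n) (.v true n)

theorem sym2_negPoly_eq_iff {q q' : F[X]} :
    s(q', negPoly q') = s(q, negPoly q) ↔ q = q' ∨ q = negPoly q' := by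
  rw [Sym2.eq_iff]
  constructor
  · rintro (⟨h, -⟩ | ⟨-, h⟩)
    · exact .inl h.symm
    · exact .inr h.symm
  · rintro (rfl | rfl)
    · exact .inl ⟨rfl, rfl⟩
    · exact .inr ⟨(negPoly_negPoly _).symm, rfl⟩

section Test
variable {ζ : F} {N : (q : F[X]) → Mat F q.natDegree}

theorem HasKey.exists_test (hζ : ζ ≠ 0) (hN : ∀ (q : F[X]) (m : ℕ), q.Monic → Irreducible q →
      0 < m → (∃ g : F[X], q = g.comp (X ^ 2)) → IsUnit (N (q ^ m)).det) [DecidableEq (Key F)]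
    {b : PBlock F} {k : Key F} (h : HasKey ζ N b k) (hk : ∀ f n, k ≠ .v f n) :
    ∃ ψ : PBlock F → ℤ, IsInv ψ ∧ ∃ c : ℤ, c ≠ 0 ∧
      ∀ b' k', HasKey ζ N b' k' → ψ b' = if k' = k then c else 0 := by
  classical
  cases h with
  | @sing n hn =>
    refine ⟨sigmaInv n, isInv_sigmaInv n, -1, by norm_num, fun b' k' h' => ?_⟩
    cases h' with
    | @sing m hm =>
      rw [sigmaInv_singBlock hm hn]
      simp only [Key.sing.injEq, eq_comm]
    | skew => simp [sigmaInv_pairSkew3]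
    | form hqm hq hm he => simp [sigmaInv_gram n (hN _ _ hqm hq hm he)]
    | iv => simp [sigmaInv_skewJ]
    | va hm => simp [sigmaInv_scaledC one_ne_zero hm]
    | vb hm => simp [sigmaInv_scaledC hζ hm]
  | @skew q l hqm hq hl hne hX =>
    have hd : (0 : ℤ) < q.natDegree := by exact_mod_cast hq.natDegree_pos
    have hscaled : ∀ c : F, c ≠ 0 → ∀ n, 0 < n → phiInv q l (scaledC c n) = 0 := by
      intro c hc n hn
      by_cases ho : Odd n
      · rw [phiInv_scaledC_odd hqm hq hl hc ho, if_neg]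
        rintro ⟨h, rfl⟩
        exact hX ⟨h, ho⟩
      · exact phiInv_scaledC_even hc hn ho q l
    refine ⟨phiInv q l, isInv_phiInv q l, q.natDegree * if q = negPoly q then 2 else 1,
      by split_ifs <;> positivity, fun b' k' h' => ?_⟩
    cases h' with
    | sing hm => simp [phiInv_singBlock q hl hm]
    | @skew q' m hqm' hq' hm hne' hX' =>
      rw [phiInv_pairSkew3 hqm hq hqm' hq' hl hm]
      simp only [Key.reg.injEq, sym2_negPoly_eq_iff]
      by_cases hlm : l = m
      · subst hlm
        by_cases h1 : q = q'
        · subst h1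
          simp only [true_or, and_self, if_true, and_true]
          split_ifs <;> simp [mul_two]
        · by_cases h2 : q = negPoly q'
          · have h3 : q ≠ negPoly q := by
              rw [h2, negPoly_negPoly, ← h2]; exact h1
            rw [if_neg h3]
            simp [h1, ← h2]
          · simp [h1, h2]
      · simp [hlm, Ne.symm hlm]
    | @form q' m hqm' hq' hm he =>
      rw [phiInv_gram hqm hq hqm' hq' hl hm (hN _ _ hqm' hq' hm he), negPoly_of_even he]
      have h1 : q ≠ q' := fun h => hne (h ▸ he)
      have h2 : q' ≠ q := h1.symm
      simp [h1, h2]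
    | iv hn => simp [phiInv_skewJ]
    | va hm => simp [hscaled 1 one_ne_zero _ hm]
    | vb hm => simp [hscaled ζ hζ _ hm]
  | @form q l hqm hq hl he =>
    have hd : (0 : ℤ) < q.natDegree := by exact_mod_cast hq.natDegree_pos
    have hscaled : ∀ c : F, c ≠ 0 → ∀ n, 0 < n → phiInv q l (scaledC c n) = 0 := by
      intro c hc n hn
      by_cases ho : Odd n
      · rw [phiInv_scaledC_odd hqm hq hl hc ho, if_neg]
        rintro ⟨rfl, -⟩
        exact X_not_even he
      · exact phiInv_scaledC_even hc hn ho q l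
    refine ⟨phiInv q l, isInv_phiInv q l, q.natDegree, hd.ne', fun b' k' h' => ?_⟩
    cases h' with
    | sing hm => simp [phiInv_singBlock q hl hm]
    | @skew q' m hqm' hq' hm hne' hX' =>
      rw [phiInv_pairSkew3 hqm hq hqm' hq' hl hm]
      have h1 : q ≠ q' := fun h => hne' (h ▸ he)
      have h2 : q ≠ negPoly q' := fun h => h1 (by
        rw [← negPoly_of_even he, h, negPoly_negPoly])
      simp only [Key.reg.injEq, sym2_negPoly_eq_iff, h1, h2, or_self, false_and, if_false, add_zero]
    | @form q' m hqm' hq' hm he' =>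
      rw [phiInv_gram hqm hq hqm' hq' hl hm (hN _ _ hqm' hq' hm he')]
      simp only [Key.reg.injEq, sym2_negPoly_eq_iff]
      simp only [negPoly_of_even he', or_self, eq_comm (a := l)]
    | iv hn => simp [phiInv_skewJ]
    | va hm => simp [hscaled 1 one_ne_zero _ hm]
    | vb hm => simp [hscaled ζ hζ _ hm]
  | @iv l hl =>
    have hscaled : ∀ c : F, c ≠ 0 → ∀ n, 0 < n → muInv l (scaledC c n) = 0 := by
      intro c hc n hn
      by_cases ho : Odd n
      · exact muInv_scaledC_odd hc ho l
      · rw [muInv_scaledC_even hl.pos hc hn ho, if_neg]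
        rintro rfl
        exact ho hl
    refine ⟨muInv l, isInv_muInv l, 2, by norm_num, fun b' k' h' => ?_⟩
    cases h' with
    | sing hm => simp [muInv_singBlock hl.pos hm]
    | skew => simp [muInv_pairSkew3]
    | form hqm hq hm he => simp [muInv_gram l (hN _ _ hqm hq hm he)]
    | iv hn =>
      rw [muInv_skewJ hl.pos hn.pos]
      simp only [Key.iv.injEq, eq_comm]
    | va hm => simp [hscaled 1 one_ne_zero _ hm]
    | vb hm => simp [hscaled ζ hζ _ hm]
  | va => exact absurd rfl (hk _ _)
  | vb => exact absurd rfl (hk _ _)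

theorem HasKey.exists_test_v (hζ : ζ ≠ 0) (hN : ∀ (q : F[X]) (m : ℕ), q.Monic → Irreducible q →
      0 < m → (∃ g : F[X], q = g.comp (X ^ 2)) → IsUnit (N (q ^ m)).det) [DecidableEq (Key F)]
    {l : ℕ} (hl : 0 < l) :
    ∃ ψ : PBlock F → ℤ, IsInv ψ ∧ ∀ b' k', HasKey ζ N b' k' →
      ψ b' = (if k' = .v true l then 1 else 0) + if k' = .v false l then 1 else 0 := by
  classical
  by_cases hlo : Odd l
  · have hscaled : ∀ c : F, c ≠ 0 → ∀ n, 0 < n →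
        phiInv X l (scaledC c n) = if n = l then 1 else 0 := by
      intro c hc n hn
      by_cases ho : Odd n
      · rw [phiInv_scaledC_odd monic_X irreducible_X hl hc ho]
        simp [eq_comm]
      · rw [phiInv_scaledC_even hc hn ho, if_neg]
        rintro rfl
        exact ho hlo
    refine ⟨phiInv X l, isInv_phiInv X l, fun b' k' h' => ?_⟩
    cases h' with
    | sing hm => simp [phiInv_singBlock X hl hm]
    | @skew q m hqm hq hm hne hX =>
      rw [phiInv_pairSkew3 monic_X irreducible_X hqm hq hl hm]
      have h1 : ¬ (X = q ∧ l = m) := fun h => hX ⟨h.1.symm, h.2 ▸ hlo⟩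
      have h2 : ¬ (X = negPoly q ∧ l = m) := fun h => h1 ⟨by
        rw [← negPoly_X, h.1, negPoly_negPoly], h.2⟩
      simp [h1, h2]
    | @form q m hqm hq hm he =>
      rw [phiInv_gram monic_X irreducible_X hqm hq hl hm (hN _ _ hqm hq hm he)]
      have h1 : ¬ (X = q ∧ l = m) := by
        rintro ⟨rfl, -⟩
        exact X_not_even he
      simp [h1]
    | iv hn => simp [phiInv_skewJ]
    | va hm => simp [hscaled 1 one_ne_zero _ hm]
    | vb hm => simp [hscaled ζ hζ _ hm]
  · have hscaled : ∀ c : F, c ≠ 0 → ∀ n, 0 < n →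
        muInv l (scaledC c n) = if n = l then 1 else 0 := by
      intro c hc n hn
      by_cases ho : Odd n
      · rw [muInv_scaledC_odd hc ho, if_neg]
        rintro rfl
        exact hlo ho
      · rw [muInv_scaledC_even hl hc hn ho]
        simp [eq_comm]
    refine ⟨muInv l, isInv_muInv l, fun b' k' h' => ?_⟩
    cases h' with
    | sing hm => simp [muInv_singBlock hl hm]
    | skew => simp [muInv_pairSkew3]
    | form hqm hq hm he => simp [muInv_gram l (hN _ _ hqm hq hm he)]
    | iv hn =>
      rw [muInv_skewJ hl hn.pos, if_neg (by rintro rfl; exact hlo hn)]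
      simp
    | va hm => simp [hscaled 1 one_ne_zero _ hm]
    | vb hm => simp [hscaled ζ hζ _ hm]

end Test

theorem eq_zero_of_sd_eq_zero {ι κ δ ε : Type*} [Fintype ι] [Fintype δ] {A B : Matrix κ ι F}
    {P Q : Matrix δ ε F} (h : sd A B P Q = 0) {f : Matrix ι δ F} (hf : A * f * P = B * f * Q) :
    f = 0 := by
  have h' := Submodule.finrank_eq_zero.1 h
  exact (Submodule.mem_bot F).1 (h' ▸ (mem_Sol.2 hf))

/-- The form `(fᵀ A g) (d, 0)` on the space of solutions of `A f J = B f`, `J` of size `d + 1`,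
is the pullback of a form of rank `k` and determinant `δ` under a surjective map. -/
def HasDisc {ι : Type*} [Fintype ι] (A B : Matrix ι ι F) (d k : ℕ) (δ : F) : Prop :=
  ∃ (κ : Type) (_ : Fintype κ) (_ : DecidableEq κ) (π : Matrix ι (Fin (d + 1)) F → κ → F)
    (D : Matrix κ κ F), Fintype.card κ = k ∧ D.det = δ ∧
    (∀ v, ∃ f, A * f * J F (d + 1) 0 = B * f ∧ π f = v) ∧
    ∀ f g, A * f * J F (d + 1) 0 = B * f → A * g * J F (d + 1) 0 = B * g →
      (fᵀ * A * g) (Fin.last d) 0 = π f ⬝ᵥ D *ᵥ π g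

section HasDisc
variable {ι κ : Type*} [Fintype ι] [Fintype κ] {d k : ℕ} {δ : F}

theorem HasDisc.cg [DecidableEq ι] [DecidableEq κ] {A B : Matrix ι ι F} {A' B' : Matrix κ κ F}
    (hd : HasDisc A B d k δ) (h : Cg A B A' B') : HasDisc A' B' d k δ := by
  obtain ⟨S, R, h1, h2, rfl, rfl⟩ := h
  obtain ⟨μ, _, _, π, D, hk, hD, hs, hq⟩ := hd
  have hR : Rᵀ * Sᵀ = 1 := by rw [← transpose_mul, h1, transpose_one]
  have hsol : ∀ f : Matrix κ (Fin (d + 1)) F, Sᵀ * A * S * f * J F (d + 1) 0 = Sᵀ * B * S * f ↔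
      A * (S * f) * J F (d + 1) 0 = B * (S * f) := by
    intro f
    simp only [Matrix.mul_assoc]
    refine ⟨fun h => ?_, fun h => by rw [h]⟩
    have := congrArg (Rᵀ * ·) h
    simpa only [← Matrix.mul_assoc Rᵀ, hR, Matrix.one_mul] using this
  refine ⟨μ, _, _, fun f => π (S * f), D, hk, hD, fun v => ?_, fun f g hf hg => ?_⟩
  · obtain ⟨f, hf, hv⟩ := hs v
    have e : S * (R * f) = f := by rw [← Matrix.mul_assoc, h1, Matrix.one_mul]
    exact ⟨R * f, (hsol _).2 (by rwa [e]), (congrArg π e).trans hv⟩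
  · rw [← hq _ _ ((hsol f).1 hf) ((hsol g).1 hg), transpose_mul]
    simp only [Matrix.mul_assoc]

theorem HasDisc.fromBlocks {A B : Matrix ι ι F} {A' B' : Matrix κ κ F} {k' : ℕ} {δ' : F}
    (h : HasDisc A B d k δ) (h' : HasDisc A' B' d k' δ') :
    HasDisc (fromBlocks A 0 0 A') (fromBlocks B 0 0 B') d (k + k') (δ * δ') := by
  obtain ⟨μ, _, _, π, D, rfl, rfl, hs, hq⟩ := h
  obtain ⟨μ', _, _, π', D', rfl, rfl, hs', hq'⟩ := h'
  have hsol : ∀ (f : Matrix ι (Fin (d + 1)) F) (g : Matrix κ (Fin (d + 1)) F),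
      Matrix.fromBlocks A 0 0 A' * fromRows f g * J F (d + 1) 0 =
      Matrix.fromBlocks B 0 0 B' * fromRows f g ↔
      A * f * J F (d + 1) 0 = B * f ∧ A' * g * J F (d + 1) 0 = B' * g := by
    intro f g
    simp only [fromBlocks_mul_fromRows, Matrix.zero_mul, add_zero, zero_add, fromRows_mul]
    exact fromRows_inj.eq_iff
  refine ⟨μ ⊕ μ', inferInstance, inferInstance,
    fun f => Sum.elim (π (toRows₁ f)) (π' (toRows₂ f)), Matrix.fromBlocks D 0 0 D',
    Fintype.card_sum, det_fromBlocks_zero₂₁ _ _ _, fun v => ?_, fun f g hf hg => ?_⟩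
  · obtain ⟨f, hf, hv⟩ := hs (v ∘ Sum.inl)
    obtain ⟨g, hg, hw⟩ := hs' (v ∘ Sum.inr)
    refine ⟨fromRows f g, (hsol f g).2 ⟨hf, hg⟩, ?_⟩
    simp only [toRows₁_fromRows, toRows₂_fromRows]
    rw [hv, hw, Sum.elim_comp_inl_inr]
  · obtain ⟨f₁, f₂, rfl⟩ : ∃ f₁ f₂, f = fromRows f₁ f₂ := ⟨_, _, (fromRows_toRows f).symm⟩
    obtain ⟨g₁, g₂, rfl⟩ : ∃ g₁ g₂, g = fromRows g₁ g₂ := ⟨_, _, (fromRows_toRows g).symm⟩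
    rw [hsol] at hf hg
    have hf1 := hq f₁ g₁ hf.1 hg.1
    have hf2 := hq' f₂ g₂ hf.2 hg.2
    rw [transpose_fromRows, Matrix.mul_assoc, fromBlocks_mul_fromRows, fromCols_mul_fromRows]
    simp only [toRows₁_fromRows, toRows₂_fromRows, Matrix.zero_mul, add_zero, zero_add,
      fromBlocks_mulVec, Sum.elim_comp_inl, Sum.elim_comp_inr, Matrix.zero_mulVec,
      sumElim_dotProduct_sumElim, Matrix.add_apply, ← Matrix.mul_assoc, hf1, hf2]

theorem HasDisc.smul {A B : Matrix ι ι F} (h : HasDisc A B d k δ) {c : F} (hc : c ≠ 0) :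
    HasDisc (c • A) (c • B) d k (c ^ k * δ) := by
  obtain ⟨μ, _, _, π, D, rfl, rfl, hs, hq⟩ := h
  have hsol : ∀ f : Matrix ι (Fin (d + 1)) F, (c • A) * f * J F (d + 1) 0 = (c • B) * f ↔
      A * f * J F (d + 1) 0 = B * f := by
    intro f
    simp only [Matrix.smul_mul]
    exact (smul_right_injective _ hc).eq_iff
  refine ⟨μ, _, _, π, c • D, rfl, det_smul _ _, fun v => ?_, fun f g hf hg => ?_⟩
  · simpa only [hsol] using hs v
  · have := hq f g ((hsol f).1 hf) ((hsol g).1 hg)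
    simp only [Matrix.mul_smul, Matrix.smul_mul, Matrix.smul_apply, smul_mulVec, dotProduct_smul,
      this]

theorem HasDisc.of_forall {A B : Matrix ι ι F}
    (h : ∀ f g : Matrix ι (Fin (d + 1)) F, A * f * J F (d + 1) 0 = B * f →
      A * g * J F (d + 1) 0 = B * g → (fᵀ * A * g) (Fin.last d) 0 = 0) : HasDisc A B d 0 1 := by
  refine ⟨Empty, inferInstance, inferInstance, fun _ => Empty.elim, 1, rfl, det_one,
    fun v => ⟨0, by simp, Subsingleton.elim _ _⟩, fun f g hf hg => ?_⟩
  rw [h f g hf hg]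
  simp

theorem HasDisc.of_sd {A B : Matrix ι ι F} (h : sd A B (J F (d + 1) 0) 1 = 0) :
    HasDisc A B d 0 1 :=
  .of_forall fun f g hf _ => by
    rw [eq_zero_of_sd_eq_zero h (f := f) (by rwa [Matrix.mul_one])]
    simp

theorem HasDisc.unique {A B : Matrix ι ι F} {δ' : F} (h : HasDisc A B d k δ)
    (h' : HasDisc A B d k δ') : ∃ s, δ = s * s * δ' := by
  obtain ⟨μ, _, _, π, D, hk, rfl, hs, hq⟩ := h
  obtain ⟨μ', _, _, π', D', hk', rfl, -, hq'⟩ := h'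
  obtain ⟨e⟩ : Nonempty (μ ≃ μ') := Fintype.card_eq.1 (hk.trans hk'.symm)
  choose b hb hbv using fun i => hs (Pi.single i 1)
  let S : Matrix μ' μ F := Matrix.of fun a i => π' (b i) a
  have hD : D = (S.submatrix e id)ᵀ * D'.submatrix e e * S.submatrix e id := by
    ext i j
    have h1 := hq _ _ (hb i) (hb j)
    rw [hq' _ _ (hb i) (hb j), hbv, hbv] at h1
    rw [mulVec_single_one, single_one_dotProduct] at h1
    rw [transpose_submatrix, submatrix_mul_equiv, submatrix_mul_equiv, submatrix_apply,
      Matrix.mul_assoc]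
    exact h1.symm
  refine ⟨(S.submatrix e id).det, ?_⟩
  rw [hD, det_mul, det_mul, det_transpose, det_submatrix_equiv_self]
  ring

end HasDisc

theorem J_mul_apply {κ : Type*} {n : ℕ} (G : Matrix (Fin n) κ F) (i : Fin n) (j : κ) :
    (J F n 0 * G) i j = if h : 0 < (i : ℕ) then G ⟨i - 1, by omega⟩ j else 0 := by
  rw [Matrix.mul_apply]
  split_ifs with h
  · rw [Finset.sum_eq_single ⟨i - 1, by omega⟩]
    · have h1 : i ≠ ⟨i - 1, by omega⟩ := by intro e; have := congrArg Fin.val e; simp at this; omega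
      have h2 : (i : ℕ) = i - 1 + 1 := by omega
      simp [J, h1, ← h2]
    · intro k _ hk
      have : (i : ℕ) ≠ k + 1 := fun e => hk (Fin.ext (by simp [e]))
      simp [J, this]
    · simp
  · refine Finset.sum_eq_zero fun k _ => ?_
    have : (i : ℕ) ≠ k + 1 := by omega
    simp [J, this]

theorem J_transpose_mul_apply {κ : Type*} {n : ℕ} (G : Matrix (Fin n) κ F) (i : Fin n) (j : κ) :
    ((J F n 0)ᵀ * G) i j = if h : (i : ℕ) + 1 < n then G ⟨i + 1, h⟩ j else 0 := by
  rw [← transpose_transpose ((J F n 0)ᵀ * G), transpose_apply, transpose_mul, transpose_transpose,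
    mul_J_apply]
  rfl

theorem J_pow_self (n : ℕ) : J F n 0 ^ n = 0 := by
  have h := companion_X_pow_nilpotent (F := F) n
  rw [companion_X_pow] at h
  have hp : ∀ k, (J F n 0).submatrix (finCongr (natDegree_X_pow (R := F) n))
      (finCongr (natDegree_X_pow (R := F) n)) ^ k = (J F n 0 ^ k).submatrix
      (finCongr (natDegree_X_pow (R := F) n)) (finCongr (natDegree_X_pow (R := F) n)) := by
    intro k
    induction k with
    | zero => simp
    | succ k ih => rw [pow_succ, ih, submatrix_mul_equiv, pow_succ]
  rw [hp] at h
  ext i j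
  have := congrFun (congrFun h ((finCongr (natDegree_X_pow (R := F) n)).symm i))
    ((finCongr (natDegree_X_pow (R := F) n)).symm j)
  simpa using this

/-- The corner entry of `fᵀ g` vanishes for all `f`, `g` intertwining the nilpotent Jordan block of
size `d + 1` with `Φ` and `-Φᵀ`, respectively. -/
def CornerVanishes {ι : Type*} [Fintype ι] (d : ℕ) (Φ : Matrix ι ι F) : Prop :=
  ∀ f g : Matrix ι (Fin (d + 1)) F, f * J F (d + 1) 0 = Φ * f → g * J F (d + 1) 0 = -(Φᵀ * g) →
    (fᵀ * g) (Fin.last d) 0 = 0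

section CornerVanishes
variable {ι κ : Type*} [Fintype ι] [Fintype κ] {d : ℕ} {Φ : Matrix ι ι F}

theorem CornerVanishes.symm (h : CornerVanishes d Φ) {f g : Matrix ι (Fin (d + 1)) F}
    (hf : f * J F (d + 1) 0 = Φ * f) (hg : g * J F (d + 1) 0 = -(Φᵀ * g)) :
    (gᵀ * f) (Fin.last d) 0 = 0 := by
  have e : (J F (d + 1) 0)ᵀ * (fᵀ * g) = -(fᵀ * g * J F (d + 1) 0) := by
    rw [← Matrix.mul_assoc, ← transpose_mul, hf, transpose_mul, Matrix.mul_assoc, Matrix.mul_assoc,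
      hg, Matrix.mul_neg, neg_neg]
  have key : ∀ k (hk : k ≤ d), (fᵀ * g) ⟨d - k, by omega⟩ ⟨k, by omega⟩ = 0 := by
    intro k
    induction k with
    | zero => intro _; exact h f g hf hg
    | succ k ih =>
      intro hk
      have := congrFun (congrFun e ⟨d - (k + 1), by omega⟩) ⟨k, by omega⟩
      rw [J_transpose_mul_apply, Matrix.neg_apply, mul_J_apply, dif_pos (by simp; omega),
        dif_pos (by simp; omega)] at this
      have h0 := ih (by omega)
      have e1 : (⟨d - (k + 1) + 1, by omega⟩ : Fin (d + 1)) = ⟨d - k, by omega⟩ :=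
        Fin.ext (by simp; omega)
      rw [e1, h0] at this
      exact neg_eq_zero.1 this.symm
  have e2 : gᵀ * f = (fᵀ * g)ᵀ := by rw [transpose_mul, transpose_transpose]
  rw [e2, transpose_apply]
  have := key d le_rfl
  simp only [Nat.sub_self] at this
  exact this

theorem CornerVanishes.submatrix (h : CornerVanishes d Φ) (e : κ ≃ ι) :
    CornerVanishes d (Φ.submatrix e e) := by
  have hs : ∀ (Ψ : Matrix ι ι F) (f : Matrix κ (Fin (d + 1)) F),
      f * J F (d + 1) 0 = Ψ.submatrix e e * f →
      f.submatrix e.symm id * J F (d + 1) 0 = Ψ * f.submatrix e.symm id := by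
    intro Ψ f hf
    have h1 : Ψ.submatrix e e * f = (Ψ * f.submatrix e.symm id).submatrix e id := by
      rw [← submatrix_mul_equiv Ψ (f.submatrix e.symm id) e e id]
      simp
    rw [h1] at hf
    have := congrArg (fun M => M.submatrix e.symm id) hf
    simp only [submatrix_submatrix, Equiv.self_comp_symm, Function.comp_id, submatrix_id_id] at this
    exact this
  intro f g hf hg
  have := h _ _ (hs Φ f hf) ((hs (-Φᵀ) g (by rw [hg, ← Matrix.neg_mul]; rfl)).trans
    (Matrix.neg_mul _ _))
  rwa [transpose_submatrix, submatrix_mul_equiv] at this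

theorem cornerVanishes_J {m : ℕ} (h : m ≠ d + 1) : CornerVanishes d (J F m 0) := by
  intro f g hf hg
  have hf' : ∀ i j, _ := fun i j => congrFun (congrFun hf i) j
  have hg' : ∀ i j, _ := fun i j => congrFun (congrFun hg i) j
  simp only [mul_J_apply, J_mul_apply] at hf'
  simp only [mul_J_apply, Matrix.neg_apply, J_transpose_mul_apply] at hg'
  rw [Matrix.mul_apply]
  refine Finset.sum_eq_zero fun i _ => ?_
  rw [transpose_apply]
  by_cases hi : (i : ℕ) + 1 < m
  · have := hf' ⟨i + 1, hi⟩ (Fin.last d)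
    simp at this
    rw [← this, zero_mul]
  rcases lt_or_gt_of_ne h with hm | hm
  · have key : ∀ a (ha : a < m) b (hb : b < d + 1), a < b → f ⟨a, ha⟩ ⟨b, hb⟩ = 0 := by
      intro a
      induction a with
      | zero =>
        intro ha b hb hab
        have := hf' ⟨0, ha⟩ ⟨b - 1, by omega⟩
        rw [dif_pos (by simp; omega), dif_neg (by simp)] at this
        rw [← this]
        congr 1
        exact Fin.ext (by simp; omega)
      | succ a ih =>
        intro ha b hb hab
        have := hf' ⟨a + 1, ha⟩ ⟨b - 1, by omega⟩
        rw [dif_pos (by simp; omega), dif_pos (by simp)] at this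
        simp only [Nat.add_sub_cancel, ih _ (b - 1) (by omega) (by omega)] at this
        rw [← this]
        congr 1
        exact Fin.ext (by simp; omega)
    have := key i i.2 d (by omega) (by omega)
    rw [show f i (Fin.last d) = 0 from this, zero_mul]
  · have key : ∀ b (hb : b ≤ d) a (ha : a < m), d < a + (d - b) → g ⟨a, ha⟩ ⟨d - b, by omega⟩ = 0 := by
      intro b
      induction b with
      | zero =>
        intro hb a ha hab
        have := hg' ⟨a - 1, by omega⟩ ⟨d, by omega⟩
        rw [dif_neg (by simp), dif_pos (by simp; omega)] at this
        rw [← neg_eq_zero, eq_comm]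
        refine this.trans ?_
        congr 2
        exact Fin.ext (by simp; omega)
      | succ b ih =>
        intro hb a ha hab
        have := hg' ⟨a - 1, by omega⟩ ⟨d - (b + 1), by omega⟩
        rw [dif_pos (by simp; omega), dif_pos (by simp; omega)] at this
        rw [← neg_eq_zero]
        have h0 := ih (by omega) (a - 1) (by omega) (by omega)
        have e1 : (⟨d - (b + 1) + 1, by omega⟩ : Fin (d + 1)) = ⟨d - b, by omega⟩ :=
          Fin.ext (by simp; omega)
        have e2 : (⟨a - 1 + 1, by omega⟩ : Fin m) = ⟨a, ha⟩ := Fin.ext (by simp; omega)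
        simp only [e1, e2, h0] at this
        exact this.symm
    have := key d le_rfl i i.2 (by omega)
    simp only [Nat.sub_self] at this
    rw [show g i 0 = 0 from this, mul_zero]

end CornerVanishes

theorem cornerVanishes_companion {q : F[X]} (hqm : q.Monic) (hq : Irreducible q) {d m : ℕ}
    (h : q = X → m ≠ d + 1) : CornerVanishes d (companion F (q ^ m)) := by
  by_cases hX : q = X
  · subst hX
    rw [companion_X_pow]
    exact (cornerVanishes_J (h rfl)).submatrix _
  · intro f g hf _
    have hJ : aeval (J F (d + 1) 0) ((X : F[X]) ^ (d + 1)) = 0 := by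
      rw [map_pow, aeval_X, J_pow_self]
    have h0 := sd_intertwine_coprime (isCoprime_pow_of_ne hqm hq monic_X irreducible_X hX m (d + 1))
      (aeval_companion_self (hqm.pow m)) hJ
    rw [eq_zero_of_sd_eq_zero h0 (f := f) (by simpa using hf)]
    simp

theorem hasDisc_skewSum {k l d : ℕ} {A A' : Matrix (Fin k) (Fin l) F}
    {B B' : Matrix (Fin l) (Fin k) F}
    (h : ∀ (f : Matrix (Fin l) (Fin (d + 1)) F) (g : Matrix (Fin k) (Fin (d + 1)) F),
      A * f * J F (d + 1) 0 = A' * f → B * g * J F (d + 1) 0 = B' * g →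
      (fᵀ * B * g) (Fin.last d) 0 = 0 ∧ (gᵀ * A * f) (Fin.last d) 0 = 0) :
    HasDisc (skewSum A B) (skewSum A' B') d 0 1 := by
  refine (HasDisc.of_forall ?_).cg (Cg.reindex (fromBlocks 0 B A 0) (fromBlocks 0 B' A' 0) _)
  have hsol : ∀ (f : Matrix (Fin l) (Fin (d + 1)) F) (g : Matrix (Fin k) (Fin (d + 1)) F),
      fromBlocks 0 B A 0 * fromRows f g * J F (d + 1) 0 = fromBlocks 0 B' A' 0 * fromRows f g →
      A * f * J F (d + 1) 0 = A' * f ∧ B * g * J F (d + 1) 0 = B' * g := by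
    intro f g h
    simp only [fromBlocks_mul_fromRows, Matrix.zero_mul, add_zero, zero_add, fromRows_mul] at h
    exact (fromRows_inj.eq_iff.1 h).symm
  intro f g hf hg
  obtain ⟨f₁, f₂, rfl⟩ : ∃ f₁ f₂, f = fromRows f₁ f₂ := ⟨_, _, (fromRows_toRows f).symm⟩
  obtain ⟨g₁, g₂, rfl⟩ : ∃ g₁ g₂, g = fromRows g₁ g₂ := ⟨_, _, (fromRows_toRows g).symm⟩
  have h1 := hsol f₁ f₂ hf
  have h2 := hsol g₁ g₂ hg
  rw [transpose_fromRows, Matrix.mul_assoc, fromBlocks_mul_fromRows, fromCols_mul_fromRows]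
  simp only [Matrix.zero_mul, add_zero, zero_add, Matrix.add_apply, ← Matrix.mul_assoc,
    (h f₁ g₂ h1.1 h2.2).1, (h g₁ f₂ h2.1 h1.2).2]

theorem hasDisc_skewSum_one {m d : ℕ} {Φ : Mat F m} (h : CornerVanishes d Φ) :
    HasDisc (skewSum 1 1) (skewSum Φ (-Φᵀ)) d 0 1 := by
  refine hasDisc_skewSum fun f g hf hg => ?_
  rw [Matrix.one_mul] at hf
  rw [Matrix.one_mul, Matrix.neg_mul] at hg
  rw [Matrix.mul_one, Matrix.mul_one]
  exact ⟨h f g hf hg, h.symm hf hg⟩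

theorem hasDisc_skewSum_neg_one {m d : ℕ} {Φ : Mat F m} (h : CornerVanishes d Φ) :
    HasDisc (skewSum 1 (-1)) (skewSum Φ Φᵀ) d 0 1 := by
  refine hasDisc_skewSum fun f g hf hg => ?_
  rw [Matrix.one_mul] at hf
  rw [Matrix.neg_mul, Matrix.one_mul, Matrix.neg_mul, neg_eq_iff_eq_neg] at hg
  rw [Matrix.mul_one, Matrix.mul_neg, Matrix.mul_one, Matrix.neg_mul, Matrix.neg_apply,
    neg_eq_zero]
  exact ⟨h f g hf hg, h.symm hf hg⟩

section Gram
variable {ι : Type*} [Fintype ι] [DecidableEq ι] {G Φ : Matrix ι ι F} {d : ℕ}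

theorem gram_sol (hG : IsUnit G.det) (f : Matrix ι (Fin (d + 1)) F) :
    G * f * J F (d + 1) 0 = G * Φ * f ↔ f * J F (d + 1) 0 = Φ * f := by
  simp only [Matrix.mul_assoc]
  refine ⟨fun h => ?_, fun h => by rw [h]⟩
  have := congrArg (G⁻¹ * ·) h
  simpa only [← Matrix.mul_assoc G⁻¹, Matrix.nonsing_inv_mul _ hG, Matrix.one_mul] using this

theorem hasDisc_gram (hG : IsUnit G.det) (hΦ : Φᵀ * G = -(G * Φ)) (h : CornerVanishes d Φ) :
    HasDisc G (G * Φ) d 0 1 := by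
  refine HasDisc.of_forall fun f g hf hg => ?_
  rw [Matrix.mul_assoc]
  refine h f (G * g) ((gram_sol hG f).1 hf) ?_
  rw [hg, ← Matrix.mul_assoc, hΦ, Matrix.neg_mul, neg_neg]

end Gram

theorem hasDisc_gram_J {d : ℕ} {G : Mat F (d + 1)} (hG : IsUnit G.det)
    (hJ : (J F (d + 1) 0)ᵀ * G = -(G * J F (d + 1) 0)) :
    ∃ γ ≠ 0, HasDisc G (G * J F (d + 1) 0) d 1 γ := by
  have hrow : ∀ j ≠ 0, G (Fin.last d) j = 0 := by
    intro j hj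
    have h0 : (j : ℕ) ≠ 0 := fun h => hj (Fin.ext h)
    have := congrFun (congrFun hJ (Fin.last d)) ⟨j - 1, by omega⟩
    rw [J_transpose_mul_apply, dif_neg (by simp), Matrix.neg_apply, mul_J_apply,
      dif_pos (by simp; omega)] at this
    rw [← neg_eq_zero, eq_comm]
    refine this.trans ?_
    congr 2
    exact Fin.ext (by simp; omega)
  refine ⟨G (Fin.last d) 0, fun h0 => ?_, Unit, inferInstance, inferInstance, fun f _ => f 0 0,
    Matrix.of fun _ _ => G (Fin.last d) 0, rfl, by simp, fun v => ⟨v () • 1, ?_, ?_⟩,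
    fun f g hf hg => ?_⟩
  · refine hG.ne_zero (det_eq_zero_of_row_eq_zero (Fin.last d) fun j => ?_)
    by_cases hj : j = 0
    · rw [hj, h0]
    · exact hrow j hj
  · simp
  · funext u
    simp
  · have hf' := (gram_sol hG f).1 hf
    have hcol : ∀ i ≠ Fin.last d, f i (Fin.last d) = 0 := by
      intro i hi
      have h0 : (i : ℕ) ≠ d := fun h => hi (Fin.ext h)
      have := congrFun (congrFun hf' ⟨i + 1, by omega⟩) (Fin.last d)
      rw [mul_J_apply, dif_neg (by simp), J_mul_apply, dif_pos (by simp)] at this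
      exact this.symm
    have hdiag : ∀ k (hk : k < d + 1), f ⟨k, hk⟩ ⟨k, hk⟩ = f 0 0 := by
      intro k
      induction k with
      | zero => intro _; rfl
      | succ k ih =>
        intro hk
        have := congrFun (congrFun hf' ⟨k + 1, hk⟩) ⟨k, by omega⟩
        rw [mul_J_apply, dif_pos hk, J_mul_apply, dif_pos (by simp)] at this
        exact this.trans (ih (by omega))
    rw [Matrix.mul_assoc, Matrix.mul_apply, Finset.sum_eq_single (Fin.last d)
      (fun i _ hi => by rw [transpose_apply, hcol i hi, zero_mul]) (by simp), transpose_apply,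
      Matrix.mul_apply, Finset.sum_eq_single 0 (fun i _ hi => by rw [hrow i hi, zero_mul])
      (by simp), show f (Fin.last d) (Fin.last d) = f 0 0 from hdiag d (by omega)]
    simp [dotProduct, mulVec]

theorem cModel_sd_swap_eq_zero {n d : ℕ} (hn : 0 < n) :
    sd (cModel F n).2 (cModel F n).1 (J F (d + 1) 0) 1 = 0 := by
  rw [sd_cModel_swap _ _ hn]
  exact sd_nilpotent (.inr (J_pow_self _))

theorem hasDisc_cModel_of_ne {n d : ℕ} (hn : 0 < n) (h : n ≠ d + 1) :
    HasDisc (cModel F n).1 (cModel F n).2 d 0 1 := by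
  obtain ⟨H, hH, h1, h2, hc⟩ := exists_cyclic_cModel (F := F) n hn
  exact (hasDisc_gram hH (transpose_companion_mul (neg_one_pow_mul_self _) h1 h2)
    (cornerVanishes_companion monic_X irreducible_X fun _ => h)).cg hc

theorem hasDisc_cModel (F : Type*) [Field F] (d : ℕ) :
    ∃ γ ≠ 0, HasDisc (cModel F (d + 1)).1 (cModel F (d + 1)).2 d 1 γ := by
  obtain ⟨H, hH, h1, h2, hc⟩ := exists_cyclic_cModel (F := F) (d + 1) d.succ_pos
  have hΦ := transpose_companion_mul (neg_one_pow_mul_self _) h1 h2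
  let e := (finCongr (natDegree_X_pow (R := F) (d + 1))).symm
  have hJ : J F (d + 1) 0 = (companion F (X ^ (d + 1))).submatrix e e := by
    rw [companion_X_pow]
    rfl
  have hHJ : H.submatrix e e * J F (d + 1) 0 = (H * companion F (X ^ (d + 1))).submatrix e e := by
    rw [hJ, submatrix_mul_equiv]
  obtain ⟨γ, h0, h⟩ := hasDisc_gram_J (G := H.submatrix e e)
    (by rwa [det_submatrix_equiv_self]) (by
      rw [hHJ, hJ, transpose_submatrix, submatrix_mul_equiv, hΦ]
      rfl)
  rw [hHJ] at h
  exact ⟨γ, h0, h.cg ((Cg.submatrix H (H * companion F (X ^ (d + 1))) e).symm.trans hc)⟩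

/-- the pair whose nondegenerate form on the summands of size `d + 1` of type (v) comes first -/
def orient {K : Type*} (d : ℕ) (b : PBlock K) : PBlock K := if Even d then b else swapBlock b

theorem psum_map_orient (d : ℕ) (L : List (PBlock F)) :
    psum (L.map (orient d)) = orient d (psum L) := by
  by_cases hd : Even d
  · have : (orient d : PBlock F → PBlock F) = id := by funext b; simp [orient, hd]
    simp [this]
  · have : (orient d : PBlock F → PBlock F) = swapBlock := by funext b; simp [orient, hd]
    rw [this, psum_map_swapBlock]

theorem PCg.orient {X Y : PBlock F} (h : PCg X Y) (d : ℕ) : PCg (orient d X) (orient d Y) := by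
  unfold Can.orient
  split_ifs
  · exact h
  · exact Cg.swap h

theorem orient_even {K : Type*} {d : ℕ} (hd : Even d) (b : PBlock K) : orient d b = b := if_pos hd

theorem orient_odd {K : Type*} {d : ℕ} (hd : ¬ Even d) (b : PBlock K) :
    orient d b = swapBlock b := if_neg hd

theorem hasDisc_scaledC_of_ne {c : F} (hc : c ≠ 0) {n d : ℕ} (hn : 0 < n) (h : n ≠ d + 1) :
    HasDisc (orient d (scaledC c n)).2.1 (orient d (scaledC c n)).2.2 d 0 1 := by
  have h1 := (hasDisc_cModel_of_ne (F := F) hn h).smul hc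
  rw [pow_zero, mul_one] at h1
  have h2 : HasDisc (c • (cModel F n).2) (c • (cModel F n).1) d 0 1 :=
    .of_sd (by rw [sd_smul _ _ hc, cModel_sd_swap_eq_zero hn])
  unfold cModel at h1 h2
  by_cases hd : Even d
  · rw [orient_even hd]
    split_ifs at h1 h2
    · exact h1
    · exact h2
  · rw [orient_odd hd]
    split_ifs at h1 h2
    · exact h2
    · exact h1

theorem hasDisc_scaledC {d : ℕ} {γ : F}
    (h : HasDisc (cModel F (d + 1)).1 (cModel F (d + 1)).2 d 1 γ) {c : F} (hc : c ≠ 0) :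
    HasDisc (orient d (scaledC c (d + 1))).2.1 (orient d (scaledC c (d + 1))).2.2 d 1 (c * γ) := by
  have h1 := h.smul hc
  rw [pow_one] at h1
  unfold cModel at h1
  by_cases hd : Even d
  · rw [orient_even hd]
    rwa [if_pos hd.add_one] at h1
  · rw [orient_odd hd]
    rwa [if_neg (by rw [Nat.odd_add_one, Nat.not_odd_iff_even]; exact hd)] at h1

theorem hasDisc_singBlock (n d : ℕ) :
    HasDisc (orient d (singBlock F n)).2.1 (orient d (singBlock F n)).2.2 d 0 1 := by
  by_cases hd : Even d
  · rw [orient_even hd]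
    refine hasDisc_skewSum fun f g _ hg => ?_
    rw [eq_zero_of_sd_eq_zero (sd_sing_transpose n (J F (d + 1) 0)) (f := g) (by
      rwa [Matrix.mul_one])]
    simp
  · rw [orient_odd hd]
    have h0 : sd (-(Gmat F n)ᵀ) (Fmat F n)ᵀ (J F (d + 1) 0) 1 = 0 := by
      rw [← sd_sing_transpose n (J F (d + 1) 0), ← sd_neg,
        ← sd_submatrix _ _ _ _ Fin.revPerm Fin.revPerm]
      simp only [neg_neg, submatrix_neg, ← transpose_submatrix, Gmat_submatrix_rev,
        Fmat_submatrix_rev, Pi.neg_apply]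
    refine hasDisc_skewSum fun f g _ hg => ?_
    rw [eq_zero_of_sd_eq_zero h0 (f := g) (by rwa [Matrix.mul_one])]
    simp

section HasKey
variable {ζ : F} {N : (q : F[X]) → Mat F q.natDegree} [DecidableEq (Key F)]

theorem HasKey.hasDisc (hζ : ζ ≠ 0)
    (hN : ∀ (q : F[X]) (m : ℕ), q.Monic → Irreducible q → 0 < m →
      (∃ g : F[X], q = g.comp (X ^ 2)) → IsUnit (N (q ^ m)).det ∧ (N (q ^ m))ᵀ = N (q ^ m) ∧
        (N (q ^ m) * companion F (q ^ m))ᵀ = -(N (q ^ m) * companion F (q ^ m)))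
    {d : ℕ} {γ : F} (hγ : HasDisc (cModel F (d + 1)).1 (cModel F (d + 1)).2 d 1 γ)
    {b : PBlock F} {k : Key F} (h : HasKey ζ N b k) :
    HasDisc (orient d b).2.1 (orient d b).2.2 d
      ((if k = .v true (d + 1) then 1 else 0) + if k = .v false (d + 1) then 1 else 0)
      ((if k = .v true (d + 1) then ζ * γ else 1) * if k = .v false (d + 1) then γ else 1) := by
  cases h with
  | sing hn => simpa using hasDisc_singBlock _ d
  | @skew q m hqm hq hm hne hX =>
    simp only [reduceCtorEq, if_false, add_zero, mul_one]
    by_cases hd : Even d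
    · rw [orient_even hd]
      refine hasDisc_skewSum_one (cornerVanishes_companion hqm hq fun h hm => hX ⟨h, ?_⟩)
      rw [hm]
      exact hd.add_one
    · rw [orient_odd hd]
      refine .of_sd ((sd_pairSkew3_swap _ _ _).trans ?_)
      rw [sd_nilpotent (.inr (J_pow_self _)), sd_nilpotent (.inr (J_pow_self _))]
  | @form q m hqm hq hm he =>
    simp only [reduceCtorEq, if_false, add_zero, mul_one]
    obtain ⟨h1, h2, h3⟩ := hN q m hqm hq hm he
    by_cases hd : Even d
    · rw [orient_even hd]
      refine hasDisc_gram h1 (transpose_companion_mul (ε := 1) (by simp) (by rwa [one_smul])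
        (by rwa [neg_smul, one_smul])) (cornerVanishes_companion hqm hq ?_)
      rintro rfl
      exact absurd he X_not_even
    · rw [orient_odd hd]
      exact .of_sd ((sd_gram_swap _ _ h1).trans (sd_nilpotent (.inr (J_pow_self _))))
  | @iv n hn =>
    simp only [reduceCtorEq, if_false, add_zero, mul_one]
    by_cases hd : Even d
    · rw [orient_even hd]
      refine .of_sd ((sd_skew_J _ _ _).trans ?_)
      rw [sd_nilpotent (.inr (J_pow_self _)), sd_nilpotent (.inr (J_pow_self _))]
    · rw [orient_odd hd]
      refine hasDisc_skewSum_neg_one (cornerVanishes_J ?_)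
      rintro rfl
      exact Nat.odd_add_one.1 hn (Nat.not_even_iff_odd.1 hd)
  | @va n hn =>
    by_cases h : n = d + 1
    · subst h
      simpa using hasDisc_scaledC hγ one_ne_zero
    · simpa [h] using hasDisc_scaledC_of_ne one_ne_zero hn h
  | @vb n hn =>
    by_cases h : n = d + 1
    · subst h
      simpa using hasDisc_scaledC hγ hζ
    · simpa [h] using hasDisc_scaledC_of_ne hζ hn h

theorem hasDisc_of_forall₂ (hζ : ζ ≠ 0)
    (hN : ∀ (q : F[X]) (m : ℕ), q.Monic → Irreducible q → 0 < m →
      (∃ g : F[X], q = g.comp (X ^ 2)) → IsUnit (N (q ^ m)).det ∧ (N (q ^ m))ᵀ = N (q ^ m) ∧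
        (N (q ^ m) * companion F (q ^ m))ᵀ = -(N (q ^ m) * companion F (q ^ m)))
    {d : ℕ} {γ : F} (hγ : HasDisc (cModel F (d + 1)).1 (cModel F (d + 1)).2 d 1 γ)
    {L : List (PBlock F)} {K : List (Key F)} (h : List.Forall₂ (HasKey ζ N) L K) :
    HasDisc (psum (L.map (orient d))).2.1 (psum (L.map (orient d))).2.2 d
      (K.count (.v true (d + 1)) + K.count (.v false (d + 1)))
      (γ ^ (K.count (.v true (d + 1)) + K.count (.v false (d + 1))) *
        ζ ^ K.count (.v true (d + 1))) := by
  induction h with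
  | nil =>
    simp only [List.count_nil, add_zero, pow_zero, mul_one]
    exact .of_forall fun f g _ _ => by
      rw [Matrix.mul_apply]
      exact Finset.sum_eq_zero fun j _ => Fin.elim0 j
  | @cons b k L K hb _ ih =>
    refine HasDisc.cg ?_ (cg_psum_cons _ _)
    convert (hb.hasDisc hζ hN hγ).fromBlocks ih using 1
    · simp only [List.count_cons, beq_iff_eq]
      omega
    · simp only [List.count_cons, beq_iff_eq]
      by_cases h1 : k = .v true (d + 1)
      · simp [h1]; ring
      · by_cases h2 : k = .v false (d + 1)
        · simp [h2]; ring
        · simp [h1, h2]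

/-- the discriminant distinguishes the summands `Cₙ` and `ζCₙ` -/
theorem count_scaled_eq (hsq : ¬ IsSquare ζ)
    (hN : ∀ (q : F[X]) (m : ℕ), q.Monic → Irreducible q → 0 < m →
      (∃ g : F[X], q = g.comp (X ^ 2)) → IsUnit (N (q ^ m)).det ∧ (N (q ^ m))ᵀ = N (q ^ m) ∧
        (N (q ^ m) * companion F (q ^ m))ᵀ = -(N (q ^ m) * companion F (q ^ m)))
    {d : ℕ} {L L' : List (PBlock F)} {K K' : List (Key F)}
    (h : List.Forall₂ (HasKey ζ N) L K) (h' : List.Forall₂ (HasKey ζ N) L' K')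
    (hcg : PCg (psum L) (psum L'))
    (hK : K.count (.v true (d + 1)) ≤ 1) (hK' : K'.count (.v true (d + 1)) ≤ 1)
    (hsum : K.count (.v true (d + 1)) + K.count (.v false (d + 1)) =
      K'.count (.v true (d + 1)) + K'.count (.v false (d + 1))) :
    K.count (.v true (d + 1)) = K'.count (.v true (d + 1)) := by
  have hζ : ζ ≠ 0 := fun h => hsq (h ▸ IsSquare.zero)
  obtain ⟨γ, hγ0, hγ⟩ := hasDisc_cModel F d
  have h1 := hasDisc_of_forall₂ hζ hN hγ h
  have h2 := hasDisc_of_forall₂ hζ hN hγ h'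
  rw [psum_map_orient] at h1 h2
  obtain ⟨s, hs⟩ := (h1.cg (hcg.orient d)).unique (hsum ▸ h2)
  rw [hsum, mul_left_comm] at hs
  have hs' := mul_left_cancel₀ (pow_ne_zero _ hγ0) hs
  have ha : K.count (.v true (d + 1)) = 0 ∨ K.count (.v true (d + 1)) = 1 := by omega
  have hb : K'.count (.v true (d + 1)) = 0 ∨ K'.count (.v true (d + 1)) = 1 := by omega
  rcases ha with ha | ha <;> rcases hb with hb | hb <;> rw [ha, hb] at hs' ⊢
  · rw [pow_zero, pow_one] at hs'
    refine absurd ⟨s⁻¹, ?_⟩ hsq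
    have hs0 : s ≠ 0 := by rintro rfl; simp at hs'
    field_simp
    rw [pow_two, hs', mul_comm]
  · rw [pow_zero, pow_one, mul_one] at hs'
    exact absurd ⟨s, hs'⟩ hsq

end HasKey

section Uniqueness
variable {ζ : F} {N : (q : F[X]) → Mat F q.natDegree}

theorem HasKey.size_pos {b : PBlock F} {f : Bool} {n : ℕ} (h : HasKey ζ N b (.v f n)) : 0 < n := by
  cases h <;> assumption

theorem exists_hasKey_of_mem {L : List (PBlock F)} {K : List (Key F)}
    (h : List.Forall₂ (HasKey ζ N) L K) {k : Key F} (hk : k ∈ K) : ∃ b, HasKey ζ N b k := by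
  induction h with
  | nil => simp at hk
  | cons hb _ ih =>
    rcases List.mem_cons.1 hk with rfl | hk
    · exact ⟨_, hb⟩
    · exact ih hk

theorem sum_map_test [DecidableEq (Key F)] {L : List (PBlock F)} {K : List (Key F)}
    (h : List.Forall₂ (HasKey ζ N) L K) {ψ : PBlock F → ℤ} {c : ℤ} {k : Key F}
    (hψ : ∀ b' k', HasKey ζ N b' k' → ψ b' = if k' = k then c else 0) :
    (L.map ψ).sum = c * K.count k := by
  induction h with
  | nil => simp
  | cons hb _ ih =>
    rw [List.map_cons, List.sum_cons, ih, hψ _ _ hb, List.count_cons]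
    simp only [beq_iff_eq]
    split_ifs <;> push_cast <;> ring

theorem sum_map_test_v [DecidableEq (Key F)] {L : List (PBlock F)} {K : List (Key F)}
    (h : List.Forall₂ (HasKey ζ N) L K) {ψ : PBlock F → ℤ} {l : ℕ}
    (hψ : ∀ b' k', HasKey ζ N b' k' →
      ψ b' = (if k' = .v true l then 1 else 0) + if k' = .v false l then 1 else 0) :
    (L.map ψ).sum = K.count (.v true l) + K.count (.v false l) := by
  induction h with
  | nil => simp
  | cons hb _ ih =>
    rw [List.map_cons, List.sum_cons, ih, hψ _ _ hb, List.count_cons, List.count_cons]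
    simp only [beq_iff_eq]
    push_cast
    ring

theorem perm_of_pcg [DecidableEq (Key F)] (hsq : ¬ IsSquare ζ)
    (hN : ∀ (q : F[X]) (m : ℕ), q.Monic → Irreducible q → 0 < m →
      (∃ g : F[X], q = g.comp (X ^ 2)) → IsUnit (N (q ^ m)).det ∧ (N (q ^ m))ᵀ = N (q ^ m) ∧
        (N (q ^ m) * companion F (q ^ m))ᵀ = -(N (q ^ m) * companion F (q ^ m)))
    {L L' : List (PBlock F)} {K K' : List (Key F)}
    (h : List.Forall₂ (HasKey ζ N) L K) (h' : List.Forall₂ (HasKey ζ N) L' K')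
    (hcg : PCg (psum L) (psum L'))
    (hK : ∀ n, K.count (.v true n) ≤ 1) (hK' : ∀ n, K'.count (.v true n) ≤ 1) : K.Perm K' := by
  have hζ : ζ ≠ 0 := fun h => hsq (h ▸ IsSquare.zero)
  have hdet := fun q m hqm hq hm he => (hN q m hqm hq hm he).1
  have hψ : ∀ ψ : PBlock F → ℤ, IsInv ψ → (L.map ψ).sum = (L'.map ψ).sum := fun ψ hi => by
    rw [← hi.psum, ← hi.psum, hi.pcg _ _ hcg]
  refine List.perm_iff_count.2 fun k => ?_
  by_cases hmem : ∃ b, HasKey ζ N b k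
  · obtain ⟨b, hb⟩ := hmem
    by_cases hv : ∀ f n, k ≠ .v f n
    · obtain ⟨ψ, hi, c, hc, ht⟩ := hb.exists_test hζ hdet hv
      have := hψ ψ hi
      rw [sum_map_test h ht, sum_map_test h' ht] at this
      exact_mod_cast mul_left_cancel₀ hc this
    · push Not at hv
      obtain ⟨f, n, rfl⟩ := hv
      have hn := hb.size_pos
      obtain ⟨ψ, hi, ht⟩ := HasKey.exists_test_v hζ hdet hn
      have hsum := hψ ψ hi
      rw [sum_map_test_v h ht, sum_map_test_v h' ht] at hsum
      obtain ⟨d, rfl⟩ : ∃ d, n = d + 1 := ⟨n - 1, by omega⟩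
      have heq := count_scaled_eq hsq hN h h' hcg (hK _) (hK' _) (by exact_mod_cast hsum)
      cases f <;> omega
  · rw [List.count_eq_zero_of_not_mem fun hk => hmem (exists_hasKey_of_mem h hk),
      List.count_eq_zero_of_not_mem fun hk => hmem (exists_hasKey_of_mem h' hk)]

theorem HasKey.equiv3 {b c : PBlock F} {k : Key F} (h : HasKey ζ N b k) (h' : HasKey ζ N c k) :
    Equiv3 b c := by
  cases h with
  | sing => cases h'; exact .inl rfl
  | @skew q m hqm hq hm hne hX =>
    generalize hs : s(q, negPoly q) = s at h'
    cases h' with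
    | @skew q' _ _ _ _ hne' _ =>
      rcases sym2_negPoly_eq_iff.1 hs with rfl | rfl
      · exact .inl rfl
      · refine .inr ⟨q, m, hqm, hq, hm, hne, hX, rfl, ?_⟩
        rw [← negPoly_pow]
        rfl
    | form _ _ _ he =>
      rcases sym2_negPoly_eq_iff.1 hs with rfl | rfl
      · exact absurd he hne
      · have := negPoly_of_even he
        rw [negPoly_negPoly] at this
        exact absurd (this ▸ he) hne
  | @form q m hqm hq hm he =>
    generalize hs : s(q, negPoly q) = s at h'
    cases h' with
    | skew _ _ _ hne =>
      rcases sym2_negPoly_eq_iff.1 hs with rfl | rfl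
      · exact absurd he hne
      · exact absurd ((negPoly_of_even he).symm ▸ he) hne
    | form =>
      rcases sym2_negPoly_eq_iff.1 hs with rfl | rfl
      · exact .inl rfl
      · rw [negPoly_of_even he]
        exact .inl rfl
  | iv => cases h'; exact .inl rfl
  | va => cases h'; exact .inl rfl
  | vb => cases h'; exact .inl rfl

theorem exists_sublist_forall₂ {α β : Type*} {R : α → β → Prop} {L : List α} {K K' : List β}
    (hs : K'.Sublist K) (h : List.Forall₂ R L K) :
    ∃ L' : List α, L'.Sublist L ∧ List.Forall₂ R L' K' := by
  induction hs generalizing L with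
  | slnil => exact ⟨[], List.nil_sublist _, .nil⟩
  | cons k _ ih =>
    cases h with
    | cons hb h =>
      obtain ⟨L', h1, h2⟩ := ih h
      exact ⟨L', h1.cons _, h2⟩
  | cons_cons k _ ih =>
    cases h with
    | cons hb h =>
      obtain ⟨L', h1, h2⟩ := ih h
      exact ⟨_ :: L', h1.cons_cons _, .cons hb h2⟩

theorem Canon3.exists_keys [DecidableEq (Key F)] {L : List (PBlock F)} (h : Canon3 ζ N L) :
    ∃ K, List.Forall₂ (HasKey ζ N) L K ∧ ∀ n, K.count (.v true n) ≤ 1 := by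
  have hkey : ∀ b ∈ L, ∃ k, HasKey ζ N b k := by
    intro b hb
    rcases h.1 b hb with ⟨n, hn, rfl⟩ | ⟨q, m, hqm, hq, hm, hne, hX, rfl⟩ |
      ⟨q, m, hqm, hq, hm, he, rfl⟩ | ⟨n, hn, rfl⟩ | ⟨n, hn, rfl⟩ | ⟨n, hn, rfl⟩
    · exact ⟨_, .sing hn⟩
    · exact ⟨_, .skew hqm hq hm hne hX⟩
    · exact ⟨_, .form hqm hq hm he⟩
    · exact ⟨_, .iv hn⟩
    · refine ⟨.v false n, ?_⟩
      have := HasKey.va (ζ := ζ) (N := N) hn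
      rwa [scaledC, one_smul, one_smul] at this
    · exact ⟨_, .vb hn⟩
  obtain ⟨K, hK⟩ : ∃ K, List.Forall₂ (HasKey ζ N) L K := by
    clear h
    induction L with
    | nil => exact ⟨[], .nil⟩
    | cons b L ih =>
      obtain ⟨k, hk⟩ := hkey b (by simp)
      obtain ⟨K, hK⟩ := ih fun c hc => hkey c (by simp [hc])
      exact ⟨k :: K, .cons hk hK⟩
  refine ⟨K, hK, fun n => ?_⟩
  by_contra! hlt
  obtain ⟨L', hs, hf⟩ := exists_sublist_forall₂ (List.replicate_sublist_iff.2 hlt) hK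
  obtain ⟨b₁, _, h1, hf₁, rfl⟩ := List.forall₂_cons_right_iff.1 hf
  obtain ⟨b₂, _, h2, hf₂, rfl⟩ := List.forall₂_cons_right_iff.1 hf₁
  obtain rfl := List.forall₂_nil_right_iff.1 hf₂
  have hvb : ∀ {b}, HasKey ζ N b (.v true n) → T3vb ζ n b := by
    intro b hb
    cases hb with
    | vb hn => exact ⟨hn, rfl⟩
  exact h.2 n ⟨b₁, b₂, hs, hvb h1, hvb h2⟩

theorem exists_perm_forall₂ (hsq : ¬ IsSquare ζ)
    (hN : ∀ (q : F[X]) (m : ℕ), q.Monic → Irreducible q → 0 < m →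
      (∃ g : F[X], q = g.comp (X ^ 2)) → IsUnit (N (q ^ m)).det ∧ (N (q ^ m))ᵀ = N (q ^ m) ∧
        (N (q ^ m) * companion F (q ^ m))ᵀ = -(N (q ^ m) * companion F (q ^ m)))
    {L₁ L₂ : List (PBlock F)} (h1 : Canon3 ζ N L₁) (h2 : Canon3 ζ N L₂)
    (hcg : PCg (psum L₁) (psum L₂)) :
    ∃ L₂', L₁.Perm L₂' ∧ List.Forall₂ Equiv3 L₂' L₂ := by
  classical
  obtain ⟨K₁, hK₁, hc₁⟩ := h1.exists_keys
  obtain ⟨K₂, hK₂, hc₂⟩ := h2.exists_keys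
  have hperm := perm_of_pcg hsq hN hK₁ hK₂ hcg hc₁ hc₂
  obtain ⟨L₂', hf, hp⟩ := List.perm_comp_forall₂ hperm.symm hK₁.flip
  refine ⟨L₂', hp.symm, ?_⟩
  refine List.forall₂_iff_get.2 ⟨by rw [← hf.length_eq, hK₂.length_eq], fun i h h' => ?_⟩
  have hi : i < K₂.length := by rwa [← hK₂.length_eq]
  exact (hf.get hi h).equiv3 (hK₂.get h' hi)

end Uniqueness

theorem stmt3 (F : Type*) [Field F] [Fintype F] (hchar : (2 : F) ≠ 0)
    (ζ : F) (hζ : ¬ IsSquare ζ)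
    (Phim1 : (q : Polynomial F) → Mat F q.natDegree)
    (hPhim1 : ∀ (pp : Polynomial F) (l : ℕ), pp.Monic → Irreducible pp → 0 < l →
      (∃ g : Polynomial F, pp = g.comp (X ^ 2)) →
      IsUnit (Phim1 (pp ^ l)).det ∧ (Phim1 (pp ^ l))ᵀ = Phim1 (pp ^ l) ∧
        (Phim1 (pp ^ l) * companion F (pp ^ l))ᵀ = -(Phim1 (pp ^ l) * companion F (pp ^ l)))
    (n : ℕ) (A B : Mat F n) (hA : Aᵀ = A) (hB : Bᵀ = -B) :
    (∃ L : List (PBlock F), Canon3 ζ Phim1 L ∧ PCong ⟨n, (A, B)⟩ (psum L)) ∧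
    (∀ L₁ L₂ : List (PBlock F), Canon3 ζ Phim1 L₁ → Canon3 ζ Phim1 L₂ →
      PCong ⟨n, (A, B)⟩ (psum L₁) → PCong ⟨n, (A, B)⟩ (psum L₂) →
      ∃ L₂' : List (PBlock F), L₁.Perm L₂' ∧ List.Forall₂ Equiv3 L₂' L₂) := by
  refine ⟨exists_canonical_list hchar hζ hPhim1 hA hB, fun L₁ L₂ h₁ h₂ hp₁ hp₂ => ?_⟩
  exact exists_perm_forall₂ hζ hPhim1 h₁ h₂ (hp₁.pcg.symm.trans hp₂.pcg)

end Stmt3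
end
end Can
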